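/- (Theorem 2.3, part (2), Lᵖ case) Let m > 2 be an integer and ν = η = ε = 1. Let (u, b, π) be a smooth solution of the 2½-dimensional Hall-MHD system on [0,T) × ℝ², Schwartz-class in the space variable for each t, with sup_{0≤t≤T'} (‖u(t)‖_{Hᵐ} + ‖b(t)‖_{Hᵐ}) < ∞ for every T' < T. Suppose that for both k ∈ {1,2} there exist p_k ∈ (2,∞) and r_k ∈ [2,∞) with 2/p_k + 2/r_k ≤ 1 such that ∫₀ᵀ ‖Δ(Δu_k)(t,·)‖_{L^{p_k}(ℝ²)}^{r_k} dt < ∞, where u_k is the k-th component of the velocity and Δ = ∂₁² + ∂₂². Then sup_{0≤t<T} (‖u(t)‖_{Hᵐ} + ‖b(t)‖_{Hᵐ}) < ∞. -/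

import Mathlib

open MeasureTheory
open scoped ENNReal

noncomputable section

/-- Partial derivative in the `i`-th coordinate direction of `ℝ²`. -/
def pd (i : Fin 2) (f : (Fin 2 → ℝ) → ℝ) (x : Fin 2 → ℝ) : ℝ :=
  fderiv ℝ f x (Pi.single i 1)

/-- The Laplacian `Δ = ∂₁² + ∂₂²` of a scalar function on `ℝ²`. -/
def lap (f : (Fin 2 → ℝ) → ℝ) (x : Fin 2 → ℝ) : ℝ :=
  pd 0 (pd 0 f) x + pd 1 (pd 1 f) x

/-- The 2½-dimensional curl `∇×F = (∂₂F₃, −∂₁F₃, ∂₁F₂ − ∂₂F₁)` of `F : ℝ² → ℝ³`. -/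
def curl (F : (Fin 2 → ℝ) → (Fin 3 → ℝ)) (x : Fin 2 → ℝ) : Fin 3 → ℝ :=
  ![pd 1 (fun y => F y 2) x, -(pd 0 (fun y => F y 2) x),
    pd 0 (fun y => F y 1) x - pd 1 (fun y => F y 0) x]

/-- The advection term `(f·∇)g = f₁∂₁g + f₂∂₂g` for `f, g : ℝ² → ℝ³`. -/
def advect (f g : (Fin 2 → ℝ) → (Fin 3 → ℝ)) (x : Fin 2 → ℝ) (i : Fin 3) : ℝ :=
  f x 0 * pd 0 (fun y => g y i) x + f x 1 * pd 1 (fun y => g y i) x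

/-- A function is Schwartz-class: it is smooth and all its iterated derivatives decay
faster than any polynomial. -/
def IsSchwartz {F : Type*} [NormedAddCommGroup F] [NormedSpace ℝ F]
    (f : (Fin 2 → ℝ) → F) : Prop :=
  ContDiff ℝ (⊤ : ℕ∞) f ∧
    ∀ k n : ℕ, ∃ C : ℝ, ∀ x, ‖x‖ ^ k * ‖iteratedFDeriv ℝ n f x‖ ≤ C

/-- A smooth solution of the 2½-dimensional Hall-MHD system on `S × ℝ²`, Schwartz-class in
the space variable for each time `t ∈ S`:
`∂ₜu + (u·∇)u + ∇π = νΔu + (b·∇)b`, `∂ₜb + (u·∇)b = ηΔb + (b·∇)u − ε∇×(j×b)`,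
`∂₁u₁ + ∂₂u₂ = 0`, `∂₁b₁ + ∂₂b₂ = 0`, where `j = ∇×b`. -/
structure IsHallMHDSolution (ν η ε : ℝ) (S : Set ℝ)
    (u b : ℝ → (Fin 2 → ℝ) → (Fin 3 → ℝ)) (π : ℝ → (Fin 2 → ℝ) → ℝ) : Prop where
  smooth_u : ContDiffOn ℝ (⊤ : ℕ∞) (fun p : ℝ × (Fin 2 → ℝ) => u p.1 p.2) (S ×ˢ Set.univ)
  smooth_b : ContDiffOn ℝ (⊤ : ℕ∞) (fun p : ℝ × (Fin 2 → ℝ) => b p.1 p.2) (S ×ˢ Set.univ)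
  smooth_pi : ContDiffOn ℝ (⊤ : ℕ∞) (fun p : ℝ × (Fin 2 → ℝ) => π p.1 p.2) (S ×ˢ Set.univ)
  schwartz_u : ∀ t ∈ S, IsSchwartz (u t)
  schwartz_b : ∀ t ∈ S, IsSchwartz (b t)
  schwartz_pi : ∀ t ∈ S, IsSchwartz (π t)
  div_u : ∀ t ∈ S, ∀ x, pd 0 (fun y => u t y 0) x + pd 1 (fun y => u t y 1) x = 0
  div_b : ∀ t ∈ S, ∀ x, pd 0 (fun y => b t y 0) x + pd 1 (fun y => b t y 1) x = 0
  momentum : ∀ t ∈ S, ∀ x, ∀ i : Fin 3,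
    deriv (fun s => u s x i) t + advect (u t) (u t) x i
        + ![pd 0 (π t) x, pd 1 (π t) x, 0] i
      = ν * lap (fun y => u t y i) x + advect (b t) (b t) x i
  induction : ∀ t ∈ S, ∀ x, ∀ i : Fin 3,
    deriv (fun s => b s x i) t + advect (u t) (b t) x i
      = η * lap (fun y => b t y i) x + advect (b t) (u t) x i
        - ε * curl (fun y => crossProduct (curl (b t) y) (b t y)) x i

/-- The `Hᵐ(ℝ²)` norm: `‖f‖_{Hᵐ} = (∑_{k=0}^{m} ∫ ‖Dᵏf(x)‖² dx)^{1/2}`. -/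
def hSobNorm (m : ℕ) (f : (Fin 2 → ℝ) → (Fin 3 → ℝ)) : ℝ :=
  Real.sqrt (∑ k ∈ Finset.range (m + 1), ∫ x, ‖iteratedFDeriv ℝ k f x‖ ^ 2)

end


section Part1
open MeasureTheory Set Filter Topology
open scoped ENNReal ContDiff SchwartzMap

noncomputable section

/-- The plane. -/
abbrev E2 := Fin 2 → ℝ

/-- Scalar Schwartz functions on the plane. -/
def Sch (f : E2 → ℝ) : Prop := IsSchwartz f

theorem Sch.toS {f : E2 → ℝ} (h : Sch f) : ∃ g : 𝓢(E2, ℝ), ⇑g = f :=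
  ⟨⟨f, h.1, h.2⟩, rfl⟩

theorem sch_coe (g : 𝓢(E2, ℝ)) : Sch g := ⟨g.smooth', g.decay'⟩

theorem Sch.contDiff {f : E2 → ℝ} (h : Sch f) : ContDiff ℝ ∞ f := h.1

theorem Sch.diff {f : E2 → ℝ} (h : Sch f) : Differentiable ℝ f :=
  h.1.differentiable (by simp)

theorem Sch.cont {f : E2 → ℝ} (h : Sch f) : Continuous f := h.1.continuous

@[simp] theorem Sch.add {f g : E2 → ℝ} (hf : Sch f) (hg : Sch g) : Sch (f + g) := by
  obtain ⟨f, rfl⟩ := hf.toS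
  obtain ⟨g, rfl⟩ := hg.toS
  exact sch_coe (f + g)

@[simp] theorem Sch.sub {f g : E2 → ℝ} (hf : Sch f) (hg : Sch g) : Sch (f - g) := by
  obtain ⟨f, rfl⟩ := hf.toS
  obtain ⟨g, rfl⟩ := hg.toS
  exact sch_coe (f - g)

@[simp] theorem Sch.neg {f : E2 → ℝ} (hf : Sch f) : Sch (-f) := by
  obtain ⟨f, rfl⟩ := hf.toS
  exact sch_coe (-f)

@[simp] theorem Sch.zero : Sch 0 := sch_coe 0

@[simp] theorem Sch.smul {f : E2 → ℝ} (c : ℝ) (hf : Sch f) : Sch (c • f) := by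
  obtain ⟨f, rfl⟩ := hf.toS
  exact sch_coe (c • f)

@[simp] theorem Sch.mul {f g : E2 → ℝ} (hf : Sch f) (hg : Sch g) : Sch (f * g) := by
  obtain ⟨f, rfl⟩ := hf.toS
  obtain ⟨g, rfl⟩ := hg.toS
  have := sch_coe (SchwartzMap.pairing (ContinuousLinearMap.mul ℝ ℝ) f g)
  convert this using 1
  ext x
  simp [SchwartzMap.pairing_apply_apply]

@[simp] theorem Sch.pd {f : E2 → ℝ} (hf : Sch f) (i : Fin 2) : Sch (pd i f) := by
  obtain ⟨f, rfl⟩ := hf.toS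
  have := sch_coe (SchwartzMap.evalCLM ℝ E2 ℝ (Pi.single i 1) (SchwartzMap.fderivCLM ℝ E2 ℝ f))
  convert this using 1
  ext x
  rfl

theorem Sch.of_compact {f : E2 → ℝ} (h : HasCompactSupport f) (h2 : ContDiff ℝ ∞ f) : Sch f :=
  sch_coe (h.toSchwartzMap h2)

theorem Sch.integrable {f : E2 → ℝ} (hf : Sch f) : Integrable f := by
  obtain ⟨f, rfl⟩ := hf.toS
  exact f.integrable

theorem Sch.memLp {f : E2 → ℝ} (hf : Sch f) (p : ℝ≥0∞) : MemLp f p := by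
  obtain ⟨f, rfl⟩ := hf.toS
  exact f.memLp p

theorem Sch.bdd {f : E2 → ℝ} (hf : Sch f) : ∃ C, 0 ≤ C ∧ ∀ x, |f x| ≤ C := by
  obtain ⟨C, hC⟩ := hf.2 0 0
  refine ⟨C, ?_, fun x => ?_⟩
  · have := hC 0
    simp at this
    exact (abs_nonneg _).trans this
  · simpa using hC x

/-! ### calculus of `pd` -/

theorem pd_add {f g : E2 → ℝ} (hf : Sch f) (hg : Sch g) (i : Fin 2) :
    pd i (f + g) = pd i f + pd i g := by
  ext x
  simp only [pd, Pi.add_apply]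
  rw [fderiv_add (hf.diff x) (hg.diff x)]; rfl

theorem pd_sub {f g : E2 → ℝ} (hf : Sch f) (hg : Sch g) (i : Fin 2) :
    pd i (f - g) = pd i f - pd i g := by
  ext x
  simp only [pd, Pi.sub_apply]
  rw [fderiv_sub (hf.diff x) (hg.diff x)]; rfl

theorem pd_neg (f : E2 → ℝ) (i : Fin 2) : pd i (-f) = - pd i f := by
  ext x
  simp only [pd, Pi.neg_apply]
  rw [fderiv_neg]; rfl

theorem pd_zero (i : Fin 2) : pd i (0 : E2 → ℝ) = 0 := by
  ext x
  simp [pd]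

theorem pd_smul {f : E2 → ℝ} (c : ℝ) (hf : Sch f) (i : Fin 2) :
    pd i (c • f) = c • pd i f := by
  ext x
  simp only [pd, Pi.smul_apply]
  rw [fderiv_const_smul (hf.diff x)]; rfl

theorem pd_mul {f g : E2 → ℝ} (hf : Sch f) (hg : Sch g) (i : Fin 2) :
    pd i (f * g) = pd i f * g + f * pd i g := by
  ext x
  simp only [pd, Pi.add_apply, Pi.mul_apply]
  rw [fderiv_mul (hf.diff x) (hg.diff x)]
  simp; ring

theorem pd_comm_of_contDiff {f : E2 → ℝ} (hf : ContDiff ℝ ∞ f) (i j : Fin 2) :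
    pd i (pd j f) = pd j (pd i f) := by
  have hd : Differentiable ℝ (fderiv ℝ f) :=
    (hf.fderiv_right (m := 1) (by norm_cast)).differentiable (by simp)
  have key : ∀ (a b : Fin 2) (x : E2), pd a (pd b f) x =
      (fderiv ℝ (fderiv ℝ f) x (Pi.single a 1)) (Pi.single b 1) := by
    intro a b x
    have h1 : HasFDerivAt (fun y => fderiv ℝ f y (Pi.single b 1))
        ((ContinuousLinearMap.apply ℝ ℝ (Pi.single b 1 : E2)).comp
          (fderiv ℝ (fderiv ℝ f) x)) x :=
      (ContinuousLinearMap.apply ℝ ℝ (Pi.single b 1 : E2)).hasFDerivAt.comp x (hd x).hasFDerivAt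
    change fderiv ℝ (fun y => fderiv ℝ f y (Pi.single b 1)) x (Pi.single a 1) = _
    rw [h1.fderiv]; rfl
  ext x
  rw [key, key]
  have hs : IsSymmSndFDerivAt ℝ f x :=
    (hf.contDiffAt).isSymmSndFDerivAt (by simp; norm_cast)
  exact hs _ _

theorem pd_comm {f : E2 → ℝ} (hf : Sch f) (i j : Fin 2) :
    pd i (pd j f) = pd j (pd i f) := pd_comm_of_contDiff hf.contDiff i j

theorem lap_eq (f : E2 → ℝ) : lap f = pd 0 (pd 0 f) + pd 1 (pd 1 f) := rfl

@[simp] theorem Sch.lap {f : E2 → ℝ} (hf : Sch f) : Sch (lap f) := by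
  exact ((hf.pd 0).pd 0).add ((hf.pd 1).pd 1)

theorem pd_lap {f : E2 → ℝ} (hf : Sch f) (i : Fin 2) : pd i (lap f) = lap (pd i f) := by
  rw [lap_eq, lap_eq, pd_add (by simp [hf]) (by simp [hf])]
  rw [pd_comm (hf.pd 0) i 0, pd_comm hf i 0, pd_comm (hf.pd 1) i 1, pd_comm hf i 1]

theorem lap_add {f g : E2 → ℝ} (hf : Sch f) (hg : Sch g) : lap (f + g) = lap f + lap g := by
  simp only [lap_eq, pd_add hf hg, pd_add (hf.pd _) (hg.pd _)]
  ring

theorem lap_sub {f g : E2 → ℝ} (hf : Sch f) (hg : Sch g) : lap (f - g) = lap f - lap g := by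
  simp only [lap_eq, pd_sub hf hg, pd_sub (hf.pd _) (hg.pd _)]
  ring

/-! ### integrals -/

theorem integral_pd {f : E2 → ℝ} (hf : Sch f) (i : Fin 2) : ∫ x, pd i f x = 0 := by
  have h1 : Integrable (fun x => fderiv ℝ f x (Pi.single i 1)) (volume : Measure E2) :=
    (hf.pd i).integrable
  have := integral_mul_fderiv_eq_neg_fderiv_mul_of_integrable (μ := (volume : Measure E2))
    (f := fun _ : E2 => (1 : ℝ)) (g := f) (v := Pi.single i 1) (by simp)
    (by simpa using h1) (by simpa using hf.integrable)
    (by intro x _; fun_prop) (by intro x _; exact hf.diff x)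
  simpa [pd] using this

theorem ibp {f g : E2 → ℝ} (hf : Sch f) (hg : Sch g) (i : Fin 2) :
    ∫ x, f x * pd i g x = - ∫ x, pd i f x * g x := by
  have h := integral_pd (hf.mul hg) i
  rw [pd_mul hf hg] at h
  have h2 : ∫ x, (pd i f * g + f * pd i g) x = (∫ x, pd i f x * g x) + ∫ x, f x * pd i g x :=
    integral_add ((hf.pd i).mul hg).integrable (hf.mul (hg.pd i)).integrable
  linarith

theorem Sch.integrable_mul {f g : E2 → ℝ} (hf : Sch f) (hg : Sch g) :
    Integrable (fun x => f x * g x) := (hf.mul hg).integrable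

theorem Sch.integrable_sq {f : E2 → ℝ} (hf : Sch f) : Integrable (fun x => f x ^ 2) := by
  have := (hf.mul hf).integrable
  refine this.congr (Eventually.of_forall fun x => ?_)
  simp [sq]

/-- squared L² norm -/
def nn (f : E2 → ℝ) : ℝ := ∫ x, f x ^ 2

theorem nn_nonneg (f : E2 → ℝ) : 0 ≤ nn f := integral_nonneg fun x => sq_nonneg _

theorem nn_add_le {f g : E2 → ℝ} (hf : Sch f) (hg : Sch g) : nn (f + g) ≤ 2 * nn f + 2 * nn g := by
  unfold nn
  rw [← integral_const_mul, ← integral_const_mul, ← integral_add]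
  · apply integral_mono (hf.add hg).integrable_sq
    · exact (hf.integrable_sq.const_mul 2).add (hg.integrable_sq.const_mul 2)
    · intro x
      simp only [Pi.add_apply]
      nlinarith [sq_nonneg (f x - g x)]
  · exact (hf.integrable_sq.const_mul 2)
  · exact (hg.integrable_sq.const_mul 2)

theorem nn_neg (f : E2 → ℝ) : nn (-f) = nn f := by simp [nn]

theorem nn_zero : nn 0 = 0 := by simp [nn]

theorem nn_sub_le {f g : E2 → ℝ} (hf : Sch f) (hg : Sch g) : nn (f - g) ≤ 2 * nn f + 2 * nn g := by
  rw [sub_eq_add_neg, ← nn_neg g]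
  exact nn_add_le hf hg.neg

/-- Cauchy–Schwarz -/
theorem cs {f g : E2 → ℝ} (hf : Sch f) (hg : Sch g) :
    ∫ x, |f x * g x| ≤ Real.sqrt (nn f) * Real.sqrt (nn g) := by
  have := integral_mul_norm_le_Lp_mul_Lq (μ := (volume : Measure E2)) (f := f) (g := g)
    (p := 2) (q := 2) (by constructor <;> norm_num) (by simpa using hf.memLp 2)
    (by simpa using hg.memLp 2)
  simp only [Real.norm_eq_abs] at this
  simp only [abs_mul]
  refine this.trans (le_of_eq ?_)
  simp [nn, Real.sqrt_eq_rpow]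

theorem cs' {f g : E2 → ℝ} (hf : Sch f) (hg : Sch g) :
    |∫ x, f x * g x| ≤ Real.sqrt (nn f) * Real.sqrt (nn g) :=
  (abs_integral_le_integral_abs).trans (cs hf hg)

end

end Part1

section Part2
open MeasureTheory Set Filter Topology
open scoped ENNReal ContDiff SchwartzMap

noncomputable section

/-! ### Sobolev-type norms -/

/-- squared `H^s` norm, defined by recursion -/
def hs : ℕ → (E2 → ℝ) → ℝ
  | 0, f => nn f
  | s + 1, f => nn f + (hs s (pd 0 f) + hs s (pd 1 f))

theorem hs_zero_eq (f : E2 → ℝ) : hs 0 f = nn f := rfl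

theorem hs_succ (s : ℕ) (f : E2 → ℝ) :
    hs (s + 1) f = nn f + (hs s (pd 0 f) + hs s (pd 1 f)) := rfl

theorem hs_nonneg (s : ℕ) : ∀ f : E2 → ℝ, 0 ≤ hs s f := by
  induction s with
  | zero => exact nn_nonneg
  | succ s ih => intro f; have := nn_nonneg f; have := ih (pd 0 f); have := ih (pd 1 f); rw [hs_succ]; linarith

theorem nn_le_hs (s : ℕ) (f : E2 → ℝ) : nn f ≤ hs s f := by
  cases s with
  | zero => exact le_rfl
  | succ s => rw [hs_succ]; have := hs_nonneg s (pd 0 f); have := hs_nonneg s (pd 1 f); linarith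

theorem hs_le_succ (s : ℕ) : ∀ f : E2 → ℝ, hs s f ≤ hs (s + 1) f := by
  induction s with
  | zero => intro f; exact nn_le_hs 1 f
  | succ s ih => intro f; rw [hs_succ, hs_succ (s + 1)]; have := ih (pd 0 f); have := ih (pd 1 f); linarith

theorem hs_mono {s s' : ℕ} (h : s ≤ s') (f : E2 → ℝ) : hs s f ≤ hs s' f := by
  induction h with
  | refl => exact le_rfl
  | step _ ih => exact ih.trans (hs_le_succ _ f)

theorem hs_pd_le (s : ℕ) (f : E2 → ℝ) (i : Fin 2) : hs s (pd i f) ≤ hs (s + 1) f := by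
  rw [hs_succ]
  have := hs_nonneg s (pd 0 f); have := hs_nonneg s (pd 1 f); have := nn_nonneg f
  fin_cases i <;> simp <;> linarith

theorem hs_add_le (s : ℕ) : ∀ {f g : E2 → ℝ}, Sch f → Sch g →
    hs s (f + g) ≤ 2 * hs s f + 2 * hs s g := by
  induction s with
  | zero => intro f g hf hg; exact nn_add_le hf hg
  | succ s ih =>
    intro f g hf hg
    simp only [hs_succ, pd_add hf hg]
    have := nn_add_le hf hg
    have := ih (hf.pd 0) (hg.pd 0)
    have := ih (hf.pd 1) (hg.pd 1)
    linarith

theorem hs_neg (s : ℕ) : ∀ f : E2 → ℝ, hs s (-f) = hs s f := by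
  induction s with
  | zero => exact nn_neg
  | succ s ih => intro f; simp only [hs_succ, pd_neg, nn_neg, ih]

theorem hs_sub_le (s : ℕ) {f g : E2 → ℝ} (hf : Sch f) (hg : Sch g) :
    hs s (f - g) ≤ 2 * hs s f + 2 * hs s g := by
  rw [sub_eq_add_neg, ← hs_neg s g]
  exact hs_add_le s hf hg.neg

theorem hs_zero_fun (s : ℕ) : hs s (0 : E2 → ℝ) = 0 := by
  induction s with
  | zero => exact nn_zero
  | succ s ih => rw [hs_succ, pd_zero, pd_zero, ih, nn_zero]; simp

/-! ### one-dimensional slices -/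

theorem Sch.decay2 {f : E2 → ℝ} (hf : Sch f) :
    ∃ C, 0 ≤ C ∧ ∀ a b : ℝ, |f ![a, b]| ≤ C * ((1 + a ^ 2)⁻¹ * (1 + b ^ 2)⁻¹) := by
  obtain ⟨C0, h0⟩ := hf.2 0 0
  obtain ⟨C2, h2⟩ := hf.2 2 0
  obtain ⟨C4, h4⟩ := hf.2 4 0
  simp only [norm_iteratedFDeriv_zero, Real.norm_eq_abs] at h0 h2 h4
  have key : ∀ a b : ℝ, |f ![a, b]| * ((1 + a ^ 2) * (1 + b ^ 2)) ≤ C0 + 2 * C2 + C4 := by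
    intro a b
    have e0 := h0 ![a, b]; have e2 := h2 ![a, b]; have e4 := h4 ![a, b]
    have ha : a ^ 2 ≤ ‖(![a, b] : E2)‖ ^ 2 := by
      have := norm_le_pi_norm (![a, b] : E2) 0
      simp at this
      exact sq_le_sq' (by linarith [neg_abs_le a]) (by linarith [le_abs_self a])
    have hb : b ^ 2 ≤ ‖(![a, b] : E2)‖ ^ 2 := by
      have := norm_le_pi_norm (![a, b] : E2) 1
      simp at this
      exact sq_le_sq' (by linarith [neg_abs_le b]) (by linarith [le_abs_self b])
    set N := ‖(![a, b] : E2)‖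
    set y := |f ![a, b]|
    have hy : 0 ≤ y := abs_nonneg _
    have : (1 + a ^ 2) * (1 + b ^ 2) ≤ (1 + N ^ 2) * (1 + N ^ 2) := by gcongr
    have := mul_le_mul_of_nonneg_left this hy
    nlinarith
  refine ⟨C0 + 2 * C2 + C4, ?_, fun a b => ?_⟩
  · have := key 0 0
    have h : 0 ≤ |f ![0, 0]| * ((1 + (0:ℝ) ^ 2) * (1 + (0:ℝ) ^ 2)) := by positivity
    linarith
  · rw [← mul_inv, ← div_eq_mul_inv, le_div_iff₀ (by positivity)]
    exact key a b

theorem Sch.int0 {f : E2 → ℝ} (hf : Sch f) (b : ℝ) : Integrable (fun a => f ![a, b]) := by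
  obtain ⟨C, hC, h⟩ := hf.decay2
  refine ((integrable_inv_one_add_sq).const_mul (C * (1 + b ^ 2)⁻¹)).mono'
    (by have := hf.cont; exact Continuous.aestronglyMeasurable (by fun_prop)) (Eventually.of_forall fun a => ?_)
  rw [Real.norm_eq_abs]
  refine (h a b).trans (le_of_eq (by ring))

theorem Sch.int1 {f : E2 → ℝ} (hf : Sch f) (a : ℝ) : Integrable (fun b => f ![a, b]) := by
  obtain ⟨C, hC, h⟩ := hf.decay2
  refine ((integrable_inv_one_add_sq).const_mul (C * (1 + a ^ 2)⁻¹)).mono'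
    (by have := hf.cont; exact Continuous.aestronglyMeasurable (by fun_prop)) (Eventually.of_forall fun b => ?_)
  rw [Real.norm_eq_abs]
  refine (h a b).trans (le_of_eq (by ring))

theorem Sch.deriv0 {f : E2 → ℝ} (hf : Sch f) (a b : ℝ) :
    HasDerivAt (fun a => f ![a, b]) (_root_.pd 0 f ![a, b]) a := by
  have h1 : HasDerivAt (fun a : ℝ => (![a, b] : E2)) (Pi.single 0 1) a := by
    rw [hasDerivAt_pi]
    intro i
    fin_cases i
    · simpa using hasDerivAt_id' a
    · simpa using hasDerivAt_const a b
  exact (hf.diff _).hasFDerivAt.comp_hasDerivAt a h1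

theorem Sch.deriv1 {f : E2 → ℝ} (hf : Sch f) (a b : ℝ) :
    HasDerivAt (fun b => f ![a, b]) (_root_.pd 1 f ![a, b]) b := by
  have h1 : HasDerivAt (fun b : ℝ => (![a, b] : E2)) (Pi.single 1 1) b := by
    rw [hasDerivAt_pi]
    intro i
    fin_cases i
    · simpa using hasDerivAt_const b a
    · simpa using hasDerivAt_id' b
  exact (hf.diff _).hasFDerivAt.comp_hasDerivAt b h1

theorem abs_le_integral_of_deriv {h h' : ℝ → ℝ} (hd : ∀ s, HasDerivAt h (h' s) s)
    (hi : Integrable h) (hi' : Integrable h') (a : ℝ) : |h a| ≤ ∫ s, |h' s| := by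
  have ht := tendsto_zero_of_hasDerivAt_of_integrableOn_Iic (a := a) (f := h) (f' := h') (fun x _ => hd x)
    hi'.integrableOn hi.integrableOn
  have := integral_Iic_of_hasDerivAt_of_tendsto' (a := a) (fun x _ => hd x) hi'.integrableOn ht
  rw [sub_zero] at this
  rw [← this]
  refine (abs_integral_le_integral_abs).trans ?_
  exact setIntegral_le_integral hi'.abs (Eventually.of_forall fun x => abs_nonneg _)

theorem integral_E2 {f : E2 → ℝ} : ∫ x, f x = ∫ p : ℝ × ℝ, f ![p.1, p.2] := by
  have h := (volume_preserving_finTwoArrow ℝ).symm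
  rw [← h.integral_comp (MeasurableEquiv.measurableEmbedding _)]
  rfl

theorem integrable_E2 {f : E2 → ℝ} : Integrable (fun p : ℝ × ℝ => f ![p.1, p.2]) ↔ Integrable f := by
  have h := (volume_preserving_finTwoArrow ℝ).symm
  rw [← h.integrable_comp_emb (MeasurableEquiv.measurableEmbedding _)]
  rfl

theorem vec2_eta (x : E2) : ![x 0, x 1] = x := by
  ext i; fin_cases i <;> rfl

theorem Sch.integrable_abs {f : E2 → ℝ} (hf : Sch f) : Integrable (fun x => |f x|) := hf.integrable.abs

theorem nn_mul_le {f g : E2 → ℝ} (hf : Sch f) (hg : Sch g) :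
    nn (f * g) ≤ 4 * (√(nn f) * √(nn (pd 0 f))) * (√(nn g) * √(nn (pd 1 g))) := by
  have hF := hf.mul hf
  have hG := hg.mul hg
  let S : ℝ → ℝ := fun b => ∫ a, |pd 0 (f * f) ![a, b]|
  let R : ℝ → ℝ := fun a => ∫ b, |pd 1 (g * g) ![a, b]|
  have iF : Integrable (fun p : ℝ × ℝ => |pd 0 (f * f) ![p.1, p.2]|) :=
    integrable_E2.2 (hF.pd 0).integrable_abs
  have iG : Integrable (fun p : ℝ × ℝ => |pd 1 (g * g) ![p.1, p.2]|) :=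
    integrable_E2.2 (hG.pd 1).integrable_abs
  have hS : Integrable S := iF.integral_prod_right
  have hR : Integrable R := iG.integral_prod_left
  have b1 : ∀ a b, (f ![a, b]) ^ 2 ≤ S b := fun a b => by
    have := abs_le_integral_of_deriv (fun s => hF.deriv0 s b) (hF.int0 b) ((hF.pd 0).int0 b) a
    simp only [Pi.mul_apply] at this
    rw [sq]; exact (le_abs_self _).trans this
  have b2 : ∀ a b, (g ![a, b]) ^ 2 ≤ R a := fun a b => by
    have := abs_le_integral_of_deriv (fun s => hG.deriv1 a s) (hG.int1 a) ((hG.pd 1).int1 a) b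
    simp only [Pi.mul_apply] at this
    rw [sq]; exact (le_abs_self _).trans this
  have iSR : ∫ b, S b = ∫ x, |pd 0 (f * f) x| := by
    rw [integral_E2, Measure.volume_eq_prod, integral_prod_symm _ (by rwa [← Measure.volume_eq_prod])]
  have iRR : ∫ b, R b = ∫ x, |pd 1 (g * g) x| := by
    rw [integral_E2, Measure.volume_eq_prod, integral_prod _ (by rwa [← Measure.volume_eq_prod])]
  have c1 : ∫ x, |pd 0 (f * f) x| ≤ 2 * (√(nn f) * √(nn (pd 0 f))) := by
    have : ∀ x, |pd 0 (f * f) x| = 2 * |f x * pd 0 f x| := fun x => by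
      rw [pd_mul hf hf]; simp only [Pi.add_apply, Pi.mul_apply]
      rw [show pd 0 f x * f x + f x * pd 0 f x = 2 * (f x * pd 0 f x) by ring, abs_mul]; simp
    simp only [this]
    rw [integral_const_mul]
    have := cs hf (hf.pd 0)
    linarith
  have c2 : ∫ x, |pd 1 (g * g) x| ≤ 2 * (√(nn g) * √(nn (pd 1 g))) := by
    have : ∀ x, |pd 1 (g * g) x| = 2 * |g x * pd 1 g x| := fun x => by
      rw [pd_mul hg hg]; simp only [Pi.add_apply, Pi.mul_apply]
      rw [show pd 1 g x * g x + g x * pd 1 g x = 2 * (g x * pd 1 g x) by ring, abs_mul]; simp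
    simp only [this]
    rw [integral_const_mul]
    have := cs hg (hg.pd 1)
    linarith
  have hmain : nn (f * g) ≤ (∫ a, R a) * ∫ b, S b := by
    rw [← integral_prod_mul, ← Measure.volume_eq_prod]
    unfold nn
    rw [integral_E2]
    apply integral_mono
    · exact integrable_E2.2 (hf.mul hg).integrable_sq
    · have := hR.mul_prod hS
      rwa [← Measure.volume_eq_prod] at this
    · intro p
      simp only [Pi.mul_apply]
      rw [mul_pow, mul_comm]
      exact mul_le_mul (b2 _ _) (b1 _ _) (sq_nonneg _) ((sq_nonneg _).trans (b2 p.1 p.2))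
  rw [iSR, iRR] at hmain
  refine hmain.trans ?_
  calc (∫ x, |pd 1 (g * g) x|) * ∫ x, |pd 0 (f * f) x|
      ≤ (2 * (√(nn g) * √(nn (pd 1 g)))) * (2 * (√(nn f) * √(nn (pd 0 f)))) := by
        gcongr
    _ = _ := by ring

theorem sqrt_mul_sqrt_le {a b c : ℝ} (hc : 0 ≤ c) (ha : a ≤ c) (hb : b ≤ c) :
    √a * √b ≤ c := by
  calc √a * √b ≤ √c * √c := by gcongr
    _ = c := Real.mul_self_sqrt hc

theorem sup_le_aux {f : E2 → ℝ} (hf : Sch f) (x : E2) : f x ^ 2 ≤ 4 * hs 2 f := by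
  have hF := hf.mul hf
  let S : ℝ → ℝ := fun a => |pd 0 (f * f) ![a, x 1]|
  have h1 : f x ^ 2 ≤ ∫ a, |pd 0 (f * f) ![a, x 1]| := by
    have := abs_le_integral_of_deriv (fun s => hF.deriv0 s (x 1)) (hF.int0 _) ((hF.pd 0).int0 _) (x 0)
    simp only [Pi.mul_apply] at this
    rw [vec2_eta] at this
    rw [sq]; exact (le_abs_self _).trans this
  have hH := (hF.pd 0).pd 1
  have iH : Integrable (fun p : ℝ × ℝ => |pd 1 (pd 0 (f * f)) ![p.1, p.2]|) :=
    integrable_E2.2 hH.integrable_abs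
  have h2 : ∫ a, |pd 0 (f * f) ![a, x 1]| ≤ ∫ a, ∫ b, |pd 1 (pd 0 (f * f)) ![a, b]| := by
    apply integral_mono ((hF.pd 0).int0 _).abs iH.integral_prod_left
    intro a
    exact abs_le_integral_of_deriv (fun s => (hF.pd 0).deriv1 a s) ((hF.pd 0).int1 a) (hH.int1 a) (x 1)
  have h3 : ∫ a, ∫ b, |pd 1 (pd 0 (f * f)) ![a, b]| = ∫ x, |pd 1 (pd 0 (f * f)) x| := by
    rw [integral_E2, Measure.volume_eq_prod, integral_prod _ (by rwa [← Measure.volume_eq_prod])]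
  have h4 : ∫ x, |pd 1 (pd 0 (f * f)) x| ≤
      2 * (∫ x, |pd 1 f x * pd 0 f x|) + 2 * ∫ x, |f x * pd 1 (pd 0 f) x| := by
    rw [← integral_const_mul, ← integral_const_mul, ← integral_add]
    · apply integral_mono hH.integrable_abs
      · exact ((((hf.pd 1).mul (hf.pd 0)).integrable_abs).const_mul 2).add
          (((hf.mul ((hf.pd 0).pd 1)).integrable_abs).const_mul 2)
      · intro x
        have : pd 1 (pd 0 (f * f)) x = 2 * (pd 1 f x * pd 0 f x) + 2 * (f x * pd 1 (pd 0 f) x) := by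
          rw [pd_mul hf hf, pd_add ((hf.pd 0).mul hf) (hf.mul (hf.pd 0)), pd_mul (hf.pd 0) hf,
            pd_mul hf (hf.pd 0)]
          simp only [Pi.add_apply, Pi.mul_apply]; ring
        simp only [this]
        refine (abs_add_le _ _).trans ?_
        rw [abs_mul 2, abs_mul 2]; simp
    · exact (((hf.pd 1).mul (hf.pd 0)).integrable_abs).const_mul 2
    · exact ((hf.mul ((hf.pd 0).pd 1)).integrable_abs).const_mul 2
  have h5 : (∫ x, |pd 1 f x * pd 0 f x|) ≤ hs 2 f :=
    (cs (hf.pd 1) (hf.pd 0)).trans (sqrt_mul_sqrt_le (hs_nonneg _ _)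
      ((nn_le_hs 1 _).trans (hs_pd_le 1 f 1)) ((nn_le_hs 1 _).trans (hs_pd_le 1 f 0)))
  have h6 : (∫ x, |f x * pd 1 (pd 0 f) x|) ≤ hs 2 f :=
    (cs hf ((hf.pd 0).pd 1)).trans (sqrt_mul_sqrt_le (hs_nonneg _ _)
      (nn_le_hs 2 _) ((hs_pd_le 0 _ 1).trans (hs_pd_le 1 f 0)))
  rw [h3] at h2
  linarith

theorem nn_mul_le_sup {f g : E2 → ℝ} (hf : Sch f) (hg : Sch g) {A : ℝ} (h : ∀ x, |f x| ≤ A) :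
    nn (f * g) ≤ A ^ 2 * nn g := by
  unfold nn
  rw [← integral_const_mul]
  apply integral_mono (hf.mul hg).integrable_sq (hg.integrable_sq.const_mul _)
  intro x
  simp only [Pi.mul_apply, mul_pow]
  rw [← sq_abs (f x)]
  have := h x
  gcongr

theorem nn_mul_le_sup' {f g : E2 → ℝ} (hf : Sch f) (hg : Sch g) {A : ℝ} (h : ∀ x, f x ^ 2 ≤ A) :
    nn (f * g) ≤ A * nn g := by
  unfold nn
  rw [← integral_const_mul]
  apply integral_mono (hf.mul hg).integrable_sq (hg.integrable_sq.const_mul _)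
  intro x
  simp only [Pi.mul_apply, mul_pow]
  gcongr
  exact h x

/-! ### product estimates -/

/-- the product estimate `‖fg‖_{H^s}² ≤ C ‖f‖_{H^i}² ‖g‖_{H^j}²` -/
def Pr (s i j : ℕ) : Prop := ∃ C : ℝ, 0 ≤ C ∧ ∀ f g : E2 → ℝ, Sch f → Sch g →
  hs s (f * g) ≤ C * (hs i f * hs j g)

theorem Pr.mono {s i j i' j' : ℕ} (h : Pr s i j) (hi : i ≤ i') (hj : j ≤ j') : Pr s i' j' := by
  obtain ⟨C, hC, h⟩ := h
  refine ⟨C, hC, fun f g hf hg => (h f g hf hg).trans ?_⟩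
  have := hs_mono hi f; have := hs_mono hj g
  have := hs_nonneg i' f; have := hs_nonneg j g
  gcongr

theorem Pr.symm {s i j : ℕ} (h : Pr s i j) : Pr s j i := by
  obtain ⟨C, hC, h⟩ := h
  refine ⟨C, hC, fun f g hf hg => ?_⟩
  rw [mul_comm f g, mul_comm (hs j f)]
  exact h g f hg hf

theorem Pr.step {s i j : ℕ} (h1 : Pr s i (j + 1)) (h2 : Pr s (i + 1) j) :
    Pr (s + 1) (i + 1) (j + 1) := by
  obtain ⟨C, hC, h1⟩ := h1
  obtain ⟨D, hD, h2⟩ := h2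
  refine ⟨C + 4 * (C + D), by positivity, fun f g hf hg => ?_⟩
  rw [hs_succ]
  have e0 : nn (f * g) ≤ C * (hs (i + 1) f * hs (j + 1) g) := by
    refine (nn_le_hs s _).trans ((h1 f g hf hg).trans ?_)
    have := hs_le_succ i f; have := hs_nonneg (j + 1) g
    gcongr
  have e : ∀ k, hs s (pd k (f * g)) ≤ 2 * (C + D) * (hs (i + 1) f * hs (j + 1) g) := by
    intro k
    rw [pd_mul hf hg]
    have a0 := hs_add_le s ((hf.pd k).mul hg) (hf.mul (hg.pd k))
    have a1 := h1 _ _ (hf.pd k) hg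
    have a2 := h2 _ _ hf (hg.pd k)
    have a3 : C * (hs i (pd k f) * hs (j + 1) g) ≤ C * (hs (i + 1) f * hs (j + 1) g) := by
      have := hs_pd_le i f k; have := hs_nonneg (j + 1) g
      gcongr
    have a4 : D * (hs (i + 1) f * hs j (pd k g)) ≤ D * (hs (i + 1) f * hs (j + 1) g) := by
      have := hs_pd_le j g k; have := hs_nonneg (i + 1) f
      gcongr
    linarith
  have := e 0; have := e 1
  linarith

theorem Pr020 : Pr 0 2 0 := ⟨4, by norm_num, fun f g hf hg => by
  have := nn_mul_le_sup' hf hg (sup_le_aux hf)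
  rw [← mul_assoc]; exact this⟩

theorem Pr011 : Pr 0 1 1 := ⟨4, by norm_num, fun f g hf hg => by
  refine (nn_mul_le hf hg).trans ?_
  have h1 : √(nn f) * √(nn (pd 0 f)) ≤ hs 1 f :=
    sqrt_mul_sqrt_le (hs_nonneg _ _) (nn_le_hs 1 f) (hs_pd_le 0 f 0)
  have h2 : √(nn g) * √(nn (pd 1 g)) ≤ hs 1 g :=
    sqrt_mul_sqrt_le (hs_nonneg _ _) (nn_le_hs 1 g) (hs_pd_le 0 g 1)
  rw [mul_assoc]
  have := hs_nonneg 1 f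
  gcongr⟩

theorem Pr121 : Pr 1 2 1 := Pr.step Pr011 Pr020
theorem Pr112 : Pr 1 1 2 := Pr121.symm
theorem Pr222 : Pr 2 2 2 := Pr.step Pr112 Pr121
theorem Prsss {s : ℕ} (h : 2 ≤ s) : Pr s s s := by
  induction h with
  | refl => exact Pr222
  | step _ ih => exact Pr.step (ih.mono le_rfl (Nat.le_succ _)) (ih.mono (Nat.le_succ _) le_rfl)

/-- all derivatives of order at most `s` are bounded by `A` -/
def wb : ℕ → ℝ → (E2 → ℝ) → Prop
  | 0, A, f => ∀ x, |f x| ≤ A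
  | s + 1, A, f => (∀ x, |f x| ≤ A) ∧ (∀ k, wb s A (pd k f))

theorem wb.sup {s : ℕ} {A : ℝ} {f : E2 → ℝ} (h : wb s A f) : ∀ x, |f x| ≤ A := by
  cases s with
  | zero => exact h
  | succ s => exact h.1

theorem wb.pd' {s : ℕ} {A : ℝ} {f : E2 → ℝ} (h : wb (s + 1) A f) (k : Fin 2) : wb s A (pd k f) := h.2 k

theorem wb.pred {s : ℕ} : ∀ {A : ℝ} {f : E2 → ℝ}, wb (s + 1) A f → wb s A f := by
  induction s with
  | zero => intro A f h; exact h.1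
  | succ s ih => intro A f h; exact ⟨h.1, fun k => ih (h.2 k)⟩

theorem wb.mono_A {s : ℕ} {A B : ℝ} (hAB : A ≤ B) : ∀ {f : E2 → ℝ}, wb s A f → wb s B f := by
  induction s with
  | zero => intro f h x; exact (h x).trans hAB
  | succ s ih => intro f h; exact ⟨fun x => (h.1 x).trans hAB, fun k => ih (h.2 k)⟩

theorem wb_mul (s : ℕ) : ∃ C : ℝ, 0 ≤ C ∧ ∀ (A : ℝ) (f g : E2 → ℝ), Sch f → Sch g → wb s A f →
    hs s (f * g) ≤ C * (A ^ 2 * hs s g) := by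
  induction s with
  | zero => exact ⟨1, by norm_num, fun A f g hf hg h => by
      rw [one_mul]; exact nn_mul_le_sup hf hg h⟩
  | succ s ih =>
    obtain ⟨C, hC, ih⟩ := ih
    refine ⟨1 + 8 * C, by positivity, fun A f g hf hg h => ?_⟩
    rw [hs_succ]
    have e0 := nn_mul_le_sup hf hg h.sup
    have e1 : A ^ 2 * nn g ≤ A ^ 2 * hs (s + 1) g := by have := nn_le_hs (s + 1) g; gcongr
    have e : ∀ k, hs s (pd k (f * g)) ≤ 4 * C * (A ^ 2 * hs (s + 1) g) := by
      intro k
      rw [pd_mul hf hg]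
      have a0 := hs_add_le s ((hf.pd k).mul hg) (hf.mul (hg.pd k))
      have a1 := ih A _ _ (hf.pd k) hg (h.2 k)
      have a2 := ih A _ _ hf (hg.pd k) h.pred
      have a3 : C * (A ^ 2 * hs s g) ≤ C * (A ^ 2 * hs (s + 1) g) := by
        have := hs_le_succ s g
        gcongr
      have a4 : C * (A ^ 2 * hs s (pd k g)) ≤ C * (A ^ 2 * hs (s + 1) g) := by
        have := hs_pd_le s g k
        gcongr
      linarith
    have := e 0; have := e 1
    linarith

/-- interpolation: `∫ f²g²` with constants -/
theorem nn_mul_young {f g : E2 → ℝ} (hf : Sch f) (hg : Sch g) :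
    nn (f * g) ≤ 2 * (nn f * nn g + nn (pd 0 f) * nn (pd 1 g)) := by
  refine (nn_mul_le hf hg).trans ?_
  have a := Real.sq_sqrt (nn_nonneg f)
  have b := Real.sq_sqrt (nn_nonneg (pd 0 f))
  have c := Real.sq_sqrt (nn_nonneg g)
  have d := Real.sq_sqrt (nn_nonneg (pd 1 g))
  rw [← a, ← b, ← c, ← d]
  simp only [Real.sqrt_sq (Real.sqrt_nonneg _)]
  nlinarith [sq_nonneg (√(nn f) * √(nn g) - √(nn (pd 0 f)) * √(nn (pd 1 g)))]

end

end Part2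

section Part3
open MeasureTheory Set Filter Topology
open scoped ENNReal ContDiff SchwartzMap

noncomputable section

/-! ### compactly supported kernels and the pointwise bound by the bi-Laplacian -/

/-- smooth compactly supported kernels -/
def CK (K : E2 → ℝ) : Prop := ContDiff ℝ ∞ K ∧ HasCompactSupport K

theorem CK.sch {K : E2 → ℝ} (h : CK K) : Sch K := Sch.of_compact h.2 h.1

theorem contDiff_pd {f : E2 → ℝ} (hf : ContDiff ℝ ∞ f) (i : Fin 2) : ContDiff ℝ ∞ (pd i f) := by
  have : ContDiff ℝ ∞ (fderiv ℝ f) := hf.fderiv_right (m := ∞) (by simp)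
  exact this.clm_apply contDiff_const

theorem CK.pd {K : E2 → ℝ} (h : CK K) (i : Fin 2) : CK (pd i K) := by
  refine ⟨contDiff_pd h.1 i, ?_⟩
  exact (h.2.fderiv (𝕜 := ℝ)).comp_left (g := fun L : E2 →L[ℝ] ℝ => L (Pi.single i 1)) (by simp)

theorem ibpc {K g : E2 → ℝ} (hK : CK K) (hg : ContDiff ℝ ∞ g) (i : Fin 2) :
    ∫ y, K y * pd i g y = - ∫ y, pd i K y * g y := by
  have hKg : CK (K * g) := ⟨hK.1.mul hg, hK.2.mul_right⟩
  have h := integral_pd hKg.sch i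
  have e : pd i (K * g) = pd i K * g + K * pd i g := by
    ext x
    simp only [pd, Pi.add_apply, Pi.mul_apply]
    rw [fderiv_mul (hK.sch.diff x) (hg.differentiable (by simp) x)]
    simp; ring
  rw [e] at h
  have h1 : CK (pd i K * g) := ⟨(hK.pd i).1.mul hg, (hK.pd i).2.mul_right⟩
  have h3 : CK (K * pd i g) := ⟨hK.1.mul (contDiff_pd hg i), hK.2.mul_right⟩
  have h2 : ∫ x, (pd i K * g + K * pd i g) x = (∫ x, pd i K x * g x) + ∫ x, K x * pd i g x :=
    integral_add h1.sch.integrable h3.sch.integrable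
  linarith

/-- averages at scale `σ` -/
def Mav (K h : E2 → ℝ) (x : E2) (σ : ℝ) : ℝ := ∫ y, K y * h (x + σ • y)

theorem pd_scale {h : E2 → ℝ} (hh : Differentiable ℝ h) (x : E2) (σ : ℝ) (i : Fin 2) (y : E2) :
    pd i (fun y => h (x + σ • y)) y = σ * pd i h (x + σ • y) := by
  have h1 : HasFDerivAt (fun y : E2 => x + σ • y) (σ • ContinuousLinearMap.id ℝ E2) y :=
    ((hasFDerivAt_id y).const_smul σ).const_add x
  have h2 := (hh (x + σ • y)).hasFDerivAt.comp y h1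
  have h3 : fderiv ℝ (fun y => h (x + σ • y)) y = _ := h2.fderiv
  simp only [pd, h3]
  simp

theorem contDiff_scale {h : E2 → ℝ} (hh : ContDiff ℝ ∞ h) (x : E2) (σ : ℝ) :
    ContDiff ℝ ∞ (fun y => h (x + σ • y)) :=
  hh.comp (by fun_prop)

theorem Mav_pd {K h : E2 → ℝ} (hK : CK K) (hh : ContDiff ℝ ∞ h) (x : E2) (σ : ℝ) (i : Fin 2) :
    σ * Mav K (pd i h) x σ = - Mav (pd i K) h x σ := by
  have := ibpc hK (contDiff_scale hh x σ) i
  simp only [pd_scale (hh.differentiable (by simp))] at this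
  unfold Mav
  rw [← this, ← integral_const_mul]
  congr 1; ext y; ring

theorem Sch.grad_bdd {h : E2 → ℝ} (hh : Sch h) : ∃ C, 0 ≤ C ∧ ∀ x i, |_root_.pd i h x| ≤ C := by
  obtain ⟨C0, h0, h0'⟩ := (hh.pd 0).bdd
  obtain ⟨C1, h1, h1'⟩ := (hh.pd 1).bdd
  refine ⟨C0 + C1, by positivity, fun x i => ?_⟩
  have := h0' x; have := h1' x
  fin_cases i <;> simp <;> linarith

theorem fderiv_apply_eq {h : E2 → ℝ} (x y : E2) :
    fderiv ℝ h x y = y 0 * pd 0 h x + y 1 * pd 1 h x := by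
  have : y = y 0 • (Pi.single 0 1 : E2) + y 1 • (Pi.single 1 1 : E2) := by
    ext i; fin_cases i <;> simp
  conv_lhs => rw [this]
  rw [map_add, map_smul, map_smul]; rfl

theorem Mav_hasDeriv {K h : E2 → ℝ} (hK : CK K) (hh : Sch h) (x : E2) (σ : ℝ) :
    HasDerivAt (Mav K h x)
      (∫ y, K y * (y 0 * pd 0 h (x + σ • y) + y 1 * pd 1 h (x + σ • y))) σ := by
  obtain ⟨C, hC, hb⟩ := hh.grad_bdd
  have hKc := hK.1.continuous
  have hhc := hh.cont
  have hpc := fun i => (hh.pd i).cont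
  refine (hasDerivAt_integral_of_dominated_loc_of_deriv_le (μ := (volume : Measure E2))
    (F := fun σ y => K y * h (x + σ • y))
    (F' := fun σ y => K y * (y 0 * pd 0 h (x + σ • y) + y 1 * pd 1 h (x + σ • y)))
    (bound := fun y => |K y| * ((|y 0| + |y 1|) * C)) (s := univ) (x₀ := σ)
    univ_mem ?_ ?_ ?_ ?_ ?_ ?_).2
  · exact Eventually.of_forall fun s => Continuous.aestronglyMeasurable (by fun_prop)
  · have : CK (K * fun y => h (x + σ • y)) := ⟨hK.1.mul (contDiff_scale hh.contDiff x σ), hK.2.mul_right⟩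
    exact this.sch.integrable
  · refine Continuous.aestronglyMeasurable ?_
    have := hpc 0; have := hpc 1
    fun_prop
  · refine Eventually.of_forall fun y s _ => ?_
    rw [Real.norm_eq_abs, abs_mul]
    gcongr
    refine (abs_add_le _ _).trans ?_
    rw [abs_mul, abs_mul, add_mul]
    gcongr
    · exact hb _ _
    · exact hb _ _
  · refine Continuous.integrable_of_hasCompactSupport (by fun_prop) ?_
    exact HasCompactSupport.mul_right (f := fun y => |K y|) (hK.2.comp_left (g := fun r : ℝ => |r|) (by simp))
  · refine Eventually.of_forall fun y s _ => ?_
    have h1 : HasDerivAt (fun s : ℝ => x + s • y) y s := by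
      simpa using ((hasDerivAt_id' s).smul_const y).const_add x
    have h2 := ((hh.diff (x + s • y)).hasFDerivAt.comp_hasDerivAt s h1).const_mul (K y)
    rw [fderiv_apply_eq] at h2
    exact h2

theorem Mav_deriv_lap {K K1 h : E2 → ℝ} (hK : CK K) (hK1 : CK K1) (hh : Sch h)
    (hrel : ∀ (i : Fin 2) y, y i * K y = - pd i K1 y) (x : E2) (σ : ℝ) :
    HasDerivAt (Mav K h x) (σ * Mav K1 (lap h) x σ) σ := by
  convert Mav_hasDeriv hK hh x σ using 1
  have e : ∀ i : Fin 2, σ * Mav K1 (pd i (pd i h)) x σ = ∫ y, K y * (y i * pd i h (x + σ • y)) := by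
    intro i
    rw [Mav_pd hK1 (hh.pd i).contDiff]
    unfold Mav
    rw [← integral_neg]
    congr 1; ext y
    have := hrel i y
    linear_combination (- pd i h (x + σ • y)) * this
  have ig : ∀ (i : Fin 2), Integrable (fun y => K y * (y i * pd i h (x + σ • y))) := by
    intro i
    have h1 : ContDiff ℝ ∞ (fun y : E2 => y i) := contDiff_apply ℝ ℝ i
    have : CK (K * fun y => (y i * pd i h (x + σ • y))) :=
      ⟨hK.1.mul (h1.mul (contDiff_scale (hh.pd i).contDiff x σ)), hK.2.mul_right⟩
    exact this.sch.integrable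
  have ig2 : ∀ (i : Fin 2), Integrable (fun y => K1 y * (pd i (pd i h) (x + σ • y))) := by
    intro i
    have : CK (K1 * fun y => (pd i (pd i h) (x + σ • y))) :=
      ⟨hK1.1.mul ((contDiff_scale ((hh.pd i).pd i).contDiff x σ)), hK1.2.mul_right⟩
    exact this.sch.integrable
  have s1 : Mav K1 (lap h) x σ = Mav K1 (pd 0 (pd 0 h)) x σ + Mav K1 (pd 1 (pd 1 h)) x σ := by
    unfold Mav
    rw [← integral_add (ig2 0) (ig2 1)]
    congr 1; ext y; simp [lap]; ring
  rw [s1, mul_add, e, e, ← integral_add (ig 0) (ig 1)]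
  congr 1; ext y; ring

/-- `L^p` norm, real version -/
def lpn (p : ℝ) (F : E2 → ℝ) : ℝ := (∫ x, |F x| ^ p) ^ (1 / p)

theorem lpn_nonneg (p : ℝ) (F : E2 → ℝ) : 0 ≤ lpn p F :=
  Real.rpow_nonneg (integral_nonneg fun _ => Real.rpow_nonneg (abs_nonneg _) _) _

theorem lpn_two (F : E2 → ℝ) : lpn 2 F = √(nn F) := by
  simp [lpn, nn, Real.sqrt_eq_rpow]

theorem Mav_holder {p : ℝ} (hp : 1 < p) {K : E2 → ℝ} (hK : CK K) :
    ∃ C, 0 ≤ C ∧ ∀ F, Sch F → ∀ x τ, 0 < τ → |Mav K F x τ| ≤ C * (τ ^ (-(2 / p)) * lpn p F) := by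
  have hpq : p.HolderConjugate p.conjExponent := Real.HolderConjugate.conjExponent hp
  set q := p.conjExponent
  refine ⟨lpn q K, lpn_nonneg _ _, fun F hF x τ hτ => ?_⟩
  have hFs : MemLp (fun y => F (x + τ • y)) (ENNReal.ofReal p) (volume : Measure E2) := by
    have h1 := hF.memLp (ENNReal.ofReal p)
    have h2 : MemLp (fun y => F (x + y)) (ENNReal.ofReal p) (volume : Measure E2) :=
      h1.comp_measurePreserving (measurePreserving_add_left volume x)
    refine (memLp_comp_smul_aux h2 hτ.ne' )
  have h0 := integral_mul_norm_le_Lp_mul_Lq (μ := (volume : Measure E2)) (f := K)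
    (g := fun y => F (x + τ • y)) hpq.symm (hK.sch.memLp _) hFs
  have h1 : |Mav K F x τ| ≤ ∫ y, ‖K y‖ * ‖F (x + τ • y)‖ := by
    refine (abs_integral_le_integral_abs).trans (le_of_eq ?_)
    congr 1; ext y; rw [abs_mul]; rfl
  refine h1.trans (h0.trans (le_of_eq ?_))
  have e : ∫ a, ‖F (x + τ • a)‖ ^ p = τ ^ (-2 : ℝ) * ∫ a, |F a| ^ p := by
    have := Measure.integral_comp_smul (volume : Measure E2) (fun y => |F (x + y)| ^ p) τ
    simp only [Real.norm_eq_abs]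
    rw [this, integral_add_left_eq_self (fun y => |F y| ^ p)]
    simp only [Module.finrank_fin_fun, smul_eq_mul]
    rw [abs_of_pos (by positivity), Real.rpow_neg hτ.le]
    norm_num
  rw [e, Real.mul_rpow (by positivity) (integral_nonneg fun _ => Real.rpow_nonneg (abs_nonneg _) _),
    ← Real.rpow_mul hτ.le]
  simp only [lpn, Real.norm_eq_abs]
  congr 3
  ring
where
  memLp_comp_smul_aux {g : E2 → ℝ} {p : ℝ≥0∞} {τ : ℝ} (h : MemLp g p volume) (hτ : τ ≠ 0) :
      MemLp (fun y => g (τ • y)) p volume := by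
    have hm : Measurable (fun y : E2 => τ • y) := by fun_prop
    have : MemLp g p (Measure.map (fun y : E2 => τ • y) volume) := by
      rw [Measure.map_addHaar_smul _ hτ]
      exact h.smul_measure ENNReal.ofReal_ne_top
    exact this.comp_of_map hm.aemeasurable

/-- iterated partial derivatives -/
def pdl (w : List (Fin 2)) (f : E2 → ℝ) : E2 → ℝ := w.foldr pd f

theorem pdl_cons (k : Fin 2) (w : List (Fin 2)) (f : E2 → ℝ) : pdl (k :: w) f = pd k (pdl w f) := rfl

theorem Sch.pdl {f : E2 → ℝ} (hf : Sch f) (w : List (Fin 2)) : Sch (pdl w f) := by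
  induction w with
  | nil => exact hf
  | cons k w ih => exact ih.pd k

theorem pdl_lap {f : E2 → ℝ} (hf : Sch f) (w : List (Fin 2)) : lap (pdl w f) = pdl w (lap f) := by
  induction w with
  | nil => rfl
  | cons k w ih => rw [pdl_cons, pdl_cons, ← pd_lap (hf.pdl w), ih]

theorem Mav_pdl {p : ℝ} (hp : 1 < p) (w : List (Fin 2)) : ∀ {K : E2 → ℝ} (_ : CK K),
    ∃ C, 0 ≤ C ∧ ∀ F, Sch F → ∀ x τ, 0 < τ →
      |Mav K (pdl w F) x τ| ≤ C * (τ ^ (-(2 / p) - w.length) * lpn p F) := by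
  induction w with
  | nil => intro K hK; simpa [pdl] using Mav_holder hp hK
  | cons k w ih =>
    intro K hK
    obtain ⟨C, hC, h⟩ := ih (hK.pd k)
    refine ⟨C, hC, fun F hF x τ hτ => ?_⟩
    have h1 := Mav_pd hK (hF.pdl w).contDiff x τ k
    have h2 := h F hF x τ hτ
    rw [pdl_cons]
    have h3 : τ * |Mav K (pd k (pdl w F)) x τ| = |Mav (pd k K) (pdl w F) x τ| := by
      rw [← abs_neg (Mav (pd k K) _ _ _), ← h1, abs_mul, abs_of_pos hτ]
    rw [← h3] at h2
    have h4 : τ ^ (-(2 / p) - ((k :: w).length : ℕ)) = τ⁻¹ * τ ^ (-(2 / p) - w.length) := by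
      rw [show -(2 / p) - (((k :: w).length : ℕ) : ℝ) = -1 + (-(2 / p) - w.length) by
        simp; ring, Real.rpow_add hτ, Real.rpow_neg_one]
    rw [h4]
    calc |Mav K (pd k (pdl w F)) x τ| = τ⁻¹ * (τ * |Mav K (pd k (pdl w F)) x τ|) := by field_simp
      _ ≤ τ⁻¹ * (C * (τ ^ (-(2 / p) - w.length) * lpn p F)) := by gcongr
      _ = _ := by ring

/-- kernels -/
theorem exists_kernels : ∃ K0 K1 K2 : E2 → ℝ, CK K0 ∧ CK K1 ∧ CK K2 ∧ (∫ y, K0 y) ≠ 0 ∧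
    (∀ (i : Fin 2) y, y i * K0 y = - pd i K1 y) ∧ (∀ (i : Fin 2) y, y i * K1 y = - pd i K2 y) := by
  have prim : ∀ θ : ℝ → ℝ, ContDiff ℝ ∞ θ → (∀ s, 1 ≤ s → θ s = 0) → ∃ Θ : ℝ → ℝ,
      ContDiff ℝ ∞ Θ ∧ (∀ s, 1 ≤ s → Θ s = 0) ∧ ∀ s, HasDerivAt Θ (-(1/2) * θ s) s := by
    intro θ hθ h0
    have hd : ∀ s, HasDerivAt (fun s => -(1/2) * ∫ r in (1:ℝ)..s, θ r) (-(1/2) * θ s) s := fun s =>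
      (intervalIntegral.integral_hasDerivAt_right (hθ.continuous.intervalIntegrable _ _)
        (hθ.continuous.stronglyMeasurableAtFilter _ _) hθ.continuous.continuousAt).const_mul _
    refine ⟨_, ?_, ?_, hd⟩
    · rw [contDiff_infty_iff_deriv]
      refine ⟨fun s => (hd s).differentiableAt, ?_⟩
      rw [show deriv _ = fun s => -(1/2) * θ s from funext fun s => (hd s).deriv]
      exact contDiff_const.mul hθ
    · intro s hs
      rw [intervalIntegral.integral_congr (g := fun _ => 0)]
      · simp
      · intro r hr
        rw [uIcc_of_le hs] at hr
        exact h0 r hr.1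
  let N : E2 → ℝ := fun y => y 0 ^ 2 + y 1 ^ 2
  have hN : ContDiff ℝ ∞ N :=
    ((contDiff_apply ℝ ℝ 0).pow 2).add ((contDiff_apply ℝ ℝ 1).pow 2)
  have ck : ∀ θ : ℝ → ℝ, ContDiff ℝ ∞ θ → (∀ s, 1 ≤ s → θ s = 0) → CK (fun y => θ (N y)) := by
    intro θ hθ h0
    refine ⟨hθ.comp hN, ?_⟩
    refine HasCompactSupport.intro (isCompact_closedBall (0 : E2) 1) fun y hy => h0 _ ?_
    simp only [Metric.mem_closedBall, dist_zero_right, not_le] at hy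
    by_contra hcon
    push Not at hcon
    have : ‖y‖ ≤ 1 := by
      rw [pi_norm_le_iff_of_nonneg (by norm_num)]
      intro i
      rw [Real.norm_eq_abs]
      have e : N y = y 0 ^ 2 + y 1 ^ 2 := rfl
      rw [← sq_le_one_iff_abs_le_one]
      fin_cases i <;> simp only [Fin.zero_eta, Fin.mk_one] <;>
        nlinarith [sq_nonneg (y 0), sq_nonneg (y 1)]
    linarith
  have rel : ∀ θ Θ : ℝ → ℝ, (∀ s, HasDerivAt Θ (-(1/2) * θ s) s) →
      ∀ (i : Fin 2) y, y i * θ (N y) = - pd i (fun y => Θ (N y)) y := by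
    intro θ Θ hd i y
    have h1 := (hd (N y)).hasFDerivAt.comp y ((hN.differentiable (by simp)) y).hasFDerivAt
    have h2 : fderiv ℝ (fun y => Θ (N y)) y = _ := h1.fderiv
    have h3 : fderiv ℝ N y (Pi.single i 1) = 2 * y i := by
      have a0 := ((ContinuousLinearMap.proj 0 : E2 →L[ℝ] ℝ).hasFDerivAt (x := y)).pow 2
      have a1 := ((ContinuousLinearMap.proj 1 : E2 →L[ℝ] ℝ).hasFDerivAt (x := y)).pow 2
      have e : fderiv ℝ N y = _ := (a0.add a1).fderiv
      rw [e]
      fin_cases i <;> simp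
    simp only [pd, h2]
    simp [h3]
    ring
  obtain ⟨κ0, c0, z0, nz, cpos⟩ : ∃ θ : ℝ → ℝ, ContDiff ℝ ∞ θ ∧ (∀ s, 1 ≤ s → θ s = 0) ∧
      (∀ s, 0 ≤ θ s) ∧ 0 < θ 0 := by
    refine ⟨fun s => Real.smoothTransition (1 - s), Real.smoothTransition.contDiff.comp (by fun_prop),
      fun s hs => Real.smoothTransition.zero_of_nonpos (by linarith),
      fun s => Real.smoothTransition.nonneg _, Real.smoothTransition.pos_of_pos (by norm_num)⟩
  obtain ⟨κ1, c1, z1, d1⟩ := prim κ0 c0 z0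
  obtain ⟨κ2, c2, z2, d2⟩ := prim κ1 c1 z1
  refine ⟨_, _, _, ck κ0 c0 z0, ck κ1 c1 z1, ck κ2 c2 z2, ?_, rel _ _ d1, rel _ _ d2⟩
  have hc := (ck κ0 c0 z0)
  refine (Continuous.integral_pos_of_hasCompactSupport_nonneg_nonzero (x := (0 : E2)) hc.1.continuous hc.2 (fun y => nz _) ?_).ne'
  simp [N]; exact cpos.ne'

theorem abs_sub_le_of_deriv {g g' h h' : ℝ → ℝ} {a b : ℝ} (hab : a ≤ b)
    (hgc : ContinuousOn g (Icc a b)) (hhc : ContinuousOn h (Icc a b))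
    (hg : ∀ t ∈ Ioo a b, HasDerivAt g (g' t) t) (hh : ∀ t ∈ Ioo a b, HasDerivAt h (h' t) t)
    (hle : ∀ t ∈ Ioo a b, |g' t| ≤ h' t) : |g b - g a| ≤ h b - h a := by
  have m1 : MonotoneOn (fun t => h t - g t) (Icc a b) := by
    refine monotoneOn_of_hasDerivWithinAt_nonneg (f' := fun t => h' t - g' t) (convex_Icc a b)
      (hhc.sub hgc) ?_ ?_
    · intro t ht; rw [interior_Icc] at ht ⊢
      exact ((hh t ht).sub (hg t ht)).hasDerivWithinAt
    · intro t ht; rw [interior_Icc] at ht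
      have := hle t ht; have := le_abs_self (g' t); linarith
  have m2 : MonotoneOn (fun t => h t + g t) (Icc a b) := by
    refine monotoneOn_of_hasDerivWithinAt_nonneg (f' := fun t => h' t + g' t) (convex_Icc a b)
      (hhc.add hgc) ?_ ?_
    · intro t ht; rw [interior_Icc] at ht ⊢
      exact ((hh t ht).add (hg t ht)).hasDerivWithinAt
    · intro t ht; rw [interior_Icc] at ht
      have := hle t ht; have := neg_abs_le (g' t); linarith
  have e1 := m1 (left_mem_Icc.2 hab) (right_mem_Icc.2 hab) hab
  have e2 := m2 (left_mem_Icc.2 hab) (right_mem_Icc.2 hab) hab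
  simp only at e1 e2
  rw [abs_le]; constructor <;> linarith

theorem sup_bilap_word {p : ℝ} (hp : 2 < p) (w : List (Fin 2)) (hw : w.length ≤ 3) :
    ∃ C, 0 ≤ C ∧ ∀ f, Sch f → ∀ x, |pdl w f x| ≤ C * (√(nn f) + lpn p (lap (lap f))) := by
  obtain ⟨K0, K1, K2, h0, h1, h2, hI, r0, r1⟩ := exists_kernels
  obtain ⟨A, hA, hA'⟩ := Mav_pdl (p := 2) (by norm_num) w h0
  obtain ⟨B0, hB0, hB0'⟩ := Mav_pdl (p := 2) (by norm_num) (0 :: 0 :: w) h1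
  obtain ⟨B1, hB1, hB1'⟩ := Mav_pdl (p := 2) (by norm_num) (1 :: 1 :: w) h1
  obtain ⟨D, hD, hD'⟩ := Mav_pdl (p := p) (by linarith) w h2
  set a := 2 / p with ha
  have hp0 : 0 < p := by linarith
  have ha0 : 0 < a := by positivity
  have ha1 : a < 1 := by rw [ha, div_lt_one hp0]; exact hp
  set I := |∫ y, K0 y| with hIdef
  have hIpos : 0 < I := abs_pos.2 hI
  refine ⟨I⁻¹ * (A + (B0 + B1) + D / (1 - a)), by have : 0 < 1 - a := by linarith
                                                  positivity, fun f hf x => ?_⟩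
  set L := √(nn f) with hL
  set P := lpn p (lap (lap f)) with hP
  have hL0 : 0 ≤ L := Real.sqrt_nonneg _
  have hP0 : 0 ≤ P := lpn_nonneg _ _
  have hh := hf.pdl w
  have e1 : ∀ σ ∈ Ioo (0:ℝ) 1, |Mav K1 (lap (pdl w f)) x σ| ≤ (B0 + B1) * L + D * P * σ ^ (-1 - a) := by
    intro σ hσ
    have b1 : |Mav K1 (lap (pdl w f)) x 1| ≤ (B0 + B1) * L := by
      have s1 : Mav K1 (lap (pdl w f)) x 1 = Mav K1 (pdl (0 :: 0 :: w) f) x 1 + Mav K1 (pdl (1 :: 1 :: w) f) x 1 := by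
        unfold Mav
        rw [← integral_add]
        · congr 1; ext y; simp [lap, pdl]; ring
        · have : CK (K1 * fun y => (pdl (0 :: 0 :: w) f) (x + (1:ℝ) • y)) :=
            ⟨h1.1.mul ((contDiff_scale (hf.pdl _).contDiff x 1)), h1.2.mul_right⟩
          exact this.sch.integrable
        · have : CK (K1 * fun y => (pdl (1 :: 1 :: w) f) (x + (1:ℝ) • y)) :=
            ⟨h1.1.mul ((contDiff_scale (hf.pdl _).contDiff x 1)), h1.2.mul_right⟩
          exact this.sch.integrable
      have t0 := hB0' f hf x 1 one_pos
      have t1 := hB1' f hf x 1 one_pos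
      rw [Real.one_rpow, one_mul, lpn_two] at t0 t1
      rw [s1]
      refine (abs_add_le _ _).trans ?_
      linarith
    have key := abs_sub_le_of_deriv (g := Mav K1 (lap (pdl w f)) x) (a := σ) (b := 1)
      (g' := fun τ => τ * Mav K2 (lap (lap (pdl w f))) x τ)
      (h := fun τ => D * P * (-(τ ^ (-1 - a)) / (1 + a))) (h' := fun τ => D * P * τ ^ (-2 - a)) hσ.2.le
      (fun τ _ => (Mav_deriv_lap h1 h2 hh.lap r1 x τ).continuousAt.continuousWithinAt)
      (by
        apply ContinuousOn.mul continuousOn_const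
        apply ContinuousOn.div_const
        apply ContinuousOn.neg
        intro τ hτ
        exact (Real.continuousAt_rpow_const _ _ (Or.inl (by linarith [hτ.1, hσ.1]))).continuousWithinAt)
      (fun τ _ => Mav_deriv_lap h1 h2 hh.lap r1 x τ)
      (by
        intro τ hτ
        have := ((Real.hasDerivAt_rpow_const (p := -1 - a) (Or.inl (by linarith [hτ.1, hσ.1] : τ ≠ 0))).neg.div_const (1 + a)).const_mul (D * P)
        refine this.congr_deriv ?_
        have : (1 + a) ≠ 0 := by positivity
        rw [show -1 - a - 1 = -2 - a by ring]
        field_simp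
        ring)
      (by
        intro τ hτ
        have hτ0 : 0 < τ := by linarith [hτ.1, hσ.1]
        have t := hD' (lap (lap f)) hf.lap.lap x τ hτ0
        rw [abs_mul, abs_of_pos hτ0, pdl_lap hf, pdl_lap hf.lap]
        have t2 : τ ^ (-a - w.length) ≤ τ ^ (-a - 3) := by
          apply Real.rpow_le_rpow_of_exponent_ge hτ0 hτ.2.le
          have : (w.length : ℝ) ≤ 3 := by exact_mod_cast hw
          linarith
        calc τ * |Mav K2 (pdl w (lap (lap f))) x τ| ≤ τ * (D * (τ ^ (-a - 3) * P)) := by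
              have := t.trans (b := _) (c := D * (τ ^ (-a - 3) * P)) (by gcongr)
              gcongr
          _ = D * P * (τ * τ ^ (-a - 3)) := by ring
          _ = _ := by
              congr 1
              rw [mul_comm, ← Real.rpow_add_one hτ0.ne']; congr 1; ring)
    have k2 : D * P * (-((1:ℝ) ^ (-1 - a)) / (1 + a)) - D * P * (-(σ ^ (-1 - a)) / (1 + a)) ≤ D * P * σ ^ (-1 - a) := by
      have q1 : 0 ≤ D * P := by positivity
      have q2 : 0 < σ ^ (-1 - a) := Real.rpow_pos_of_pos hσ.1 _
      have q3 : σ ^ (-1 - a) / (1 + a) ≤ σ ^ (-1 - a) := div_le_self q2.le (by linarith)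
      have q4 : 0 < 1 / (1 + a) := by positivity
      rw [Real.one_rpow, ← mul_sub]
      gcongr
      rw [neg_div, neg_div]
      linarith
    have := abs_sub_abs_le_abs_sub (Mav K1 (lap (pdl w f)) x σ) (Mav K1 (lap (pdl w f)) x 1)
    rw [abs_sub_comm] at this
    linarith
  have key := abs_sub_le_of_deriv (g := Mav K0 (pdl w f) x) (a := 0) (b := 1)
      (g' := fun τ => τ * Mav K1 (lap (pdl w f)) x τ)
      (h := fun τ => (B0 + B1) * L * τ + D * P * (τ ^ (1 - a) / (1 - a)))
      (h' := fun τ => (B0 + B1) * L + D * P * τ ^ (- a)) zero_le_one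
      (fun τ _ => (Mav_deriv_lap h0 h1 hh r0 x τ).continuousAt.continuousWithinAt)
      (by
        apply ContinuousOn.add (by fun_prop)
        apply ContinuousOn.mul continuousOn_const
        apply ContinuousOn.div_const
        intro τ hτ
        exact (Real.continuousAt_rpow_const _ _ (Or.inr (by linarith))).continuousWithinAt)
      (fun τ _ => Mav_deriv_lap h0 h1 hh r0 x τ)
      (by
        intro τ hτ
        have := ((hasDerivAt_id' τ).const_mul ((B0 + B1) * L)).add (((Real.hasDerivAt_rpow_const (p := 1 - a) (Or.inl (by linarith [hτ.1] : τ ≠ 0))).div_const (1 - a)).const_mul (D * P))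
        refine this.congr_deriv ?_
        have : (1 - a) ≠ 0 := by linarith
        rw [show 1 - a - 1 = - a by ring]
        field_simp)
      (by
        intro τ hτ
        have hτ0 : 0 < τ := hτ.1
        have t := e1 τ hτ
        rw [abs_mul, abs_of_pos hτ0]
        calc τ * |Mav K1 (lap (pdl w f)) x τ| ≤ τ * ((B0 + B1) * L + D * P * τ ^ (-1 - a)) := by gcongr
          _ = τ * ((B0 + B1) * L) + D * P * (τ * τ ^ (-1 - a)) := by ring
          _ ≤ 1 * ((B0 + B1) * L) + D * P * (τ * τ ^ (-1 - a)) := by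
              have := hτ.2.le
              gcongr
          _ = _ := by
              rw [mul_comm τ, ← Real.rpow_add_one hτ0.ne', one_mul]; congr 3; ring)
  have m0 : Mav K0 (pdl w f) x 0 = (∫ y, K0 y) * pdl w f x := by
    unfold Mav
    simp only [zero_smul, add_zero]
    rw [integral_mul_const]
  have m1 := hA' f hf x 1 one_pos
  rw [Real.one_rpow, one_mul, lpn_two] at m1
  have m2 := abs_sub_abs_le_abs_sub (Mav K0 (pdl w f) x 0) (Mav K0 (pdl w f) x 1)
  rw [abs_sub_comm] at m2
  have m3 : I * |pdl w f x| ≤ A * L + (B0 + B1) * L + D * P / (1 - a) := by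
    rw [hIdef, ← abs_mul, ← m0]
    have z : (0:ℝ) ^ (1 - a) = 0 := Real.zero_rpow (by linarith)
    rw [Real.one_rpow, z] at key
    have : D * P * (1 / (1 - a)) = D * P / (1 - a) := by ring
    simp only [mul_one, mul_zero, zero_div, add_zero, sub_zero] at key
    linarith
  have : 0 < 1 - a := by linarith
  calc |pdl w f x| = I⁻¹ * (I * |pdl w f x|) := by field_simp
    _ ≤ I⁻¹ * (A * L + (B0 + B1) * L + D * P / (1 - a)) := by gcongr
    _ ≤ I⁻¹ * ((A + (B0 + B1) + D / (1 - a)) * (L + P)) := by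
        gcongr
        have i1 : 0 ≤ (A + (B0 + B1)) * P := by positivity
        have i2 : 0 ≤ D / (1 - a) * L := by positivity
        have i3 : D * P / (1 - a) = D / (1 - a) * P := by ring
        rw [i3]; linarith
    _ = _ := by ring

theorem sup_bilap_aux {p : ℝ} (hp : 2 < p) (s : ℕ) : ∀ w : List (Fin 2), w.length + s ≤ 3 →
    ∃ C, 0 ≤ C ∧ ∀ f, Sch f → wb s (C * (√(nn f) + lpn p (lap (lap f)))) (pdl w f) := by
  induction s with
  | zero => intro w hw; exact sup_bilap_word hp w hw
  | succ s ih =>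
    intro w hw
    obtain ⟨C, hC, h⟩ := sup_bilap_word hp w (by omega)
    obtain ⟨C0, hC0, h0⟩ := ih (0 :: w) (by simp; omega)
    obtain ⟨C1, hC1, h1⟩ := ih (1 :: w) (by simp; omega)
    refine ⟨C + C0 + C1, by positivity, fun f hf => ?_⟩
    have hN : 0 ≤ √(nn f) + lpn p (lap (lap f)) := add_nonneg (Real.sqrt_nonneg _) (lpn_nonneg _ _)
    refine ⟨fun x => (h f hf x).trans (by gcongr; linarith), fun k => ?_⟩
    fin_cases k
    · exact (h0 f hf).mono_A (by gcongr; linarith)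
    · exact (h1 f hf).mono_A (by gcongr; linarith)

/-- the pointwise bound by the bi-Laplacian -/
theorem sup_bilap {p : ℝ} (hp : 2 < p) : ∃ C, 0 ≤ C ∧ ∀ f, Sch f →
    wb 3 (C * (√(nn f) + lpn p (lap (lap f)))) f :=
  sup_bilap_aux hp 3 [] (by simp)

end

end Part3

section Part4
open MeasureTheory Set Filter Topology
open scoped ENNReal ContDiff SchwartzMap

noncomputable section

/-! ### time dependent functions -/

/-- time dependent scalar functions -/
abbrev TF := ℝ → E2 → ℝ

/-- spatial derivative of a time dependent function -/
def D (i : Fin 2) (f : TF) : TF := fun t => pd i (f t)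

/-- time derivative -/
def dt (f : TF) : TF := fun t x => deriv (fun s => f s x) t

/-- smooth on `(0,T) × ℝ²` with Schwartz slices -/
structure Reg (T : ℝ) (f : TF) : Prop where
  sch : ∀ t, Sch (f t)
  smooth : ContDiffOn ℝ ∞ (fun p : ℝ × E2 => f p.1 p.2) (Ioo 0 T ×ˢ univ)

theorem isOpen_slab (T : ℝ) : IsOpen (Ioo 0 T ×ˢ (univ : Set E2)) := isOpen_Ioo.prod isOpen_univ

section
variable {T : ℝ} {f g : TF}

theorem Reg.add (hf : Reg T f) (hg : Reg T g) : Reg T (f + g) :=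
  ⟨fun t => (hf.sch t).add (hg.sch t), hf.smooth.add hg.smooth⟩

theorem Reg.sub (hf : Reg T f) (hg : Reg T g) : Reg T (f - g) :=
  ⟨fun t => (hf.sch t).sub (hg.sch t), hf.smooth.sub hg.smooth⟩

theorem Reg.neg (hf : Reg T f) : Reg T (-f) :=
  ⟨fun t => (hf.sch t).neg, hf.smooth.neg⟩

theorem Reg.mul (hf : Reg T f) (hg : Reg T g) : Reg T (f * g) :=
  ⟨fun t => (hf.sch t).mul (hg.sch t), hf.smooth.mul hg.smooth⟩

theorem Reg.zero : Reg T 0 := ⟨fun _ => Sch.zero, contDiffOn_const⟩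

theorem slab_mem {t : ℝ} (ht : t ∈ Ioo 0 T) (x : E2) : (t, x) ∈ Ioo 0 T ×ˢ (univ : Set E2) :=
  ⟨ht, mem_univ _⟩

theorem Reg.diffAt (hf : Reg T f) {t : ℝ} (ht : t ∈ Ioo 0 T) (x : E2) :
    DifferentiableAt ℝ (fun p : ℝ × E2 => f p.1 p.2) (t, x) :=
  (hf.smooth.contDiffAt ((isOpen_slab T).mem_nhds (slab_mem ht x))).differentiableAt (by simp)

theorem Reg.pd_eq (hf : Reg T f) {t : ℝ} (ht : t ∈ Ioo 0 T) (x : E2) (i : Fin 2) :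
    pd i (f t) x = fderiv ℝ (fun p : ℝ × E2 => f p.1 p.2) (t, x) (0, Pi.single i 1) := by
  have h1 : HasFDerivAt (fun x : E2 => (t, x)) (ContinuousLinearMap.inr ℝ ℝ E2) x :=
    hasFDerivAt_prodMk_right t x
  have h2 : fderiv ℝ (f t) x = _ := ((hf.diffAt ht x).hasFDerivAt.comp x h1).fderiv
  simp only [pd, h2]
  simp

theorem Reg.hasDerivAt (hf : Reg T f) {t : ℝ} (ht : t ∈ Ioo 0 T) (x : E2) :
    HasDerivAt (fun s => f s x) (fderiv ℝ (fun p : ℝ × E2 => f p.1 p.2) (t, x) (1, 0)) t := by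
  have h1 : HasFDerivAt (fun s : ℝ => (s, x)) (ContinuousLinearMap.inl ℝ ℝ E2) t :=
    hasFDerivAt_prodMk_left t x
  have h2 := ((hf.diffAt ht x).hasFDerivAt.comp t h1).hasDerivAt
  simp only [ContinuousLinearMap.comp_apply, ContinuousLinearMap.inl_apply] at h2
  exact h2

theorem Reg.dt_eq (hf : Reg T f) {t : ℝ} (ht : t ∈ Ioo 0 T) (x : E2) :
    dt f t x = fderiv ℝ (fun p : ℝ × E2 => f p.1 p.2) (t, x) (1, 0) := (hf.hasDerivAt ht x).deriv

theorem Reg.hasDeriv (hf : Reg T f) {t : ℝ} (ht : t ∈ Ioo 0 T) (x : E2) :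
    HasDerivAt (fun s => f s x) (dt f t x) t := by
  rw [hf.dt_eq ht]; exact hf.hasDerivAt ht x

theorem Reg.fderiv_smooth (hf : Reg T f) (e : ℝ × E2) :
    ContDiffOn ℝ ∞ (fun p => fderiv ℝ (fun p : ℝ × E2 => f p.1 p.2) p e) (Ioo 0 T ×ˢ univ) :=
  (hf.smooth.fderiv_of_isOpen (m := ∞) (isOpen_slab T) (by simp)).clm_apply contDiffOn_const

theorem Reg.D (hf : Reg T f) (i : Fin 2) : Reg T (D i f) :=
  ⟨fun t => (hf.sch t).pd i, (hf.fderiv_smooth (0, Pi.single i 1)).congr fun p hp => hf.pd_eq hp.1 p.2 i⟩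

theorem Reg.dt_smooth (hf : Reg T f) :
    ContDiffOn ℝ ∞ (fun p : ℝ × E2 => dt f p.1 p.2) (Ioo 0 T ×ˢ univ) :=
  (hf.fderiv_smooth (1, 0)).congr fun p hp => hf.dt_eq hp.1 p.2

theorem Reg.contOn (hf : Reg T f) : ContinuousOn (fun p : ℝ × E2 => f p.1 p.2) (Ioo 0 T ×ˢ univ) :=
  hf.smooth.continuousOn

theorem dt_add (hf : Reg T f) (hg : Reg T g) {t : ℝ} (ht : t ∈ Ioo 0 T) (x : E2) :
    dt (f + g) t x = dt f t x + dt g t x := ((hf.hasDeriv ht x).add (hg.hasDeriv ht x)).deriv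

theorem dt_sub (hf : Reg T f) (hg : Reg T g) {t : ℝ} (ht : t ∈ Ioo 0 T) (x : E2) :
    dt (f - g) t x = dt f t x - dt g t x := ((hf.hasDeriv ht x).sub (hg.hasDeriv ht x)).deriv

theorem dt_neg (hf : Reg T f) {t : ℝ} (ht : t ∈ Ioo 0 T) (x : E2) :
    dt (-f) t x = - dt f t x := ((hf.hasDeriv ht x).neg).deriv

theorem dt_D (hf : Reg T f) {t : ℝ} (ht : t ∈ Ioo 0 T) (x : E2) (i : Fin 2) :
    dt (_root_.D i f) t x = pd i (dt f t) x := by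
  rw [(hf.D i).dt_eq ht]
  set F := fun p : ℝ × E2 => f p.1 p.2 with hF
  have hmem := (isOpen_slab T).mem_nhds (slab_mem ht x)
  have hFd : DifferentiableAt ℝ (fderiv ℝ F) (t, x) :=
    ((hf.smooth.contDiffAt hmem).fderiv_right (m := 1) (by norm_cast)).differentiableAt (by simp)
  have hsym : IsSymmSndFDerivAt ℝ F (t, x) :=
    (hf.smooth.contDiffAt hmem).isSymmSndFDerivAt (by simp; norm_cast)
  have ev : ∀ e : ℝ × E2, fderiv ℝ (fun p => fderiv ℝ F p e) (t, x) =
      (ContinuousLinearMap.apply ℝ ℝ e).comp (fderiv ℝ (fderiv ℝ F) (t, x)) := fun e =>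
    ((ContinuousLinearMap.apply ℝ ℝ e).hasFDerivAt.comp (t, x) hFd.hasFDerivAt).fderiv
  have e1 : fderiv ℝ (fun p : ℝ × E2 => _root_.D i f p.1 p.2) (t, x) =
      fderiv ℝ (fun p => fderiv ℝ F p (0, Pi.single i 1)) (t, x) := by
    apply Filter.EventuallyEq.fderiv_eq
    filter_upwards [hmem] with p hp
    exact hf.pd_eq hp.1 p.2 i
  have e2 : pd i (dt f t) x = fderiv ℝ (fun p => fderiv ℝ F p (1, 0)) (t, x) (0, Pi.single i 1) := by
    have h0 : dt f t = fun y => fderiv ℝ F (t, y) (1, 0) := funext fun y => hf.dt_eq ht y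
    have h1 : HasFDerivAt (fun x : E2 => (t, x)) (ContinuousLinearMap.inr ℝ ℝ E2) x :=
      hasFDerivAt_prodMk_right t x
    have hd : DifferentiableAt ℝ (fun p => fderiv ℝ F p (1, 0)) (t, x) := by
      have := (ContinuousLinearMap.apply ℝ ℝ ((1, 0) : ℝ × E2)).differentiableAt.comp (t, x) hFd
      exact this
    have h2 : fderiv ℝ (fun y => fderiv ℝ F (t, y) (1, 0)) x = _ := (hd.hasFDerivAt.comp x h1).fderiv
    rw [h0]
    unfold pd
    rw [h2]
    simp
  rw [e1, e2, ev, ev]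
  exact hsym _ _

theorem D_add (hf : Reg T f) (hg : Reg T g) (i : Fin 2) : D i (f + g) = D i f + D i g :=
  funext fun t => pd_add (hf.sch t) (hg.sch t) i

theorem D_sub (hf : Reg T f) (hg : Reg T g) (i : Fin 2) : D i (f - g) = D i f - D i g :=
  funext fun t => pd_sub (hf.sch t) (hg.sch t) i

theorem D_neg (f : TF) (i : Fin 2) : D i (-f) = - D i f := funext fun t => pd_neg (f t) i

theorem D_zero (i : Fin 2) : D i 0 = 0 := funext fun _ => pd_zero i

theorem D_mul (hf : Reg T f) (hg : Reg T g) (i : Fin 2) : D i (f * g) = D i f * g + f * D i g :=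
  funext fun t => pd_mul (hf.sch t) (hg.sch t) i

theorem D_comm (hf : Reg T f) (i j : Fin 2) : D i (D j f) = D j (D i f) :=
  funext fun t => pd_comm (hf.sch t) i j

theorem aesm_integral (hf : Reg T f) :
    AEStronglyMeasurable (fun t => ∫ x, f t x) (volume.restrict (Ioo 0 T)) := by
  let F : ℝ × E2 → ℝ := indicator (Ioo 0 T ×ˢ univ) (fun p => f p.1 p.2)
  have hF : StronglyMeasurable F := by
    have hm : Measurable F := by
      have := hf.contOn
      exact measurable_of_continuousOn_compl_singleton_aux this (isOpen_slab T)
    exact hm.stronglyMeasurable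
  have h2 : StronglyMeasurable (fun t => ∫ x, F (t, x)) := hF.integral_prod_right'
  refine ⟨_, h2, ?_⟩
  filter_upwards [ae_restrict_mem measurableSet_Ioo] with t ht
  congr 1; ext x
  simp only [F]
  rw [indicator_of_mem (slab_mem ht x)]
where
  measurable_of_continuousOn_compl_singleton_aux {F : ℝ × E2 → ℝ} {s : Set (ℝ × E2)}
      (h : ContinuousOn F s) (hs : IsOpen s) : Measurable (indicator s F) := by
    classical
    have := h.measurable_piecewise (g := fun _ => (0:ℝ)) continuousOn_const hs.measurableSet
    convert this using 1
    ext p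
    simp [indicator, piecewise]

theorem aesm_nn (hf : Reg T f) :
    AEStronglyMeasurable (fun t => nn (f t)) (volume.restrict (Ioo 0 T)) := by
  have := aesm_integral (hf.mul hf)
  refine this.congr (Eventually.of_forall fun t => ?_)
  simp only [nn]
  congr 1; ext x; simp [sq]

theorem aesm_hs (s : ℕ) : ∀ {f : TF}, Reg T f →
    AEStronglyMeasurable (fun t => hs s (f t)) (volume.restrict (Ioo 0 T)) := by
  induction s with
  | zero => intro f hf; exact aesm_nn hf
  | succ s ih => intro f hf; exact (aesm_nn hf).add ((ih (hf.D 0)).add (ih (hf.D 1)))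

end

end

end Part4

section Part5
open MeasureTheory Set Filter Topology
open scoped ENNReal ContDiff SchwartzMap

noncomputable section

/-! ### cutoffs -/

theorem exists_cut : ∃ χ : E2 → ℝ, CK χ ∧ χ 0 = 1 ∧ (∀ x, 0 ≤ χ x) ∧ (∀ x, χ x ≤ 1) := by
  let B : ContDiffBump (0 : E2) := ⟨1, 2, by norm_num, by norm_num⟩
  refine ⟨B, ⟨B.contDiff, B.hasCompactSupport⟩, ?_, fun x => B.nonneg, fun x => B.le_one⟩
  exact B.one_of_mem_closedBall (by simp [B])

theorem exists_cuts : ∃ (χ : ℕ → E2 → ℝ) (δ : ℕ → ℝ), (∀ n, CK (χ n)) ∧ (∀ n x, 0 ≤ χ n x) ∧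
    (∀ n x, χ n x ≤ 1) ∧ (∀ n, 0 ≤ δ n) ∧ Tendsto δ atTop (𝓝 0) ∧
    (∀ n x i, |pd i (χ n) x| ≤ δ n) ∧ ∀ x, Tendsto (fun n => χ n x) atTop (𝓝 1) := by
  obtain ⟨χ, h1, h2, h3, h4⟩ := exists_cut
  obtain ⟨C, hC, hb⟩ := h1.sch.grad_bdd
  have hσ : ∀ n : ℕ, (0:ℝ) < 1 / ((n:ℝ) + 1) := fun n => by positivity
  have hlim : Tendsto (fun n : ℕ => 1 / ((n:ℝ) + 1)) atTop (𝓝 0) := tendsto_one_div_add_atTop_nhds_zero_nat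
  refine ⟨fun n x => χ (0 + (1 / ((n:ℝ) + 1)) • x), fun n => 1 / ((n:ℝ) + 1) * C, fun n => ⟨contDiff_scale h1.1 _ _, ?_⟩,
    fun n x => h3 _, fun n x => h4 _, fun n => by have := hσ n; positivity, ?_, fun n x i => ?_, fun x => ?_⟩
  · have := h1.2.comp_smul (hσ n).ne'
    simpa using this
  · simpa using hlim.mul_const C
  · rw [pd_scale (h1.1.differentiable (by simp)), abs_mul, abs_of_pos (hσ n)]
    have := hσ n
    exact mul_le_mul_of_nonneg_left (hb _ _) (hσ n).le
  · have hc := h1.1.continuous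
    have : Tendsto (fun n : ℕ => (0:E2) + (1 / ((n:ℝ) + 1)) • x) atTop (𝓝 (0 + (0:ℝ) • x)) :=
      (hlim.smul_const x).const_add 0
    simp only [zero_smul, add_zero] at this
    have h5 := (hc.tendsto 0).comp this
    rw [h2] at h5
    exact h5

section
variable {T : ℝ}

theorem cut_cont {φ : E2 → ℝ} (hφ : CK φ) {w : ℝ → E2 → ℝ}
    (hw : ContinuousOn (fun p : ℝ × E2 => w p.1 p.2) (Ioo 0 T ×ˢ univ)) :
    ContinuousOn (fun t => ∫ x, φ x * w t x) (Ioo 0 T) := by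
  refine continuousOn_integral_of_compact_support (k := tsupport φ) hφ.2.isCompact ?_ ?_
  · have h1 : Continuous (fun p : ℝ × E2 => φ p.2) := hφ.1.continuous.comp continuous_snd
    exact h1.continuousOn.mul hw
  · intro t x _ hx
    rw [image_eq_zero_of_notMem_tsupport hx, zero_mul]

theorem cut_deriv {φ : E2 → ℝ} (hφ : CK φ) {f : TF} (hf : Reg T f) {t : ℝ} (ht : t ∈ Ioo 0 T) :
    HasDerivAt (fun t => ∫ x, φ x * f t x ^ 2) (∫ x, φ x * (2 * f t x * dt f t x)) t := by
  obtain ⟨ε, hε, hball⟩ : ∃ ε > 0, Metric.closedBall t ε ⊆ Ioo 0 T :=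
    Metric.nhds_basis_closedBall.mem_iff.1 (isOpen_Ioo.mem_nhds ht)
  have hφc := hφ.1.continuous
  have cont : ContinuousOn (fun p : ℝ × E2 => φ p.2 * (2 * f p.1 p.2 * dt f p.1 p.2)) (Ioo 0 T ×ˢ univ) := by
    have h1 : Continuous (fun p : ℝ × E2 => φ p.2) := hφc.comp continuous_snd
    exact h1.continuousOn.mul ((continuousOn_const.mul hf.contOn).mul hf.dt_smooth.continuousOn)
  obtain ⟨C, hC⟩ := ((isCompact_closedBall t ε).prod hφ.2.isCompact).exists_bound_of_continuousOn
    (cont.mono (prod_mono hball (subset_univ _)))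
  refine (hasDerivAt_integral_of_dominated_loc_of_deriv_le (μ := (volume : Measure E2))
    (F := fun t x => φ x * f t x ^ 2)
    (F' := fun t x => φ x * (2 * f t x * dt f t x))
    (bound := (tsupport φ).indicator fun _ => C) (s := Metric.closedBall t ε) (x₀ := t)
    (Metric.closedBall_mem_nhds t hε) ?_ ?_ ?_ ?_ ?_ ?_).2
  · refine Eventually.of_forall fun s => ?_
    have := (hf.sch s).cont
    exact Continuous.aestronglyMeasurable (by fun_prop)
  · have h1 := hφ.sch.mul ((hf.sch t).mul (hf.sch t))
    refine h1.integrable.congr (Eventually.of_forall fun x => ?_)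
    simp [sq]
  · refine Continuous.aestronglyMeasurable ?_
    rw [← continuousOn_univ]
    exact cont.comp (f := fun x : E2 => (t, x)) (by fun_prop) (fun x _ => slab_mem ht x)
  · refine Eventually.of_forall fun x s hs => ?_
    by_cases hx : x ∈ tsupport φ
    · rw [indicator_of_mem hx]
      exact hC (s, x) ⟨hs, hx⟩
    · rw [indicator_of_notMem hx, image_eq_zero_of_notMem_tsupport hx]; simp
  · rw [integrable_indicator_iff (isClosed_tsupport φ).measurableSet]
    exact integrableOn_const (hφ.2.isCompact.measure_lt_top.ne)
  · refine Eventually.of_forall fun x s hs => ?_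
    have := ((hf.hasDeriv (hball hs) x).pow 2).const_mul (φ x)
    refine this.congr_deriv ?_
    simp

end
end

end Part5

section Part6
open MeasureTheory Set Filter Topology
open scoped ENNReal ContDiff SchwartzMap

noncomputable section

/-! ### the energy inequality -/

theorem lim_energy {μ : Measure ℝ} [IsFiniteMeasure μ] {g J : ℕ → ℝ → ℝ} {G : ℝ → ℝ}
    {δ e0 e1 : ℕ → ℝ} {K B V0 V1 q L : ℝ} (hK : 0 ≤ K)
    (hδ : Tendsto δ atTop (𝓝 0))
    (hg : ∀ n, Integrable (g n) μ) (hg0 : ∀ n, ∀ᵐ t ∂μ, 0 ≤ g n t)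
    (hgG : ∀ n, ∀ᵐ t ∂μ, g n t ≤ G t) (hlim : ∀ᵐ t ∂μ, Tendsto (fun n => g n t) atTop (𝓝 (G t)))
    (hJ : ∀ n, Integrable (J n) μ) (hJB : ∀ n, ∀ᵐ t ∂μ, |J n t| ≤ B)
    (hJlim : ∀ᵐ t ∂μ, Tendsto (fun n => J n t) atTop (𝓝 0))
    (he0 : Tendsto e0 atTop (𝓝 V0)) (he1 : Tendsto e1 atTop (𝓝 V1)) (he1n : ∀ n, 0 ≤ e1 n)
    (hin : ∀ n, e1 n + (1 - 2 * δ n * (1 + K)) * ∫ t, g n t ∂μ ≤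
      e0 n + (1 + 2 * δ n) * q + 12 * δ n * L + 2 * ∫ t, J n t ∂μ) :
    Integrable G μ ∧ V1 + ∫ t, G t ∂μ ≤ V0 + q := by
  have hJt : Tendsto (fun n => ∫ t, J n t ∂μ) atTop (𝓝 0) := by
    have := tendsto_integral_of_dominated_convergence (μ := μ) (F := J) (f := fun _ => 0) (fun _ => B)
      (fun n => (hJ n).1) (integrable_const B) (fun n => by simpa using hJB n) hJlim
    simpa using this
  have hR : Tendsto (fun n => e0 n + (1 + 2 * δ n) * q + 12 * δ n * L + 2 * ∫ t, J n t ∂μ) atTop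
      (𝓝 (V0 + (1 + 2 * 0) * q + 12 * 0 * L + 2 * 0)) :=
    ((he0.add (((hδ.const_mul 2).const_add 1).mul_const q)).add ((hδ.const_mul 12).mul_const L)).add
      (hJt.const_mul 2)
  have hc : Tendsto (fun n => 1 - 2 * δ n * (1 + K)) atTop (𝓝 (1 - 2 * 0 * (1 + K))) :=
    ((hδ.const_mul 2).mul_const (1 + K)).const_sub 1
  simp only [mul_zero, zero_mul, add_zero, one_mul, sub_zero] at hR hc
  have hGi : Integrable G μ := by
    refine integrable_of_tendsto hlim (fun n => (hg n).1) ?_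
    have h1 : ∀ᶠ n in atTop, ∫⁻ t, ‖g n t‖ₑ ∂μ ≤ ENNReal.ofReal (2 * (V0 + q + 1)) := by
      filter_upwards [hR.eventually_lt_const (show V0 + q < V0 + q + 1 by linarith),
        hc.eventually_const_lt (show (1:ℝ)/2 < 1 by norm_num)] with n h2 h3
      rw [← ofReal_integral_norm_eq_lintegral_enorm (hg n)]
      apply ENNReal.ofReal_le_ofReal
      have : ∫ t, ‖g n t‖ ∂μ = ∫ t, g n t ∂μ :=
        integral_congr_ae ((hg0 n).mono fun t ht => by simp [abs_of_nonneg ht])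
      rw [this]
      have h4 : 0 ≤ ∫ t, g n t ∂μ := integral_nonneg_of_ae (hg0 n)
      have := hin n
      have := he1n n
      nlinarith
    refine ne_top_of_le_ne_top ENNReal.ofReal_ne_top (liminf_le_of_frequently_le' h1.frequently)
  refine ⟨hGi, ?_⟩
  have hgt : Tendsto (fun n => ∫ t, g n t ∂μ) atTop (𝓝 (∫ t, G t ∂μ)) := by
    refine tendsto_integral_of_dominated_convergence G (fun n => (hg n).1) hGi (fun n => ?_) hlim
    filter_upwards [hg0 n, hgG n] with t h1 h2
    rwa [Real.norm_of_nonneg h1]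
  have := le_of_tendsto_of_tendsto' (he1.add (hc.mul hgt)) hR hin
  simpa using this

theorem int_comb {α : Type*} [MeasurableSpace α] {μ : Measure α} {f g h k : α → ℝ} (c1 c2 c3 : ℝ)
    (hf : Integrable f μ) (hg : Integrable g μ) (hh : Integrable h μ) (hk : Integrable k μ) :
    ∫ x, (-(c1 * f x) + c2 * g x + c3 * h x + 2 * k x) ∂μ =
      -(c1 * ∫ x, f x ∂μ) + c2 * (∫ x, g x ∂μ) + c3 * (∫ x, h x ∂μ) + 2 * ∫ x, k x ∂μ := by
  have a1 : Integrable (fun x => -(c1 * f x)) μ := (hf.const_mul c1).neg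
  have a2 : Integrable (fun x => -(c1 * f x) + c2 * g x) μ := a1.add (hg.const_mul c2)
  have a3 : Integrable (fun x => -(c1 * f x) + c2 * g x + c3 * h x) μ := a2.add (hh.const_mul c3)
  rw [integral_add a3 (hk.const_mul 2), integral_add a2 (hh.const_mul c3), integral_add a1 (hg.const_mul c2),
    integral_neg, integral_const_mul, integral_const_mul, integral_const_mul, integral_const_mul]

theorem energy_pt {χ δ d v p N M : ℝ} (h0 : 0 ≤ χ) (hd : |d| ≤ δ) :
    -(2 * ((2 * χ * d * v + χ ^ 2 * p) * (p + (N + M)))) ≤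
      - (χ ^ 2 * p ^ 2) + χ ^ 2 * N ^ 2 - 2 * χ ^ 2 * (M * p)
        + 2 * δ * (3 * v ^ 2 + χ ^ 2 * (p ^ 2 + N ^ 2 + M ^ 2)) := by
  obtain ⟨h1, h2⟩ := abs_le.1 hd
  have key : ∀ y : ℝ, - (4 * χ * d * v * y) ≤ 2 * δ * (v ^ 2 + χ ^ 2 * y ^ 2) := by
    intro y
    have h3 := mul_nonneg (sub_nonneg.2 h2) (sq_nonneg (v - χ * y))
    have h4 := mul_nonneg (by linarith : 0 ≤ δ + d) (sq_nonneg (v + χ * y))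
    nlinarith
  have h5 := key p
  have h6 := key N
  have h7 := key M
  have h8 : 0 ≤ χ ^ 2 * (p + N) ^ 2 := by positivity
  nlinarith

section
variable {T : ℝ} {ι : Type} [Fintype ι]

theorem Sch.sum {κ : Type*} {s : Finset κ} {f : κ → E2 → ℝ} (h : ∀ a, Sch (f a)) : Sch (∑ a ∈ s, f a) := by
  classical
  induction s using Finset.induction_on with
  | empty => simpa using Sch.zero
  | insert a s ha ih => rw [Finset.sum_insert ha]; exact (h a).add ih

theorem energy {v : ι → TF} {N M : ι → Fin 2 → TF} {H : ι → TF} (hv : ∀ a, Reg T (v a))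
    (hN : ∀ a i, Reg T (N a i)) (hM : ∀ a i, Reg T (M a i)) (hH : ∀ a, Reg T (H a))
    (heq : ∀ t ∈ Ioo 0 T, ∀ x a, dt (v a) t x =
      lap (v a t) x + ∑ i, pd i (N a i t + M a i t) x + H a t x)
    (hcan : ∀ t ∈ Ioo 0 T, ∀ x, ∑ a, ∑ i, M a i t x * pd i (v a t) x = 0)
    {t0 t1 : ℝ} (h0 : 0 < t0) (h01 : t0 < t1) (h1 : t1 < T) {K B : ℝ} (hK0 : 0 ≤ K)
    (hK : ∀ t ∈ Icc t0 t1, ∀ x, ∑ a, ∑ i, M a i t x ^ 2 ≤ K * ∑ a, ∑ i, pd i (v a t) x ^ 2)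
    (hvB : ∀ t ∈ Icc t0 t1, ∑ a, nn (v a t) ≤ B) (hHB : ∀ t ∈ Icc t0 t1, ∑ a, nn (H a t) ≤ B)
    (hH0 : ∀ t ∈ Icc t0 t1, ∑ a, ∫ x, v a t x * H a t x = 0)
    (hQ : IntegrableOn (fun t => ∑ a, ∑ i, nn (N a i t)) (Ioo t0 t1)) :
    IntegrableOn (fun t => ∑ a, ∑ i, nn (pd i (v a t))) (Ioo t0 t1) ∧
      ∑ a, nn (v a t1) + ∫ t in Ioo t0 t1, ∑ a, ∑ i, nn (pd i (v a t)) ≤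
        ∑ a, nn (v a t0) + ∫ t in Ioo t0 t1, ∑ a, ∑ i, nn (N a i t) := by
  obtain ⟨χ, δ, hχ, hχ0, hχ1, hδ0, hδ, hχd, hχl⟩ := exists_cuts
  have hsub : Icc t0 t1 ⊆ Ioo 0 T := fun t ht => ⟨h0.trans_le ht.1, ht.2.trans_lt h1⟩
  have hsub' : Ioo t0 t1 ⊆ Icc t0 t1 := Ioo_subset_Icc_self
  have hφ : ∀ n, CK (χ n * χ n) := fun n => ⟨(hχ n).1.mul (hχ n).1, (hχ n).2.mul_right⟩
  have hφ0 : ∀ n x, 0 ≤ (χ n * χ n) x := fun n x => mul_nonneg (hχ0 n x) (hχ0 n x)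
  have hφ1 : ∀ n x, (χ n * χ n) x ≤ 1 := fun n x => mul_le_one₀ (hχ1 n x) (hχ0 n x) (hχ1 n x)
  have hφl : ∀ x, Tendsto (fun n => (χ n * χ n) x) atTop (𝓝 1) := fun x => by
    simpa using (hχl x).mul (hχl x)
  -- generic dominated limit in space
  have hspace : ∀ w : E2 → ℝ, Integrable w → Tendsto (fun n => ∫ x, (χ n * χ n) x * w x) atTop (𝓝 (∫ x, w x)) := by
    intro w hw
    refine tendsto_integral_of_dominated_convergence (fun x => |w x|)
      (fun n => ((hφ n).1.continuous.aestronglyMeasurable).mul hw.1) hw.abs (fun n => Eventually.of_forall fun x => ?_)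
      (Eventually.of_forall fun x => ?_)
    · rw [Real.norm_eq_abs, abs_mul, abs_of_nonneg (hφ0 n x)]
      exact mul_le_of_le_one_left (abs_nonneg _) (hφ1 n x)
    · simpa using (hφl x).mul_const (w x)
  have hφi : ∀ n (w : E2 → ℝ), Integrable w → Integrable (fun x => (χ n * χ n) x * w x) := by
    intro n w hw
    refine hw.abs.mono (((hφ n).1.continuous.aestronglyMeasurable).mul hw.1) (Eventually.of_forall fun x => ?_)
    simp only [Pi.mul_apply] at *
    rw [Real.norm_eq_abs, abs_mul, abs_of_nonneg (hφ0 n x)]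
    simpa using mul_le_of_le_one_left (abs_nonneg (w x)) (hφ1 n x)
  -- densities
  set Gx : TF := fun t x => ∑ a, ∑ i, pd i (v a t) x ^ 2 with hGx
  set Vx : TF := fun t x => ∑ a, v a t x ^ 2 with hVx
  set Nx : TF := fun t x => ∑ a, ∑ i, N a i t x ^ 2 with hNx
  set Hx : TF := fun t x => ∑ a, v a t x * H a t x with hHx
  have iG : ∀ t, Integrable (Gx t) := fun t => integrable_finsetSum _ fun a _ =>
    integrable_finsetSum _ fun i _ => (((hv a).sch t).pd i).integrable_sq
  have iV : ∀ t, Integrable (Vx t) := fun t => integrable_finsetSum _ fun a _ => ((hv a).sch t).integrable_sq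
  have iN : ∀ t, Integrable (Nx t) := fun t => integrable_finsetSum _ fun a _ =>
    integrable_finsetSum _ fun i _ => ((hN a i).sch t).integrable_sq
  have iH : ∀ t, Integrable (Hx t) := fun t => integrable_finsetSum _ fun a _ =>
    ((hv a).sch t).integrable_mul ((hH a).sch t)
  have eG : ∀ t, ∫ x, Gx t x = ∑ a, ∑ i, nn (pd i (v a t)) := fun t => by
    simp only [hGx, nn]
    rw [integral_finsetSum _ fun a _ => integrable_finsetSum _ fun i _ => (((hv a).sch t).pd i).integrable_sq]
    exact Finset.sum_congr rfl fun a _ => integral_finsetSum _ fun i _ => (((hv a).sch t).pd i).integrable_sq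
  have eN : ∀ t, ∫ x, Nx t x = ∑ a, ∑ i, nn (N a i t) := fun t => by
    simp only [hNx, nn]
    rw [integral_finsetSum _ fun a _ => integrable_finsetSum _ fun i _ => ((hN a i).sch t).integrable_sq]
    exact Finset.sum_congr rfl fun a _ => integral_finsetSum _ fun i _ => ((hN a i).sch t).integrable_sq
  have eV : ∀ t, ∫ x, Vx t x = ∑ a, nn (v a t) := fun t => by
    simp only [hVx, nn]
    exact integral_finsetSum _ fun a _ => ((hv a).sch t).integrable_sq
  have eH : ∀ t, ∫ x, Hx t x = ∑ a, ∫ x, v a t x * H a t x := fun t => by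
    simp only [hHx]
    exact integral_finsetSum _ fun a _ => ((hv a).sch t).integrable_mul ((hH a).sch t)
  have cG : ContinuousOn (fun p : ℝ × E2 => Gx p.1 p.2) (Ioo 0 T ×ˢ univ) :=
    continuousOn_finsetSum _ fun a _ => continuousOn_finsetSum _ fun i _ => ((hv a).D i).contOn.pow 2
  have cH : ContinuousOn (fun p : ℝ × E2 => Hx p.1 p.2) (Ioo 0 T ×ˢ univ) :=
    continuousOn_finsetSum _ fun a _ => (hv a).contOn.mul (hH a).contOn
  have cV : ContinuousOn (fun p : ℝ × E2 => Vx p.1 p.2) (Ioo 0 T ×ˢ univ) :=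
    continuousOn_finsetSum _ fun a _ => (hv a).contOn.pow 2
  have G0 : ∀ t x, 0 ≤ Gx t x := fun t x => Finset.sum_nonneg fun a _ => Finset.sum_nonneg fun i _ => sq_nonneg _
  have N0 : ∀ t x, 0 ≤ Nx t x := fun t x => Finset.sum_nonneg fun a _ => Finset.sum_nonneg fun i _ => sq_nonneg _
  have V0 : ∀ t x, 0 ≤ Vx t x := fun t x => Finset.sum_nonneg fun a _ => sq_nonneg _
  have mono1 : ∀ n (w : E2 → ℝ), Integrable w → (∀ x, 0 ≤ w x) → ∫ x, (χ n * χ n) x * w x ≤ ∫ x, w x := by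
    intro n w hw hw0
    exact integral_mono (hφi n w hw) hw fun x => mul_le_of_le_one_left (hw0 x) (hφ1 n x)
  have intOn : ∀ n (w : TF), ContinuousOn (fun p : ℝ × E2 => w p.1 p.2) (Ioo 0 T ×ˢ univ) →
      IntegrableOn (fun t => ∫ x, (χ n * χ n) x * w t x) (Icc t0 t1) := by
    intro n w hw
    exact ((cut_cont (hφ n) hw).mono hsub).integrableOn_Icc
  -- derivative inequality
  have hder : ∀ n, ∀ t ∈ Icc t0 t1, ∑ a, ∫ x, (χ n * χ n) x * (2 * v a t x * dt (v a) t x) ≤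
      -((1 - 2 * δ n * (1 + K)) * ∫ x, (χ n * χ n) x * Gx t x) + (1 + 2 * δ n) * (∑ a, ∑ i, nn (N a i t))
        + 12 * δ n * B + 2 * ∫ x, (χ n * χ n) x * Hx t x := by
    intro n t ht
    have hφS := (hφ n).sch
    have e1 : ∀ a, ∫ x, (χ n * χ n) x * (2 * v a t x * dt (v a) t x) =
        ∫ x, (∑ i, -(2 * (pd i (χ n * χ n * v a t) x * (pd i (v a t) + (N a i t + M a i t)) x))
          + 2 * ((χ n * χ n) x * (v a t x * H a t x))) := by
      intro a
      have s1 := hφS.mul ((hv a).sch t)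
      have s2 : ∀ i, Sch (pd i (v a t) + (N a i t + M a i t)) := fun i =>
        (((hv a).sch t).pd i).add (((hN a i).sch t).add ((hM a i).sch t))
      have i1 : ∀ i, Integrable (fun x => 2 * ((χ n * χ n * v a t) x * pd i (pd i (v a t) + (N a i t + M a i t)) x)) :=
        fun i => (s1.integrable_mul ((s2 i).pd i)).const_mul 2
      have i2 : ∀ i, Integrable (fun x => -(2 * (pd i (χ n * χ n * v a t) x * (pd i (v a t) + (N a i t + M a i t)) x))) :=
        fun i => (((s1.pd i).integrable_mul (s2 i)).const_mul 2).neg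
      have i3 : Integrable (fun x => 2 * ((χ n * χ n) x * (v a t x * H a t x))) :=
        (hφi n _ (((hv a).sch t).integrable_mul ((hH a).sch t))).const_mul 2
      have : ∀ x, (χ n * χ n) x * (2 * v a t x * dt (v a) t x) =
          ∑ i, 2 * ((χ n * χ n * v a t) x * pd i (pd i (v a t) + (N a i t + M a i t)) x)
          + 2 * ((χ n * χ n) x * (v a t x * H a t x)) := by
        intro x
        rw [heq t (hsub ht) x a]
        simp only [Fin.sum_univ_two, lap, pd_add (((hv a).sch t).pd _) (((hN a _).sch t).add ((hM a _).sch t)),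
          Pi.mul_apply, Pi.add_apply]
        ring
      simp_rw [this]
      rw [integral_add (integrable_finsetSum _ fun i _ => i1 i) i3, integral_finsetSum _ fun i _ => i1 i,
        integral_add (integrable_finsetSum _ fun i _ => i2 i) i3, integral_finsetSum _ fun i _ => i2 i]
      congr 1
      refine Finset.sum_congr rfl fun i _ => ?_
      rw [integral_neg, integral_const_mul, integral_const_mul, ibp s1 (s2 i)]
      ring
    have s1 := fun a => hφS.mul ((hv a).sch t)
    have s2 : ∀ a i, Sch (pd i (v a t) + (N a i t + M a i t)) := fun a i =>
        (((hv a).sch t).pd i).add (((hN a i).sch t).add ((hM a i).sch t))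
    have i4 : ∀ a, Integrable (fun x => (∑ i, -(2 * (pd i (χ n * χ n * v a t) x * (pd i (v a t) + (N a i t + M a i t)) x))
          + 2 * ((χ n * χ n) x * (v a t x * H a t x)))) := fun a =>
      (integrable_finsetSum _ fun i _ => ((((s1 a).pd i).integrable_mul (s2 a i)).const_mul 2).neg).add
        ((hφi n _ (((hv a).sch t).integrable_mul ((hH a).sch t))).const_mul 2)
    simp_rw [e1]
    rw [← integral_finsetSum _ fun a _ => i4 a]
    have hd := hδ0 n
    calc _ ≤ ∫ x, (-((1 - 2 * δ n * (1 + K)) * ((χ n * χ n) x * Gx t x)) + (1 + 2 * δ n) * Nx t x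
            + 12 * δ n * Vx t x + 2 * ((χ n * χ n) x * Hx t x)) := by
          refine integral_mono (integrable_finsetSum _ fun a _ => i4 a)
            ((((((hφi n _ (iG t)).const_mul _).neg).add ((iN t).const_mul _)).add ((iV t).const_mul _)).add
              ((hφi n _ (iH t)).const_mul 2)) fun x => ?_
          simp only
          have p1 : ∀ a i, -(2 * (pd i (χ n * χ n * v a t) x * (pd i (v a t) + (N a i t + M a i t)) x)) ≤
              - (χ n x ^ 2 * pd i (v a t) x ^ 2) + χ n x ^ 2 * N a i t x ^ 2 - 2 * χ n x ^ 2 * (M a i t x * pd i (v a t) x)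
        + 2 * δ n * (3 * v a t x ^ 2 + χ n x ^ 2 * (pd i (v a t) x ^ 2 + N a i t x ^ 2 + M a i t x ^ 2)) := by
            intro a i
            have e2 : pd i (χ n * χ n * v a t) x = 2 * χ n x * pd i (χ n) x * v a t x + χ n x ^ 2 * pd i (v a t) x := by
              rw [pd_mul hφS ((hv a).sch t), pd_mul (hχ n).sch (hχ n).sch]
              simp only [Pi.add_apply, Pi.mul_apply]; ring
            rw [e2]
            exact energy_pt (hχ0 n x) (hχd n x i)
          have p2 := Finset.sum_le_sum fun a (_ : a ∈ Finset.univ) => Finset.sum_le_sum fun i (_ : i ∈ Finset.univ) => p1 a i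
          rw [Finset.sum_add_distrib]
          have hMt := hcan t (hsub ht) x
          have hKt := hK t ht x
          have hφle : 0 ≤ χ n x ^ 2 := by positivity
          have hφ1' := hφ1 n x
          simp only [Pi.mul_apply] at hφ1' ⊢
          have e3 : ∑ a, 2 * (χ n x * χ n x * (v a t x * H a t x)) = 2 * (χ n x * χ n x * Hx t x) := by
            simp only [hHx, Finset.mul_sum]
          rw [e3]
          have e4 : ∑ a, ∑ i : Fin 2, (- (χ n x ^ 2 * pd i (v a t) x ^ 2) + χ n x ^ 2 * N a i t x ^ 2 - 2 * χ n x ^ 2 * (M a i t x * pd i (v a t) x)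
        + 2 * δ n * (3 * v a t x ^ 2 + χ n x ^ 2 * (pd i (v a t) x ^ 2 + N a i t x ^ 2 + M a i t x ^ 2)))
            = - (χ n x ^ 2 * Gx t x) + χ n x ^ 2 * Nx t x - 2 * χ n x ^ 2 * (∑ a, ∑ i, M a i t x * pd i (v a t) x)
              + 2 * δ n * (6 * Vx t x + χ n x ^ 2 * (Gx t x + Nx t x + ∑ a, ∑ i, M a i t x ^ 2)) := by
            simp only [hGx, hNx, hVx, Fin.sum_univ_two, Finset.mul_sum, Finset.sum_add_distrib, Finset.sum_sub_distrib,
              mul_add, Finset.sum_neg_distrib, ← Finset.mul_sum]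
            ring
          rw [e4, hMt] at p2
          have q1 : χ n x ^ 2 * Nx t x ≤ Nx t x := mul_le_of_le_one_left (N0 t x) (by nlinarith)
          have q2 : χ n x ^ 2 * (∑ a, ∑ i, M a i t x ^ 2) ≤ χ n x ^ 2 * (K * Gx t x) :=
            mul_le_mul_of_nonneg_left hKt hφle
          have q3 := mul_le_mul_of_nonneg_left q2 (by linarith : 0 ≤ 2 * δ n)
          have q4 := mul_le_mul_of_nonneg_left q1 (by linarith : 0 ≤ 2 * δ n)
          have := p2.trans' (le_refl _)
          nlinarith
      _ = -((1 - 2 * δ n * (1 + K)) * ∫ x, (χ n * χ n) x * Gx t x) + (1 + 2 * δ n) * (∑ a, ∑ i, nn (N a i t))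
        + 12 * δ n * (∑ a, nn (v a t)) + 2 * ∫ x, (χ n * χ n) x * Hx t x := by
          rw [int_comb _ _ _ (hφi n _ (iG t)) (iN t) (iV t) (hφi n _ (iH t)), eN, eV]
      _ ≤ _ := by
          have := mul_le_mul_of_nonneg_left (hvB t ht) (by linarith : 0 ≤ 12 * δ n)
          linarith
  have hQ' : IntegrableOn (fun t => ∑ a, ∑ i, nn (N a i t)) (Icc t0 t1) :=
    (integrableOn_Icc_iff_integrableOn_Ioo (by simp) (by simp)).2 hQ
  have habsH : ∀ t ∈ Icc t0 t1, ∫ x, |Hx t x| ≤ B := by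
    intro t ht
    have iHH : Integrable (fun x => ∑ a, H a t x ^ 2) := integrable_finsetSum _ fun a _ => ((hH a).sch t).integrable_sq
    calc ∫ x, |Hx t x| ≤ ∫ x, ((1/2) * Vx t x + (1/2) * ∑ a, H a t x ^ 2) := by
          refine integral_mono (iH t).abs (((iV t).const_mul _).add (iHH.const_mul _)) fun x => ?_
          simp only [hHx, hVx]
          rw [← mul_add, ← Finset.sum_add_distrib, Finset.mul_sum]
          refine (Finset.abs_sum_le_sum_abs _ _).trans (Finset.sum_le_sum fun a _ => ?_)
          rw [abs_le]; constructor <;> nlinarith [sq_nonneg (v a t x + H a t x), sq_nonneg (v a t x - H a t x)]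
      _ = (1/2) * (∑ a, nn (v a t)) + (1/2) * ∑ a, nn (H a t) := by
          rw [integral_add ((iV t).const_mul _) (iHH.const_mul _), integral_const_mul, integral_const_mul, eV]
          congr 2
          exact integral_finsetSum _ fun a _ => ((hH a).sch t).integrable_sq
      _ ≤ B := by linarith [hvB t ht, hHB t ht]
  have main := lim_energy (μ := volume.restrict (Ioo t0 t1)) (g := fun n t => ∫ x, (χ n * χ n) x * Gx t x)
    (J := fun n t => ∫ x, (χ n * χ n) x * Hx t x) (G := fun t => ∑ a, ∑ i, nn (pd i (v a t)))
    (δ := δ) (e0 := fun n => ∫ x, (χ n * χ n) x * Vx t0 x) (e1 := fun n => ∫ x, (χ n * χ n) x * Vx t1 x)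
    (K := K) (B := B) (V0 := ∑ a, nn (v a t0)) (V1 := ∑ a, nn (v a t1))
    (q := ∫ t in Ioo t0 t1, ∑ a, ∑ i, nn (N a i t)) (L := (t1 - t0) * B) hK0 hδ
    (fun n => (intOn n Gx cG).mono_set hsub')
    (fun n => Eventually.of_forall fun t => integral_nonneg fun x => mul_nonneg (hφ0 n x) (G0 t x))
    (fun n => Eventually.of_forall fun t => by rw [← eG]; exact mono1 n _ (iG t) (G0 t))
    (Eventually.of_forall fun t => by rw [← eG]; exact hspace _ (iG t))
    (fun n => (intOn n Hx cH).mono_set hsub')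
    (fun n => (ae_restrict_iff' measurableSet_Ioo).2 (Eventually.of_forall fun t ht => by
      refine (abs_integral_le_integral_abs).trans (le_trans ?_ (habsH t (hsub' ht)))
      refine integral_mono (hφi n _ (iH t)).abs (iH t).abs fun x => ?_
      simp only [abs_mul, abs_of_nonneg (hφ0 n x)]
      exact mul_le_of_le_one_left (abs_nonneg _) (hφ1 n x)))
    ((ae_restrict_iff' measurableSet_Ioo).2 (Eventually.of_forall fun t ht => by
      rw [← hH0 t (hsub' ht), ← eH]; exact hspace _ (iH t)))
    (by rw [← eV]; exact hspace _ (iV t0)) (by rw [← eV]; exact hspace _ (iV t1))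
    (fun n => integral_nonneg fun x => mul_nonneg (hφ0 n x) (V0 t1 x)) ?_
  · exact main
  intro n
  have eE : ∀ t, ∫ x, (χ n * χ n) x * Vx t x = ∑ a, ∫ x, (χ n * χ n) x * v a t x ^ 2 := fun t => by
    simp only [hVx, Finset.mul_sum]
    exact integral_finsetSum _ fun a _ => hφi n _ ((hv a).sch t).integrable_sq
  have key := intervalIntegral.sub_le_integral_of_hasDeriv_right_of_le h01.le
    (g := fun t => ∑ a, ∫ x, (χ n * χ n) x * v a t x ^ 2)
    (g' := fun t => ∑ a, ∫ x, (χ n * χ n) x * (2 * v a t x * dt (v a) t x))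
    (φ := fun t => -((1 - 2 * δ n * (1 + K)) * ∫ x, (χ n * χ n) x * Gx t x) + (1 + 2 * δ n) * (∑ a, ∑ i, nn (N a i t))
        + 12 * δ n * B + 2 * ∫ x, (χ n * χ n) x * Hx t x)
    (((cut_cont (hφ n) cV).mono hsub).congr fun t _ => (eE t).symm)
    (fun t ht => (HasDerivAt.fun_sum fun a _ => cut_deriv (hφ n) (hv a) (hsub (hsub' ht))).hasDerivWithinAt)
    ((((((intOn n Gx cG).const_mul _).neg).add (hQ'.const_mul _)).add (integrableOn_const (by simp))).add
      ((intOn n Hx cH).const_mul 2))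
    (fun t ht => hder n t (hsub' ht))
  have jG := (intOn n Gx cG).mono_set hsub'
  have jH := (intOn n Hx cH).mono_set hsub'
  have jc : IntegrableOn (fun _ : ℝ => B) (Ioo t0 t1) := integrableOn_const (by simp)
  rw [intervalIntegral.integral_of_le h01.le, integral_Ioc_eq_integral_Ioo,
    int_comb (f := fun t => ∫ x, (χ n * χ n) x * Gx t x) _ _ _ jG hQ jc jH, setIntegral_const] at key
  simp only [← eE, measureReal_def, Real.volume_Ioo, smul_eq_mul,
    ENNReal.toReal_ofReal (sub_nonneg.2 h01.le)] at key
  linarith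

end
end

end Part6

section Part7
open MeasureTheory Set Filter Topology
open scoped ENNReal ContDiff SchwartzMap

noncomputable section

/-! ### bounded / integrable near the final time, locally bounded -/

/-- bounded near the final time -/
def TB (T : ℝ) (g : ℝ → ℝ) : Prop := ∃ τ ∈ Ioo 0 T, ∃ B : ℝ, 0 ≤ B ∧ ∀ t ∈ Ioo τ T, g t ≤ B

/-- dominated by an integrable function near the final time -/
def TI (T : ℝ) (g : ℝ → ℝ) : Prop :=
  ∃ τ ∈ Ioo 0 T, ∃ G : ℝ → ℝ, IntegrableOn G (Ioo τ T) ∧ ∀ t ∈ Ioo τ T, 0 ≤ G t ∧ g t ≤ G t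

/-- locally bounded -/
def LB (T : ℝ) (g : ℝ → ℝ) : Prop :=
  ∀ t0 t1, 0 < t0 → t0 < t1 → t1 < T → ∃ B : ℝ, 0 ≤ B ∧ ∀ t ∈ Icc t0 t1, g t ≤ B

section
variable {T : ℝ} {f g h X Y : ℝ → ℝ}

theorem max_mem {a b : ℝ} (ha : a ∈ Ioo 0 T) (hb : b ∈ Ioo 0 T) : max a b ∈ Ioo 0 T :=
  ⟨lt_max_of_lt_left ha.1, max_lt ha.2 hb.2⟩

theorem sub_left {a b : ℝ} : Ioo (max a b) T ⊆ Ioo a T := Ioo_subset_Ioo_left (le_max_left _ _)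
theorem sub_right {a b : ℝ} : Ioo (max a b) T ⊆ Ioo b T := Ioo_subset_Ioo_left (le_max_right _ _)

theorem mem_of_tail {τ t : ℝ} (h : τ ∈ Ioo 0 T) (ht : t ∈ Ioo τ T) : t ∈ Ioo 0 T := ⟨h.1.trans ht.1, ht.2⟩

theorem TB.mono (hg : TB T g) (h : ∀ t ∈ Ioo 0 T, f t ≤ g t) : TB T f := by
  obtain ⟨τ, hτ, B, hB, hb⟩ := hg
  exact ⟨τ, hτ, B, hB, fun t ht => (h t (mem_of_tail hτ ht)).trans (hb t ht)⟩

theorem TB.add (hf : TB T f) (hg : TB T g) : TB T (fun t => f t + g t) := by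
  obtain ⟨τ, hτ, B, hB, hb⟩ := hf
  obtain ⟨τ', hτ', B', hB', hb'⟩ := hg
  exact ⟨_, max_mem hτ hτ', B + B', by positivity, fun t ht => add_le_add (hb t (sub_left ht)) (hb' t (sub_right ht))⟩

theorem TB.mul (hf : TB T f) (hg : TB T g) (hg0 : ∀ t ∈ Ioo 0 T, 0 ≤ g t) : TB T (fun t => f t * g t) := by
  obtain ⟨τ, hτ, B, hB, hb⟩ := hf
  obtain ⟨τ', hτ', B', hB', hb'⟩ := hg
  exact ⟨_, max_mem hτ hτ', B * B', by positivity, fun t ht =>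
    mul_le_mul (hb t (sub_left ht)) (hb' t (sub_right ht)) (hg0 t (mem_of_tail hτ' (sub_right ht))) hB⟩

theorem TB.const_mul {c : ℝ} (hc : 0 ≤ c) (hf : TB T f) : TB T (fun t => c * f t) := by
  obtain ⟨τ, hτ, B, hB, hb⟩ := hf
  exact ⟨τ, hτ, c * B, by positivity, fun t ht => mul_le_mul_of_nonneg_left (hb t ht) hc⟩

theorem TB.sum {ι : Type*} {s : Finset ι} {F : ι → ℝ → ℝ} (hT : 0 < T) (h : ∀ a ∈ s, TB T (F a)) :
    TB T (fun t => ∑ a ∈ s, F a t) := by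
  classical
  induction s using Finset.induction_on with
  | empty => exact ⟨T / 2, ⟨by linarith, by linarith⟩, 0, le_rfl, fun t _ => by simp⟩
  | insert a s ha ih =>
    simp only [Finset.sum_insert ha]
    exact (h a (by simp)).add (ih fun b hb => h b (by simp [hb]))

theorem TI.mono (hg : TI T g) (h : ∀ t ∈ Ioo 0 T, f t ≤ g t) : TI T f := by
  obtain ⟨τ, hτ, G, hG, hb⟩ := hg
  exact ⟨τ, hτ, G, hG, fun t ht => ⟨(hb t ht).1, (h t (mem_of_tail hτ ht)).trans (hb t ht).2⟩⟩

theorem TB.toTI (hf : TB T f) : TI T f := by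
  obtain ⟨τ, hτ, B, hB, hb⟩ := hf
  exact ⟨τ, hτ, fun _ => B, integrableOn_const (by simp), fun t ht => ⟨hB, hb t ht⟩⟩

theorem TI.add (hf : TI T f) (hg : TI T g) : TI T (fun t => f t + g t) := by
  obtain ⟨τ, hτ, B, hB, hb⟩ := hf
  obtain ⟨τ', hτ', B', hB', hb'⟩ := hg
  exact ⟨_, max_mem hτ hτ', fun t => B t + B' t, (hB.mono_set sub_left).add (hB'.mono_set sub_right), fun t ht =>
    ⟨add_nonneg (hb t (sub_left ht)).1 (hb' t (sub_right ht)).1,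
      add_le_add (hb t (sub_left ht)).2 (hb' t (sub_right ht)).2⟩⟩

theorem TI.const_mul {c : ℝ} (hc : 0 ≤ c) (hf : TI T f) : TI T (fun t => c * f t) := by
  obtain ⟨τ, hτ, B, hB, hb⟩ := hf
  exact ⟨τ, hτ, fun t => c * B t, hB.const_mul c, fun t ht =>
    ⟨mul_nonneg hc (hb t ht).1, mul_le_mul_of_nonneg_left (hb t ht).2 hc⟩⟩

theorem TI.sum {ι : Type*} {s : Finset ι} {F : ι → ℝ → ℝ} (hT : 0 < T) (h : ∀ a ∈ s, TI T (F a)) :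
    TI T (fun t => ∑ a ∈ s, F a t) := by
  classical
  induction s using Finset.induction_on with
  | empty => exact TB.toTI ⟨T / 2, ⟨by linarith, by linarith⟩, 0, le_rfl, fun t _ => by simp⟩
  | insert a s ha ih =>
    simp only [Finset.sum_insert ha]
    exact (h a (by simp)).add (ih fun b hb => h b (by simp [hb]))

theorem TB.mulTI (hf : TB T f) (hf0 : ∀ t ∈ Ioo 0 T, 0 ≤ f t) (hg : TI T g) : TI T (fun t => f t * g t) := by
  obtain ⟨τ, hτ, B, hB, hb⟩ := hf
  obtain ⟨τ', hτ', B', hB', hb'⟩ := hg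
  refine ⟨_, max_mem hτ hτ', fun t => B * B' t, (hB'.mono_set sub_right).const_mul _, fun t ht =>
    ⟨mul_nonneg hB (hb' t (sub_right ht)).1, ?_⟩⟩
  exact (mul_le_mul_of_nonneg_left (hb' t (sub_right ht)).2 (hf0 t (mem_of_tail hτ (sub_left ht)))).trans
    (mul_le_mul_of_nonneg_right (hb t (sub_left ht)) (hb' t (sub_right ht)).1)

theorem LB.mono (hg : LB T g) (h : ∀ t ∈ Ioo 0 T, f t ≤ g t) : LB T f := by
  intro t0 t1 h0 h1 h2
  obtain ⟨B, hB, hb⟩ := hg t0 t1 h0 h1 h2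
  exact ⟨B, hB, fun t ht => (h t ⟨h0.trans_le ht.1, ht.2.trans_lt h2⟩).trans (hb t ht)⟩

theorem LB.zero : LB T (fun _ => 0) := fun _ _ _ _ _ => ⟨0, le_rfl, fun _ _ => le_rfl⟩

theorem LB.add (hf : LB T f) (hg : LB T g) : LB T (fun t => f t + g t) := by
  intro t0 t1 h0 h1 h2
  obtain ⟨B, hB, hb⟩ := hf t0 t1 h0 h1 h2
  obtain ⟨B', hB', hb'⟩ := hg t0 t1 h0 h1 h2
  exact ⟨B + B', by positivity, fun t ht => add_le_add (hb t ht) (hb' t ht)⟩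

theorem LB.const_mul {c : ℝ} (hc : 0 ≤ c) (hf : LB T f) : LB T (fun t => c * f t) := by
  intro t0 t1 h0 h1 h2
  obtain ⟨B, hB, hb⟩ := hf t0 t1 h0 h1 h2
  exact ⟨c * B, by positivity, fun t ht => mul_le_mul_of_nonneg_left (hb t ht) hc⟩

theorem LB.mul (hf : LB T f) (hg : LB T g) (hg0 : ∀ t, 0 ≤ g t) : LB T (fun t => f t * g t) := by
  intro t0 t1 h0 h1 h2
  obtain ⟨B, hB, hb⟩ := hf t0 t1 h0 h1 h2
  obtain ⟨B', hB', hb'⟩ := hg t0 t1 h0 h1 h2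
  exact ⟨B * B', by positivity, fun t ht => mul_le_mul (hb t ht) (hb' t ht) (hg0 t) hB⟩

theorem LB.sum {ι : Type*} {s : Finset ι} {F : ι → ℝ → ℝ} (h : ∀ a ∈ s, LB T (F a)) :
    LB T (fun t => ∑ a ∈ s, F a t) := by
  classical
  induction s using Finset.induction_on with
  | empty => simpa using LB.zero
  | insert a s ha ih =>
    simp only [Finset.sum_insert ha]
    exact (h a (by simp)).add (ih fun b hb => h b (by simp [hb]))

/-- right-hand sides that the closing argument can handle -/
def Good (T : ℝ) (X Y f : ℝ → ℝ) : Prop :=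
  ∀ ε > 0, ∃ g, TI T g ∧ ∀ t ∈ Ioo 0 T, f t ≤ ε * Y t + g t * (1 + X t)

theorem Good.mono (hg : Good T X Y g) (h : ∀ t ∈ Ioo 0 T, f t ≤ g t) : Good T X Y f := by
  intro ε hε
  obtain ⟨k, hk, hb⟩ := hg ε hε
  exact ⟨k, hk, fun t ht => (h t ht).trans (hb t ht)⟩

theorem Good.add (hf : Good T X Y f) (hg : Good T X Y g) : Good T X Y (fun t => f t + g t) := by
  intro ε hε
  obtain ⟨k, hk, hb⟩ := hf (ε / 2) (by positivity)
  obtain ⟨k', hk', hb'⟩ := hg (ε / 2) (by positivity)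
  refine ⟨_, hk.add hk', fun t ht => ?_⟩
  have := hb t ht; have := hb' t ht
  linarith

theorem Good.const_mul {c : ℝ} (hc : 0 ≤ c) (hY : ∀ t ∈ Ioo 0 T, 0 ≤ Y t) (hf : Good T X Y f) : Good T X Y (fun t => c * f t) := by
  intro ε hε
  obtain ⟨k, hk, hb⟩ := hf (ε / (c + 1)) (by positivity)
  refine ⟨_, hk.const_mul hc, fun t ht => ?_⟩
  have h1 := mul_le_mul_of_nonneg_left (hb t ht) hc
  have h2 : c * (ε / (c + 1) * Y t) ≤ ε * Y t := by
    have : c * (ε / (c + 1)) ≤ ε := by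
      rw [mul_div_assoc', div_le_iff₀ (by positivity)]; nlinarith
    have := mul_le_mul_of_nonneg_right this (hY t ht)
    linarith
  nlinarith

theorem Good.of_TI (hf : TI T f) (hX : ∀ t ∈ Ioo 0 T, 0 ≤ X t) (hY : ∀ t ∈ Ioo 0 T, 0 ≤ Y t) (hf0 : ∀ t ∈ Ioo 0 T, 0 ≤ f t) : Good T X Y f := by
  intro ε hε
  refine ⟨f, hf, fun t ht => ?_⟩
  have := mul_nonneg hε.le (hY t ht)
  have := mul_nonneg (hf0 t ht) (hX t ht)
  linarith

theorem Good.of_mul (hg : TI T g) (hY : ∀ t ∈ Ioo 0 T, 0 ≤ Y t) (hg0 : ∀ t ∈ Ioo 0 T, 0 ≤ g t) : Good T X Y (fun t => g t * X t) := by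
  intro ε hε
  refine ⟨g, hg, fun t ht => ?_⟩
  have := mul_nonneg hε.le (hY t ht)
  have := hg0 t ht
  linarith

theorem Good.sum {ι : Type*} {s : Finset ι} {F : ι → ℝ → ℝ} (hT : 0 < T) (hX : ∀ t ∈ Ioo 0 T, 0 ≤ X t)
    (hY : ∀ t ∈ Ioo 0 T, 0 ≤ Y t)
    (h : ∀ a ∈ s, Good T X Y (F a)) : Good T X Y (fun t => ∑ a ∈ s, F a t) := by
  classical
  induction s using Finset.induction_on with
  | empty =>
    exact Good.of_TI (TB.toTI ⟨T / 2, ⟨by linarith, by linarith⟩, 0, le_rfl, fun t _ => by simp⟩) hX hY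
      (fun t _ => by simp)
  | insert a s ha ih =>
    simp only [Finset.sum_insert ha]
    exact (h a (by simp)).add (ih fun b hb => h b (by simp [hb]))

theorem tail_small {τ : ℝ} (hτT : τ < T) {G : ℝ → ℝ} (hG : IntegrableOn G (Ioo τ T)) {ε : ℝ} (hε : 0 < ε) :
    ∃ τ' ∈ Ioo τ T, ∫ t in Ioo τ' T, G t < ε := by
  let s : ℕ → Set ℝ := fun n => Ioo (T - (T - τ) / ((n:ℝ) + 1)) T
  have hd : 0 < T - τ := sub_pos.2 hτT
  have h0 : IntegrableOn G (s 0) := by simpa [s] using hG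
  have hanti : Antitone s := by
    intro a b hab
    refine Ioo_subset_Ioo_left ?_
    have : (T - τ) / ((b:ℝ) + 1) ≤ (T - τ) / ((a:ℝ) + 1) := by gcongr
    linarith
  have := tendsto_setIntegral_of_antitone (μ := volume) (f := G) (s := s) (fun _ => measurableSet_Ioo) hanti ⟨0, h0⟩
  have he : ⋂ n, s n = ∅ := by
    rw [eq_empty_iff_forall_notMem]
    intro t ht
    rw [mem_iInter] at ht
    have hlt : t < T := (ht 0).2
    obtain ⟨n, hn⟩ := exists_nat_gt ((T - τ) / (T - t))
    have h1 := (ht n).1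
    have h2 : (T - τ) / ((n:ℝ) + 1) < T - t := by
      rw [div_lt_iff₀ (sub_pos.2 hlt)] at hn
      rw [div_lt_iff₀ (by positivity)]
      have := sub_pos.2 hlt
      nlinarith
    linarith
  rw [he, setIntegral_empty] at this
  obtain ⟨n, hn1, hn2⟩ := ((this.eventually_lt_const hε).and (eventually_ge_atTop 1)).exists
  refine ⟨_, ⟨?_, ?_⟩, hn1⟩
  · have : (T - τ) / ((n:ℝ) + 1) < T - τ := by
      rw [div_lt_iff₀ (by positivity)]
      have : (1:ℝ) ≤ n := by exact_mod_cast hn2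
      nlinarith
    linarith
  · have : 0 < (T - τ) / ((n:ℝ) + 1) := by positivity
    linarith

/-- the closing argument -/
theorem closing {Q : ℝ → ℝ} (hX0 : ∀ t, 0 ≤ X t) (hY0 : ∀ t, 0 ≤ Y t) (hQ0 : ∀ t, 0 ≤ Q t) (hX : LB T X)
    (hE : ∀ t0 t1, 0 < t0 → t0 < t1 → t1 < T → IntegrableOn Y (Ioo t0 t1) ∧
      X t1 + ∫ t in Ioo t0 t1, Y t ≤ X t0 + ∫ t in Ioo t0 t1, Q t)
    (hQ : Good T X Y Q) : TB T X ∧ TI T Y := by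
  obtain ⟨g, ⟨τ, hτ, G, hG, hgG⟩, hg⟩ := hQ (1/2) (by norm_num)
  obtain ⟨a, ha, hsm⟩ := tail_small hτ.2 hG (ε := 1/4) (by norm_num)
  have ha0 : 0 < a := hτ.1.trans ha.1
  have key : ∀ t1, a < t1 → t1 < T → ∀ S, 0 ≤ S → (∀ t ∈ Icc a t1, X t ≤ S) →
      X t1 + (1/2) * ∫ t in Ioo a t1, Y t ≤ X a + (1/4) * (1 + S) := by
    intro t1 h1 h2 S hS0 hS
    obtain ⟨hYi, hle⟩ := hE a t1 ha0 h1 h2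
    have hsub : Ioo a t1 ⊆ Ioo τ T := Ioo_subset_Ioo ha.1.le h2.le
    have hsub2 : Ioo a t1 ⊆ Ioo a T := Ioo_subset_Ioo_right h2.le
    have hGi : IntegrableOn G (Ioo a t1) := hG.mono_set hsub
    have b1 : ∫ t in Ioo a t1, Q t ≤ ∫ t in Ioo a t1, ((1/2) * Y t + (1 + S) * G t) := by
      refine integral_mono_of_nonneg (Eventually.of_forall hQ0) ((hYi.const_mul _).add (hGi.const_mul _)) ?_
      filter_upwards [ae_restrict_mem measurableSet_Ioo] with t ht
      obtain ⟨c1, c2⟩ := hgG t (hsub ht)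
      have c3 := hg t (mem_of_tail hτ (hsub ht))
      have c4 := hS t ⟨ht.1.le, ht.2.le⟩
      have c5 := hX0 t
      have : g t * (1 + X t) ≤ G t * (1 + X t) := mul_le_mul_of_nonneg_right c2 (by linarith)
      have : G t * (1 + X t) ≤ G t * (1 + S) := mul_le_mul_of_nonneg_left (by linarith) c1
      linarith
    have b2 : ∫ t in Ioo a t1, ((1/2) * Y t + (1 + S) * G t) = (1/2) * (∫ t in Ioo a t1, Y t) +
        (1 + S) * ∫ t in Ioo a t1, G t := by
      rw [integral_add (hYi.const_mul _) (hGi.const_mul _), integral_const_mul, integral_const_mul]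
    have b3 : ∫ t in Ioo a t1, G t ≤ 1/4 := by
      refine le_trans (setIntegral_mono_set (hG.mono_set (Ioo_subset_Ioo_left ha.1.le)) ?_ hsub2.eventuallyLE) hsm.le
      filter_upwards [ae_restrict_mem measurableSet_Ioo] with t ht
      exact (hgG t ⟨ha.1.trans ht.1, ht.2⟩).1
    have b4 := mul_le_mul_of_nonneg_left b3 (by linarith : 0 ≤ 1 + S)
    linarith
  set R := (4 * X a + 1) / 3 with hR
  have hR0 : 0 ≤ R := by have := hX0 a; positivity
  have hXa : X a ≤ R := by have := hX0 a; rw [hR]; linarith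
  have bound : ∀ t1, a < t1 → t1 < T → X t1 ≤ R := by
    intro t1 h1 h2
    obtain ⟨B, hB, hb⟩ := hX a t1 ha0 h1 h2
    have hbdd : BddAbove (X '' Icc a t1) := ⟨B, by rintro _ ⟨t, ht, rfl⟩; exact hb t ht⟩
    have hle : ∀ t ∈ Icc a t1, X t ≤ sSup (X '' Icc a t1) := fun t ht => le_csSup hbdd ⟨t, ht, rfl⟩
    set S := sSup (X '' Icc a t1) with hSdef
    have hS0 : 0 ≤ S := (hX0 a).trans (hle a ⟨le_rfl, h1.le⟩)
    have hSle : S ≤ X a + (1/4) * (1 + S) := by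
      refine csSup_le ⟨_, a, ⟨le_rfl, h1.le⟩, rfl⟩ ?_
      rintro _ ⟨t, ht, rfl⟩
      rcases ht.1.eq_or_lt with rfl | hlt
      · linarith
      · have := key t hlt (ht.2.trans_lt h2) S hS0 fun s hs => hle s ⟨hs.1, hs.2.trans ht.2⟩
        have : 0 ≤ ∫ s in Ioo a t, Y s := integral_nonneg hY0
        linarith
    have := hle t1 ⟨h1.le, le_rfl⟩
    rw [hR]; linarith
  have haT : a ∈ Ioo 0 T := ⟨ha0, ha.2⟩
  refine ⟨⟨a, haT, R, hR0, fun t ht => bound t ht.1 ht.2⟩, a, haT, Y, ?_, fun t _ => ⟨hY0 t, le_rfl⟩⟩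
  let c : ℕ → ℝ := fun n => T - (T - a) / ((n:ℝ) + 2)
  have hd : 0 < T - a := sub_pos.2 ha.2
  have hc1 : ∀ n, a < c n := fun n => by
    have : (T - a) / ((n:ℝ) + 2) < T - a := by
      rw [div_lt_iff₀ (by positivity)]
      have : (0:ℝ) ≤ n := by positivity
      nlinarith
    simp only [c]; linarith
  have hc2 : ∀ n, c n < T := fun n => by
    have : 0 < (T - a) / ((n:ℝ) + 2) := by positivity
    simp only [c]; linarith
  have hc3 : Tendsto c atTop (𝓝 T) := by
    have h1 : Tendsto (fun n : ℕ => (n:ℝ) + 2) atTop atTop :=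
      tendsto_atTop_add_const_right _ _ tendsto_natCast_atTop_atTop
    have := (h1.const_div_atTop (T - a)).const_sub T
    simpa using this
  have := integrableOn_Ioc_of_intervalIntegral_norm_bounded_right (f := Y) (a := a) (b := c) (b₀ := T) (l := atTop)
    (I := 2 * (X a + (1/4) * (1 + R)))
    (fun n => (integrableOn_Ioc_iff_integrableOn_Ioo (by simp)).2 (hE a (c n) ha0 (hc1 n) (hc2 n)).1) hc3
    (Eventually.of_forall fun n => ?_)
  · exact this.mono_set Ioo_subset_Ioc_self
  · rw [integral_Ioc_eq_integral_Ioo]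
    have e : ∀ t, ‖Y t‖ = Y t := fun t => Real.norm_of_nonneg (hY0 t)
    simp only [e]
    have := key (c n) (hc1 n) (hc2 n) R hR0 fun t ht => by
      rcases ht.1.eq_or_lt with rfl | hlt
      · exact hXa
      · exact bound t hlt (ht.2.trans_lt (hc2 n))
    have := hX0 (c n)
    linarith

end
end

end Part7

section Part8
open MeasureTheory Set Filter Topology
open scoped ENNReal ContDiff SchwartzMap

noncomputable section

/-! ### higher order energy inequalities -/

section
variable {T : ℝ} {ι κ : Type} [Fintype ι]

/-- spatial derivative of a family -/
def DF {ι : Type} (k : Fin 2) (v : ι → TF) : ι → TF := fun a => D k (v a)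

/-- the iterated right-hand side -/
def QQ (M : (ι → TF) → (κ → TF) → ι → Fin 2 → TF) (b : κ → TF) :
    ℕ → (ι → TF) → (ι → Fin 2 → TF) → ℝ → ℝ
  | 0, _, N, t => ∑ a, ∑ i, nn (N a i t)
  | s + 1, v, N, t => ∑ a, ∑ i, nn (N a i t) +
      ∑ k : Fin 2, QQ M b s (DF k v) (fun a i => D k (N a i) + M v (DF k b) a i) t

theorem QQ_nonneg (M : (ι → TF) → (κ → TF) → ι → Fin 2 → TF) (b : κ → TF) (s : ℕ) :
    ∀ v N t, 0 ≤ QQ M b s v N t := by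
  have h : ∀ (N : ι → Fin 2 → TF) t, 0 ≤ ∑ a, ∑ i, nn (N a i t) := fun N t =>
    Finset.sum_nonneg fun a _ => Finset.sum_nonneg fun i _ => nn_nonneg _
  induction s with
  | zero => intro v N t; exact h N t
  | succ s ih => intro v N t; exact add_nonneg (h N t) (Finset.sum_nonneg fun k _ => ih _ _ t)

structure Adm (T : ℝ) (M : (ι → TF) → (κ → TF) → ι → Fin 2 → TF) (b : κ → TF) : Prop where
  regb : ∀ c, Reg T (b c)
  reg : ∀ v b', (∀ a, Reg T (v a)) → (∀ c, Reg T (b' c)) → ∀ a i, Reg T (M v b' a i)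
  leib : ∀ v, (∀ a, Reg T (v a)) → ∀ k a i, D k (M v b a i) = M (DF k v) b a i + M v (DF k b) a i
  can : ∀ v t x, ∑ a, ∑ i, M v b a i t x * pd i (v a t) x = 0
  bd : ∀ t0 t1, 0 < t0 → t0 < t1 → t1 < T → ∃ K, 0 ≤ K ∧ ∀ v, ∀ t ∈ Icc t0 t1, ∀ x,
    ∑ a, ∑ i, M v b a i t x ^ 2 ≤ K * ∑ a, ∑ i, pd i (v a t) x ^ 2

variable {M : (ι → TF) → (κ → TF) → ι → Fin 2 → TF} {b : κ → TF}

theorem aesm_nnsum {N : ι → Fin 2 → TF} (hN : ∀ a i, Reg T (N a i)) :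
    AEStronglyMeasurable (fun t => ∑ a, ∑ i, nn (N a i t)) (volume.restrict (Ioo 0 T)) :=
  Finset.aestronglyMeasurable_fun_sum _ fun a _ => Finset.aestronglyMeasurable_fun_sum _ fun i _ => aesm_nn (hN a i)

theorem aesm_QQ (hM : Adm T M b) (s : ℕ) : ∀ {v : ι → TF} {N : ι → Fin 2 → TF}, (∀ a, Reg T (v a)) →
    (∀ a i, Reg T (N a i)) → AEStronglyMeasurable (QQ M b s v N) (volume.restrict (Ioo 0 T)) := by
  induction s with
  | zero => intro v N _ hN; exact aesm_nnsum hN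
  | succ s ih =>
    intro v N hv hN
    refine (aesm_nnsum hN).add (Finset.aestronglyMeasurable_fun_sum _ fun k _ => ih (fun a => (hv a).D k) fun a i => ?_)
    exact ((hN a i).D k).add (hM.reg _ _ hv (fun c => (hM.regb c).D k) a i)

theorem LB.integrableOn {g : ℝ → ℝ} (hg : LB T g) (hg0 : ∀ t, 0 ≤ g t)
    (hm : AEStronglyMeasurable g (volume.restrict (Ioo 0 T))) {t0 t1 : ℝ} (h0 : 0 < t0) (h01 : t0 < t1) (h1 : t1 < T) :
    IntegrableOn g (Ioo t0 t1) := by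
  obtain ⟨B, hB, hb⟩ := hg t0 t1 h0 h01 h1
  refine (integrableOn_const (C := B) (by simp)).mono' (hm.mono_set (Ioo_subset_Ioo h0.le h1.le)) ?_
  filter_upwards [ae_restrict_mem measurableSet_Ioo] with t ht
  rw [Real.norm_of_nonneg (hg0 t)]
  exact hb t ⟨ht.1.le, ht.2.le⟩

theorem eq_D (hM : Adm T M b) {v : ι → TF} {N : ι → Fin 2 → TF} (hv : ∀ a, Reg T (v a))
    (hN : ∀ a i, Reg T (N a i))
    (heq : ∀ t ∈ Ioo 0 T, ∀ x a, dt (v a) t x = lap (v a t) x + ∑ i, pd i (N a i t + M v b a i t) x) (k : Fin 2) :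
    ∀ t ∈ Ioo 0 T, ∀ x a, dt (DF k v a) t x = lap (DF k v a t) x +
      ∑ i, pd i ((D k (N a i) + M v (DF k b) a i) t + M (DF k v) b a i t) x := by
  intro t ht x a
  have hMr := hM.reg _ _ hv hM.regb a
  have e1 : dt (v a) t = lap (v a t) + (pd 0 (N a 0 t + M v b a 0 t) + pd 1 (N a 1 t + M v b a 1 t)) := by
    ext y; rw [heq t ht y a, Fin.sum_univ_two]; rfl
  have s1 := ((hv a).sch t).lap
  have s2 : ∀ i, Sch (N a i t + M v b a i t) := fun i => ((hN a i).sch t).add ((hMr i).sch t)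
  have e2 : ∀ i, pd k (pd i (N a i t + M v b a i t)) = pd i ((D k (N a i) + M v (DF k b) a i) t + M (DF k v) b a i t) := by
    intro i
    rw [pd_comm (s2 i) k i, pd_add ((hN a i).sch t) ((hMr i).sch t)]
    congr 1
    have := congrFun (hM.leib v hv k a i) t
    change pd k (M v b a i t) = _ at this
    rw [this]
    simp only [D, Pi.add_apply]
    abel
  simp only [DF] at *
  rw [dt_D (hv a) ht, e1, pd_add s1 (((s2 0).pd 0).add ((s2 1).pd 1)), pd_add ((s2 0).pd 0) ((s2 1).pd 1), e2, e2,
    Fin.sum_univ_two, pd_lap ((hv a).sch t)]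
  rfl

theorem rec_energy (hM : Adm T M b) (s : ℕ) : ∀ {v : ι → TF} {N : ι → Fin 2 → TF}, (∀ a, Reg T (v a)) →
    (∀ a i, Reg T (N a i)) →
    (∀ t ∈ Ioo 0 T, ∀ x a, dt (v a) t x = lap (v a t) x + ∑ i, pd i (N a i t + M v b a i t) x) →
    LB T (fun t => ∑ a, hs s (v a t)) → LB T (QQ M b s v N) →
    ∀ t0 t1, 0 < t0 → t0 < t1 → t1 < T →
    IntegrableOn (fun t => ∑ a, ∑ i, hs s (pd i (v a t))) (Ioo t0 t1) ∧
      ∑ a, hs s (v a t1) + ∫ t in Ioo t0 t1, ∑ a, ∑ i, hs s (pd i (v a t)) ≤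
        ∑ a, hs s (v a t0) + ∫ t in Ioo t0 t1, QQ M b s v N t := by
  have base : ∀ {v : ι → TF} {N : ι → Fin 2 → TF}, (∀ a, Reg T (v a)) → (∀ a i, Reg T (N a i)) →
      (∀ t ∈ Ioo 0 T, ∀ x a, dt (v a) t x = lap (v a t) x + ∑ i, pd i (N a i t + M v b a i t) x) →
      LB T (fun t => ∑ a, nn (v a t)) → LB T (fun t => ∑ a, ∑ i, nn (N a i t)) →
      ∀ t0 t1, 0 < t0 → t0 < t1 → t1 < T →
      IntegrableOn (fun t => ∑ a, ∑ i, nn (pd i (v a t))) (Ioo t0 t1) ∧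
      ∑ a, nn (v a t1) + ∫ t in Ioo t0 t1, ∑ a, ∑ i, nn (pd i (v a t)) ≤
        ∑ a, nn (v a t0) + ∫ t in Ioo t0 t1, ∑ a, ∑ i, nn (N a i t) := by
    intro v N hv hN heq hvB hNB t0 t1 h0 h01 h1
    obtain ⟨B, hB, hb⟩ := hvB t0 t1 h0 h01 h1
    obtain ⟨K, hK, hk⟩ := hM.bd t0 t1 h0 h01 h1
    refine energy (H := fun _ => 0) hv hN (hM.reg v b hv hM.regb) (fun _ => Reg.zero) (fun t ht x a => ?_)
      (fun t _ x => hM.can v t x) h0 h01 h1 hK (hk v) hb (fun t _ => by simp [nn_zero, hB]) (fun t _ => by simp) ?_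
    · rw [heq t ht x a]; simp
    · exact hNB.integrableOn (fun t => Finset.sum_nonneg fun a _ => Finset.sum_nonneg fun i _ => nn_nonneg _)
        (aesm_nnsum hN) h0 h01 h1
  induction s with
  | zero => intro v N hv hN heq h1 h2; exact base hv hN heq h1 h2
  | succ s ih =>
    intro v N hv hN heq hvB hQB t0 t1 h0 h01 h1
    have nnN : ∀ t, 0 ≤ ∑ a, ∑ i, nn (N a i t) := fun t =>
      Finset.sum_nonneg fun a _ => Finset.sum_nonneg fun i _ => nn_nonneg _
    set N' : Fin 2 → ι → Fin 2 → TF := fun k a i => D k (N a i) + M v (DF k b) a i with hN'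
    have hN'r : ∀ k a i, Reg T (N' k a i) := fun k a i => ((hN a i).D k).add (hM.reg _ _ hv (fun c => (hM.regb c).D k) a i)
    have LBN : LB T (fun t => ∑ a, ∑ i, nn (N a i t)) := hQB.mono fun t _ =>
      le_add_of_nonneg_right (Finset.sum_nonneg fun k _ => QQ_nonneg M b s _ _ t)
    have LBQ : ∀ k, LB T (QQ M b s (DF k v) (N' k)) := fun k => hQB.mono fun t _ => by
      refine le_add_of_nonneg_of_le (nnN t) ?_
      exact Finset.single_le_sum (f := fun k => QQ M b s (DF k v) (N' k) t) (fun k _ => QQ_nonneg M b s _ _ t) (Finset.mem_univ k)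
    have LBv : LB T (fun t => ∑ a, nn (v a t)) := hvB.mono fun t _ => Finset.sum_le_sum fun a _ => nn_le_hs _ _
    have LBDv : ∀ k, LB T (fun t => ∑ a, hs s (DF k v a t)) := fun k => hvB.mono fun t _ =>
      Finset.sum_le_sum fun a _ => hs_pd_le s (v a t) k
    obtain ⟨a1, a2⟩ := base hv hN heq LBv LBN t0 t1 h0 h01 h1
    have hD := fun k => ih (v := DF k v) (fun a => (hv a).D k) (hN'r k) (eq_D hM hv hN heq k) (LBDv k) (LBQ k) t0 t1 h0 h01 h1
    have iN := LBN.integrableOn nnN (aesm_nnsum hN) h0 h01 h1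
    have iQ := fun k => (LBQ k).integrableOn (QQ_nonneg M b s _ _)
      (aesm_QQ hM s (v := DF k v) (fun a => (hv a).D k) (hN'r k)) h0 h01 h1
    obtain ⟨c1, c2⟩ := hD 0
    obtain ⟨d1, d2⟩ := hD 1
    have eY : (fun t => ∑ a, ∑ i, hs (s + 1) (pd i (v a t))) = fun t => (∑ a, ∑ i, nn (pd i (v a t))) +
        ((∑ a, ∑ i, hs s (pd i (DF 0 v a t))) + ∑ a, ∑ i, hs s (pd i (DF 1 v a t))) := by
      ext t
      rw [← Finset.sum_add_distrib, ← Finset.sum_add_distrib]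
      refine Finset.sum_congr rfl fun a _ => ?_
      simp only [Fin.sum_univ_two, hs_succ, DF, D]
      rw [pd_comm ((hv a).sch t) 1 0]
      ring
    have eX : ∀ t, ∑ a, hs (s + 1) (v a t) = ∑ a, nn (v a t) + (∑ a, hs s (DF 0 v a t) + ∑ a, hs s (DF 1 v a t)) := by
      intro t
      rw [← Finset.sum_add_distrib, ← Finset.sum_add_distrib]; rfl
    have eQ : QQ M b (s + 1) v N = fun t => ∑ a, ∑ i, nn (N a i t) +
        (QQ M b s (DF 0 v) (N' 0) t + QQ M b s (DF 1 v) (N' 1) t) := by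
      ext t; simp only [QQ, Fin.sum_univ_two, hN']
    have cd : IntegrableOn (fun t => (∑ a, ∑ i, hs s (pd i (DF 0 v a t))) + ∑ a, ∑ i, hs s (pd i (DF 1 v a t))) (Ioo t0 t1) :=
      c1.add d1
    have iQ2 : IntegrableOn (fun t => QQ M b s (DF 0 v) (N' 0) t + QQ M b s (DF 1 v) (N' 1) t) (Ioo t0 t1) :=
      (iQ 0).add (iQ 1)
    have i1 : ∫ t in Ioo t0 t1, ((∑ a, ∑ i, nn (pd i (v a t))) +
        ((∑ a, ∑ i, hs s (pd i (DF 0 v a t))) + ∑ a, ∑ i, hs s (pd i (DF 1 v a t)))) = _ := integral_add a1 cd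
    have i2 : ∫ t in Ioo t0 t1, ((∑ a, ∑ i, hs s (pd i (DF 0 v a t))) + ∑ a, ∑ i, hs s (pd i (DF 1 v a t))) =
        (∫ t in Ioo t0 t1, ∑ a, ∑ i, hs s (pd i (DF 0 v a t))) + ∫ t in Ioo t0 t1, ∑ a, ∑ i, hs s (pd i (DF 1 v a t)) :=
      integral_add c1 d1
    have i3 : ∫ t in Ioo t0 t1, (∑ a, ∑ i, nn (N a i t) +
        (QQ M b s (DF 0 v) (N' 0) t + QQ M b s (DF 1 v) (N' 1) t)) = _ := integral_add iN iQ2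
    have i4 : ∫ t in Ioo t0 t1, (QQ M b s (DF 0 v) (N' 0) t + QQ M b s (DF 1 v) (N' 1) t) = _ :=
      integral_add (iQ 0) (iQ 1)
    change ∑ a, hs s (DF 0 v a t1) + (∫ t in Ioo t0 t1, ∑ a, ∑ i, hs s (pd i (DF 0 v a t))) ≤ ∑ a, hs s (DF 0 v a t0) + _ at c2
    change ∑ a, hs s (DF 1 v a t1) + (∫ t in Ioo t0 t1, ∑ a, ∑ i, hs s (pd i (DF 1 v a t))) ≤ ∑ a, hs s (DF 1 v a t0) + _ at d2
    rw [eY, eX, eX, eQ]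
    refine ⟨a1.add cd, ?_⟩
    beta_reduce
    rw [i1, i2, i3, i4]
    linarith

/-! linear case -/

theorem adm_zero : Adm T (fun (_ : ι → TF) (_ : Empty → TF) (_ : ι) (_ : Fin 2) => (0 : TF)) Empty.elim where
  regb := fun c => c.elim
  reg := fun _ _ _ _ _ _ => Reg.zero
  leib := fun _ _ _ _ _ => by rw [D_zero, add_zero]
  can := fun _ _ _ => by simp
  bd := fun _ _ _ _ _ => ⟨0, le_rfl, fun _ _ _ _ => by simp⟩

theorem QQ_zero (s : ℕ) : ∀ (v : ι → TF) (N : ι → Fin 2 → TF) (t : ℝ),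
    QQ (fun (_ : ι → TF) (_ : Empty → TF) (_ : ι) (_ : Fin 2) => (0 : TF)) Empty.elim s v N t = ∑ a, ∑ i, hs s (N a i t) := by
  induction s with
  | zero => intro v N t; rfl
  | succ s ih =>
    intro v N t
    simp only [QQ, ih, add_zero, Fin.sum_univ_two, hs_succ, Finset.sum_add_distrib, D]
    ring

/-- closing for linear (divergence-form) equations -/
theorem linear_close {v : ι → TF} {N : ι → Fin 2 → TF} (s : ℕ) (hv : ∀ a, Reg T (v a)) (hN : ∀ a i, Reg T (N a i))
    (heq : ∀ t ∈ Ioo 0 T, ∀ x a, dt (v a) t x = lap (v a t) x + ∑ i, pd i (N a i t) x)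
    (hvB : ∀ a, LB T (fun t => hs s (v a t))) (hNB : ∀ a i, LB T (fun t => hs s (N a i t)))
    (hG : Good T (fun t => ∑ a, hs s (v a t)) (fun t => ∑ a, ∑ i, hs s (pd i (v a t))) (fun t => ∑ a, ∑ i, hs s (N a i t))) :
    TB T (fun t => ∑ a, hs s (v a t)) ∧ TI T (fun t => ∑ a, ∑ i, hs s (pd i (v a t))) := by
  have hQ := funext (QQ_zero s v N)
  have h := rec_energy (T := T) adm_zero s hv hN (fun t ht x a => by simpa using heq t ht x a)
    (LB.sum fun a _ => hvB a) (by rw [hQ]; exact LB.sum fun a _ => LB.sum fun i _ => hNB a i)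
  simp only [QQ_zero] at h
  exact closing (fun t => Finset.sum_nonneg fun a _ => hs_nonneg _ _)
    (fun t => Finset.sum_nonneg fun a _ => Finset.sum_nonneg fun i _ => hs_nonneg _ _)
    (fun t => Finset.sum_nonneg fun a _ => Finset.sum_nonneg fun i _ => hs_nonneg _ _)
    (LB.sum fun a _ => hvB a) h hG

theorem adm_close (hM : Adm T M b) (s : ℕ) {v : ι → TF} {N : ι → Fin 2 → TF} (hv : ∀ a, Reg T (v a))
    (hN : ∀ a i, Reg T (N a i))
    (heq : ∀ t ∈ Ioo 0 T, ∀ x a, dt (v a) t x = lap (v a t) x + ∑ i, pd i (N a i t + M v b a i t) x)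
    (hvB : ∀ a, LB T (fun t => hs s (v a t))) (hQB : LB T (QQ M b s v N))
    (hG : Good T (fun t => ∑ a, hs s (v a t)) (fun t => ∑ a, ∑ i, hs s (pd i (v a t))) (QQ M b s v N)) :
    TB T (fun t => ∑ a, hs s (v a t)) ∧ TI T (fun t => ∑ a, ∑ i, hs s (pd i (v a t))) :=
  closing (fun t => Finset.sum_nonneg fun a _ => hs_nonneg _ _)
    (fun t => Finset.sum_nonneg fun a _ => Finset.sum_nonneg fun i _ => hs_nonneg _ _)
    (QQ_nonneg M b s v N) (LB.sum fun a _ => hvB a)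
    (rec_energy hM s hv hN heq (LB.sum fun a _ => hvB a) hQB) hG

end
end

end Part8

section Part9
open MeasureTheory Set Filter Topology
open scoped ENNReal ContDiff SchwartzMap

noncomputable section

/-! ### the Hall operator -/

def J0 (v : Fin 3 → TF) : TF := D 1 (v 2)
def J1 (v : Fin 3 → TF) : TF := -D 0 (v 2)
def J2 (v : Fin 3 → TF) : TF := D 0 (v 1) - D 1 (v 0)
def Ef0 (v b : Fin 3 → TF) : TF := J1 v * b 2 - J2 v * b 1
def Ef1 (v b : Fin 3 → TF) : TF := J2 v * b 0 - J0 v * b 2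
def Ef2 (v b : Fin 3 → TF) : TF := J0 v * b 1 - J1 v * b 0

def HM (v b : Fin 3 → TF) : Fin 3 → Fin 2 → TF :=
  ![![0, -Ef2 v b], ![Ef2 v b, 0], ![-Ef1 v b, Ef0 v b]]

section
variable {T : ℝ} {v b : Fin 3 → TF}

theorem Reg.J0 (hv : ∀ a, Reg T (v a)) : Reg T (J0 v) := (hv 2).D 1
theorem Reg.J1 (hv : ∀ a, Reg T (v a)) : Reg T (J1 v) := ((hv 2).D 0).neg
theorem Reg.J2 (hv : ∀ a, Reg T (v a)) : Reg T (J2 v) := ((hv 1).D 0).sub ((hv 0).D 1)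
theorem Reg.Ef0 (hv : ∀ a, Reg T (v a)) (hb : ∀ a, Reg T (b a)) : Reg T (Ef0 v b) :=
  ((Reg.J1 hv).mul (hb 2)).sub ((Reg.J2 hv).mul (hb 1))
theorem Reg.Ef1 (hv : ∀ a, Reg T (v a)) (hb : ∀ a, Reg T (b a)) : Reg T (Ef1 v b) :=
  ((Reg.J2 hv).mul (hb 0)).sub ((Reg.J0 hv).mul (hb 2))
theorem Reg.Ef2 (hv : ∀ a, Reg T (v a)) (hb : ∀ a, Reg T (b a)) : Reg T (Ef2 v b) :=
  ((Reg.J0 hv).mul (hb 1)).sub ((Reg.J1 hv).mul (hb 0))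

theorem HM_cases {P : TF → Prop} {v b : Fin 3 → TF} (h0 : P 0) (hn : ∀ f, P f → P (-f)) (e0 : P (Ef0 v b)) (e1 : P (Ef1 v b))
    (e2 : P (Ef2 v b)) (a : Fin 3) (i : Fin 2) : P (HM v b a i) := by
  fin_cases a <;> fin_cases i
  · exact h0
  · exact hn _ e2
  · exact e2
  · exact h0
  · exact hn _ e1
  · exact e0

theorem Reg.HM (hv : ∀ a, Reg T (v a)) (hb : ∀ a, Reg T (b a)) (a : Fin 3) (i : Fin 2) : Reg T (HM v b a i) :=
  HM_cases Reg.zero (fun _ h => h.neg) (Reg.Ef0 hv hb) (Reg.Ef1 hv hb) (Reg.Ef2 hv hb) a i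

theorem D_J0 (hv : ∀ a, Reg T (v a)) (k : Fin 2) : D k (J0 v) = J0 (DF k v) := D_comm (hv 2) _ _
theorem D_J1 (hv : ∀ a, Reg T (v a)) (k : Fin 2) : D k (J1 v) = J1 (DF k v) := by
  rw [J1, D_neg, D_comm (hv 2)]; rfl
theorem D_J2 (hv : ∀ a, Reg T (v a)) (k : Fin 2) : D k (J2 v) = J2 (DF k v) := by
  rw [J2, D_sub ((hv 1).D 0) ((hv 0).D 1), D_comm (hv 1), D_comm (hv 0)]; rfl

theorem D_Ef0 (hv : ∀ a, Reg T (v a)) (hb : ∀ a, Reg T (b a)) (k : Fin 2) :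
    D k (Ef0 v b) = Ef0 (DF k v) b + Ef0 v (DF k b) := by
  have h1 := Reg.J1 hv; have h2 := Reg.J2 hv
  simp only [Ef0]
  rw [D_sub (h1.mul (hb 2)) (h2.mul (hb 1)), D_mul h1 (hb 2), D_mul h2 (hb 1), D_J1 hv, D_J2 hv]
  simp only [DF]; ring
theorem D_Ef1 (hv : ∀ a, Reg T (v a)) (hb : ∀ a, Reg T (b a)) (k : Fin 2) :
    D k (Ef1 v b) = Ef1 (DF k v) b + Ef1 v (DF k b) := by
  have h1 := Reg.J0 hv; have h2 := Reg.J2 hv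
  simp only [Ef1]
  rw [D_sub (h2.mul (hb 0)) (h1.mul (hb 2)), D_mul h2 (hb 0), D_mul h1 (hb 2), D_J0 hv, D_J2 hv]
  simp only [DF]; ring
theorem D_Ef2 (hv : ∀ a, Reg T (v a)) (hb : ∀ a, Reg T (b a)) (k : Fin 2) :
    D k (Ef2 v b) = Ef2 (DF k v) b + Ef2 v (DF k b) := by
  have h1 := Reg.J0 hv; have h2 := Reg.J1 hv
  simp only [Ef2]
  rw [D_sub (h1.mul (hb 1)) (h2.mul (hb 0)), D_mul h1 (hb 1), D_mul h2 (hb 0), D_J0 hv, D_J1 hv]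
  simp only [DF]; ring

theorem HM_leib (hv : ∀ a, Reg T (v a)) (hb : ∀ a, Reg T (b a)) (k : Fin 2) (a : Fin 3) (i : Fin 2) :
    D k (HM v b a i) = HM (DF k v) b a i + HM v (DF k b) a i := by
  have z : D k (0 : TF) = 0 + 0 := by rw [D_zero, add_zero]
  have n : ∀ f g h : TF, D k f = g + h → D k (-f) = -g + -h := by
    intro f g h e; rw [D_neg, e, neg_add]
  fin_cases a <;> fin_cases i
  · exact z
  · exact n _ _ _ (D_Ef2 hv hb k)
  · exact D_Ef2 hv hb k
  · exact z
  · exact n _ _ _ (D_Ef1 hv hb k)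
  · exact D_Ef0 hv hb k

theorem HM_sum (v b : Fin 3 → TF) (F : TF → Fin 3 → Fin 2 → ℝ) : ∑ a, ∑ i, F (HM v b a i) a i =
    F 0 0 0 + F (-Ef2 v b) 0 1 + (F (Ef2 v b) 1 0 + F 0 1 1) + (F (-Ef1 v b) 2 0 + F (Ef0 v b) 2 1) := by
  simp only [Fin.sum_univ_three, Fin.sum_univ_two]; rfl

theorem HM_can (v b : Fin 3 → TF) (t : ℝ) (x : E2) : ∑ a, ∑ i, HM v b a i t x * pd i (v a t) x = 0 := by
  rw [HM_sum v b (fun f a i => f t x * pd i (v a t) x)]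
  simp only [Ef0, Ef1, Ef2, J0, J1, J2, Pi.sub_apply, Pi.mul_apply, Pi.neg_apply, Pi.zero_apply, D]
  ring

theorem HM_bd (v b : Fin 3 → TF) (t : ℝ) (x : E2) {S : ℝ} (hS : ∀ c, b c t x ^ 2 ≤ S) :
    ∑ a, ∑ i, HM v b a i t x ^ 2 ≤ 32 * S * ∑ a, ∑ i, pd i (v a t) x ^ 2 := by
  rw [HM_sum v b (fun f a i => f t x ^ 2)]
  set G := ∑ a, ∑ i, pd i (v a t) x ^ 2 with hG
  have eG : G = pd 0 (v 0 t) x ^ 2 + pd 1 (v 0 t) x ^ 2 + (pd 0 (v 1 t) x ^ 2 + pd 1 (v 1 t) x ^ 2) +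
    (pd 0 (v 2 t) x ^ 2 + pd 1 (v 2 t) x ^ 2) := by
    simp only [hG, Fin.sum_univ_three, Fin.sum_univ_two]
  have hS0 : 0 ≤ S := (sq_nonneg _).trans (hS 0)
  have j0 : J0 v t x ^ 2 ≤ 2 * G := by
    simp only [J0, D]; rw [eG]; nlinarith [sq_nonneg (pd 0 (v 0 t) x), sq_nonneg (pd 1 (v 0 t) x), sq_nonneg (pd 0 (v 1 t) x), sq_nonneg (pd 1 (v 1 t) x), sq_nonneg (pd 0 (v 2 t) x), sq_nonneg (pd 1 (v 2 t) x)]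
  have j1 : J1 v t x ^ 2 ≤ 2 * G := by
    simp only [J1, D, Pi.neg_apply]; rw [eG]; nlinarith [sq_nonneg (pd 0 (v 0 t) x), sq_nonneg (pd 1 (v 0 t) x), sq_nonneg (pd 0 (v 1 t) x), sq_nonneg (pd 1 (v 1 t) x), sq_nonneg (pd 0 (v 2 t) x), sq_nonneg (pd 1 (v 2 t) x)]
  have j2 : J2 v t x ^ 2 ≤ 2 * G := by
    simp only [J2, D, Pi.sub_apply]; rw [eG]; nlinarith [sq_nonneg (pd 0 (v 0 t) x), sq_nonneg (pd 1 (v 0 t) x), sq_nonneg (pd 0 (v 1 t) x), sq_nonneg (pd 1 (v 1 t) x), sq_nonneg (pd 0 (v 2 t) x), sq_nonneg (pd 1 (v 2 t) x), sq_nonneg (pd 0 (v 1 t) x + pd 1 (v 0 t) x)]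
  have key : ∀ p q c d : ℝ, p ^ 2 ≤ 2 * G → q ^ 2 ≤ 2 * G → c ^ 2 ≤ S → d ^ 2 ≤ S → (p * c - q * d) ^ 2 ≤ 8 * S * G := by
    intro p q c d hp hq hc hd
    have h1 : p ^ 2 * c ^ 2 ≤ 2 * G * S := mul_le_mul hp hc (sq_nonneg _) ((sq_nonneg _).trans hp)
    have h2 : q ^ 2 * d ^ 2 ≤ 2 * G * S := mul_le_mul hq hd (sq_nonneg _) ((sq_nonneg _).trans hq)
    nlinarith [sq_nonneg (p * c + q * d)]
  have k0 : Ef0 v b t x ^ 2 ≤ 8 * S * G := key _ _ _ _ j1 j2 (hS 2) (hS 1)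
  have k1 : Ef1 v b t x ^ 2 ≤ 8 * S * G := key _ _ _ _ j2 j0 (hS 0) (hS 2)
  have k2 : Ef2 v b t x ^ 2 ≤ 8 * S * G := key _ _ _ _ j0 j1 (hS 1) (hS 0)
  simp only [Pi.neg_apply, Pi.zero_apply]
  linarith

theorem adm_HM (hb : ∀ c, Reg T (b c)) (hB : ∀ c, LB T (fun t => hs 2 (b c t))) : Adm T HM b where
  regb := hb
  reg := fun _ _ hv hb' a i => Reg.HM hv hb' a i
  leib := fun _ hv k a i => HM_leib hv hb k a i
  can := fun v t x => HM_can v b t x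
  bd := by
    intro t0 t1 h0 h01 h1
    obtain ⟨B, hB0, hb'⟩ := LB.sum (s := Finset.univ) (fun c _ => hB c) t0 t1 h0 h01 h1
    refine ⟨32 * (4 * B), by positivity, fun v t ht x => HM_bd v b t x fun c => ?_⟩
    refine (sup_le_aux ((hb c).sch t) x).trans ?_
    have := (Finset.single_le_sum (f := fun c => hs 2 (b c t)) (fun c _ => hs_nonneg _ _) (Finset.mem_univ c)).trans (hb' t ht)
    linarith

end
end

end Part9

section Part10
open MeasureTheory Set Filter Topology
open scoped ENNReal ContDiff SchwartzMap

noncomputable section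

/-! ### bounds for the Hall operator -/

section
variable {T : ℝ} {v b : Fin 3 → TF}

theorem Reg.DF {ι : Type} {v : ι → TF} (hv : ∀ a, Reg T (v a)) (k : Fin 2) : ∀ a, Reg T (DF k v a) := fun a => (hv a).D k

theorem HM_gen (s : ℕ) (hv : ∀ a, Reg T (v a)) (hb : ∀ a, Reg T (b a)) (t : ℝ) {W : ℝ}
    (h : ∀ i a c, (c = 2 → a = 2) → hs s (D i (v a) t * b c t) ≤ W) :
    ∑ a, ∑ i, hs s (HM v b a i t) ≤ 40 * W := by
  have sc : ∀ i a c, Sch (D i (v a) t * b c t) := fun i a c => (((hv a).D i).sch t).mul ((hb c).sch t)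
  have p3 : ∀ {f g k : E2 → ℝ}, Sch f → Sch g → Sch k → hs s f ≤ W → hs s g ≤ W → hs s k ≤ W →
      hs s (f - (g - k)) ≤ 10 * W := by
    intro f g k hf hg hk a b c
    have h1 := hs_sub_le s hf (hg.sub hk)
    have h2 := hs_sub_le s hg hk
    linarith
  have n : ∀ f : TF, hs s ((-f) t) = hs s (f t) := fun f => hs_neg s _
  have z : hs s ((0 : TF) t) = 0 := hs_zero_fun s
  have W0 : 0 ≤ W := (hs_nonneg s _).trans (h 0 2 0 (by decide))
  have e0 : hs s (Ef0 v b t) ≤ 10 * W := by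
    have : Ef0 v b t = -(D 0 (v 2) t * b 2 t) - (D 0 (v 1) t * b 1 t - D 1 (v 0) t * b 1 t) := by
      simp only [Ef0, J1, J2, Pi.sub_apply, Pi.mul_apply, Pi.neg_apply]; ring
    rw [this]
    exact p3 (sc 0 2 2).neg (sc 0 1 1) (sc 1 0 1) (by rw [hs_neg]; exact h _ _ _ (by decide)) (h _ _ _ (by decide)) (h _ _ _ (by decide))
  have e1 : hs s (Ef1 v b t) ≤ 10 * W := by
    have : Ef1 v b t = -(D 1 (v 2) t * b 2 t) - (D 1 (v 0) t * b 0 t - D 0 (v 1) t * b 0 t) := by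
      simp only [Ef1, J0, J2, Pi.sub_apply, Pi.mul_apply]; ring
    rw [this]
    exact p3 (sc 1 2 2).neg (sc 1 0 0) (sc 0 1 0) (by rw [hs_neg]; exact h _ _ _ (by decide)) (h _ _ _ (by decide)) (h _ _ _ (by decide))
  have e2 : hs s (Ef2 v b t) ≤ 10 * W := by
    have : Ef2 v b t = D 1 (v 2) t * b 1 t - (-(D 0 (v 2) t * b 0 t) - 0) := by
      simp only [Ef2, J0, J1, Pi.sub_apply, Pi.mul_apply, Pi.neg_apply]; ring
    rw [this]
    exact p3 (sc 1 2 1) (sc 0 2 0).neg Sch.zero (h _ _ _ (by decide)) (by rw [hs_neg]; exact h _ _ _ (by decide))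
      (by rw [hs_zero_fun]; exact W0)
  rw [HM_sum v b (fun f _ _ => hs s (f t)), n, n, z]
  linarith

theorem single_le {ι : Type} [Fintype ι] {f : ι → ℝ} (hf : ∀ a, 0 ≤ f a) (a : ι) : f a ≤ ∑ a, f a :=
  Finset.single_le_sum (fun c _ => hf c) (Finset.mem_univ a)

theorem HM_pr {s i j : ℕ} (h : Pr s i j) : ∃ C : ℝ, 0 ≤ C ∧ ∀ (T : ℝ) (v b : Fin 3 → TF), (∀ a, Reg T (v a)) →
    (∀ a, Reg T (b a)) → ∀ t, ∑ a, ∑ k, hs s (HM v b a k t) ≤ C * ((∑ a, hs (i + 1) (v a t)) * ∑ c, hs j (b c t)) := by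
  obtain ⟨C, hC, h⟩ := h
  refine ⟨40 * C, by positivity, fun T v b hv hb t => ?_⟩
  have := HM_gen s hv hb t (W := C * ((∑ a, hs (i + 1) (v a t)) * ∑ c, hs j (b c t))) (fun k a c _ => ?_)
  · linarith
  · refine (h _ _ (((hv a).D k).sch t) ((hb c).sch t)).trans (mul_le_mul_of_nonneg_left ?_ hC)
    refine mul_le_mul ((hs_pd_le i _ k).trans (single_le (f := fun a => hs (i + 1) (v a t)) (fun a => hs_nonneg _ _) a))
      (single_le (f := fun a => hs j (b a t)) (fun a => hs_nonneg _ _) c) (hs_nonneg _ _) (Finset.sum_nonneg fun _ _ => hs_nonneg _ _)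

theorem Pr_max (s : ℕ) : Pr s s (max 2 s) := by
  rcases s with _ | _ | s
  · exact Pr020.symm
  · exact Pr112
  · rw [max_eq_right (by lia)]; exact Prsss (by lia)

/-- one step of the recursion -/
theorem QQ_succ_le (s : ℕ) (v : Fin 3 → TF) (N : Fin 3 → Fin 2 → TF) (t : ℝ) : QQ HM b (s + 1) v N t =
  ∑ a, ∑ i, nn (N a i t) + (QQ HM b s (DF 0 v) (fun a i => D 0 (N a i) + HM v (DF 0 b) a i) t +
    QQ HM b s (DF 1 v) (fun a i => D 1 (N a i) + HM v (DF 1 b) a i) t) := by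
  simp only [QQ, Fin.sum_univ_two]

theorem sum_hs_add_le (s : ℕ) {N M : Fin 3 → Fin 2 → TF} (hN : ∀ a i, Reg T (N a i)) (hM : ∀ a i, Reg T (M a i)) (t : ℝ) :
    ∑ a, ∑ i, hs s ((N a i + M a i) t) ≤ 2 * ∑ a, ∑ i, hs s (N a i t) + 2 * ∑ a, ∑ i, hs s (M a i t) := by
  simp only [Finset.mul_sum, ← Finset.sum_add_distrib]
  exact Finset.sum_le_sum fun a _ => Finset.sum_le_sum fun i _ => hs_add_le s ((hN a i).sch t) ((hM a i).sch t)

theorem sum_nn_D (s : ℕ) (N : Fin 3 → Fin 2 → TF) (t : ℝ) : ∑ a, ∑ i, hs (s + 1) (N a i t) = ∑ a, ∑ i, nn (N a i t) +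
    (∑ a, ∑ i, hs s (D 0 (N a i) t) + ∑ a, ∑ i, hs s (D 1 (N a i) t)) := by
  simp only [hs_succ, Finset.sum_add_distrib, D]

theorem sum_DF_le (s : ℕ) (v : Fin 3 → TF) (k : Fin 2) (t : ℝ) : ∑ a, hs s (DF k v a t) ≤ ∑ a, hs (s + 1) (v a t) :=
  Finset.sum_le_sum fun a _ => hs_pd_le s _ k

theorem sum_hs_nonneg {ι : Type} [Fintype ι] (s : ℕ) (v : ι → TF) (t : ℝ) : 0 ≤ ∑ a, hs s (v a t) :=
  Finset.sum_nonneg fun _ _ => hs_nonneg _ _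
theorem sum_hs_nonneg2 {ι : Type} [Fintype ι] (s : ℕ) (v : ι → Fin 2 → TF) (t : ℝ) : 0 ≤ ∑ a, ∑ i, hs s (v a i t) :=
  Finset.sum_nonneg fun _ _ => Finset.sum_nonneg fun _ _ => hs_nonneg _ _
theorem sum_nn_nonneg2 {ι : Type} [Fintype ι] (v : ι → Fin 2 → TF) (t : ℝ) : 0 ≤ ∑ a, ∑ i, nn (v a i t) :=
  Finset.sum_nonneg fun _ _ => Finset.sum_nonneg fun _ _ => nn_nonneg _
theorem sum_hs_mono {ι : Type} [Fintype ι] {s s' : ℕ} (h : s ≤ s') (v : ι → TF) (t : ℝ) : ∑ a, hs s (v a t) ≤ ∑ a, hs s' (v a t) :=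
  Finset.sum_le_sum fun _ _ => hs_mono h _

theorem hQ_bound (hb : ∀ c, Reg T (b c)) (s : ℕ) : ∃ C : ℝ, 0 ≤ C ∧ ∀ (v : Fin 3 → TF) (N : Fin 3 → Fin 2 → TF),
    (∀ a, Reg T (v a)) → (∀ a i, Reg T (N a i)) → ∀ t, QQ HM b s v N t ≤
      C * (∑ a, ∑ i, hs s (N a i t) + (∑ a, hs s (v a t)) * ∑ c, hs (max 3 s) (b c t)) := by
  induction s with
  | zero =>
    refine ⟨1, by norm_num, fun v N hv hN t => ?_⟩
    have := mul_nonneg (sum_hs_nonneg 0 v t) (sum_hs_nonneg (max 3 0) b t)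
    change ∑ a, ∑ i, nn (N a i t) ≤ 1 * (∑ a, ∑ i, nn (N a i t) + _)
    linarith
  | succ s ih =>
    obtain ⟨C, hC, h⟩ := ih
    obtain ⟨C', hC', h'⟩ := HM_pr (Pr_max s)
    refine ⟨1 + 2 * C + 4 * C * C' + 2 * C, by positivity, fun v N hv hN t => ?_⟩
    rw [QQ_succ_le]
    set P := (∑ a, hs (s + 1) (v a t)) * ∑ c, hs (max 3 (s + 1)) (b c t) with hP
    have P0 : 0 ≤ P := mul_nonneg (sum_hs_nonneg _ v t) (sum_hs_nonneg _ b t)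
    have key : ∀ k, QQ HM b s (DF k v) (fun a i => D k (N a i) + HM v (DF k b) a i) t ≤
        C * (2 * ∑ a, ∑ i, hs s (D k (N a i) t) + 2 * (C' * P) + P) := by
      intro k
      have r1 : ∀ a i, Reg T (D k (N a i)) := fun a i => (hN a i).D k
      have r2 : ∀ a i, Reg T (HM v (DF k b) a i) := Reg.HM hv (Reg.DF hb k)
      refine (h _ _ (Reg.DF hv k) (fun a i => (r1 a i).add (r2 a i)) t).trans (mul_le_mul_of_nonneg_left ?_ hC)
      have a1 := sum_hs_add_le s r1 r2 t
      have a2 := h' T v (DF k b) hv (Reg.DF hb k) t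
      have a3 : (∑ a, hs (s + 1) (v a t)) * ∑ c, hs (max 2 s) (DF k b c t) ≤ P :=
        mul_le_mul_of_nonneg_left ((sum_DF_le _ b k t).trans (sum_hs_mono (by lia) b t)) (sum_hs_nonneg _ v t)
      have a4 : (∑ a, hs s (DF k v a t)) * ∑ c, hs (max 3 s) (b c t) ≤ P :=
        mul_le_mul (sum_DF_le _ v k t) (sum_hs_mono (by lia) b t) (sum_hs_nonneg _ b t) (sum_hs_nonneg _ v t)
      have a5 := mul_le_mul_of_nonneg_left a3 hC'
      beta_reduce
      linarith
    have k0 := key 0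
    have k1 := key 1
    have eN := sum_nn_D s N t
    have n0 := sum_nn_nonneg2 N t
    have n1 := sum_hs_nonneg2 s (fun a i => D 0 (N a i)) t
    have n2 := sum_hs_nonneg2 s (fun a i => D 1 (N a i)) t
    rw [eN]
    set x := ∑ a, ∑ i, nn (N a i t)
    set y := ∑ a, ∑ i, hs s (D 0 (N a i) t)
    set z := ∑ a, ∑ i, hs s (D 1 (N a i) t)
    have : 0 ≤ C * C' * P := by positivity
    have : 0 ≤ C * P := by positivity
    have : 0 ≤ C * x := by positivity
    have : 0 ≤ C * y := by positivity
    have : 0 ≤ C * z := by positivity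
    have : 0 ≤ C * C' * x := by positivity
    have : 0 ≤ C * C' * y := by positivity
    have : 0 ≤ C * C' * z := by positivity
    nlinarith

theorem QQ1_le (hv : ∀ a, Reg T (v a)) (hb : ∀ c, Reg T (b c)) {N : Fin 3 → Fin 2 → TF} (hN : ∀ a i, Reg T (N a i)) (t : ℝ) {W : ℝ}
    (hW : ∀ k, ∑ a, ∑ i, nn (HM v (DF k b) a i t) ≤ W) :
    QQ HM b 1 v N t ≤ 2 * ∑ a, ∑ i, hs 1 (N a i t) + 4 * W := by
  rw [QQ_succ_le, sum_nn_D 0]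
  have h := fun k => sum_hs_add_le 0 (fun a i => (hN a i).D k) (Reg.HM hv (Reg.DF hb k)) t
  have h0 := h 0
  have h1 := h 1
  have n0 := sum_nn_nonneg2 N t
  have w0 := hW 0
  have w1 := hW 1
  simp only [QQ, hs_zero_eq] at *
  linarith

theorem QQ2_le (hv : ∀ a, Reg T (v a)) (hb : ∀ c, Reg T (b c)) {N : Fin 3 → Fin 2 → TF} (hN : ∀ a i, Reg T (N a i)) (t : ℝ) {W : ℝ}
    (hW1 : ∀ k, ∑ a, ∑ i, nn (HM v (DF k b) a i t) ≤ W)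
    (hW2 : ∀ k l, ∑ a, ∑ i, nn (HM (DF k v) (DF l b) a i t) ≤ W)
    (hW3 : ∀ k l, ∑ a, ∑ i, nn (HM v (DF k (DF l b)) a i t) ≤ W) :
    QQ HM b 2 v N t ≤ 4 * ∑ a, ∑ i, hs 2 (N a i t) + 100 * W := by
  have key : ∀ k, QQ HM b 1 (DF k v) (fun a i => D k (N a i) + HM v (DF k b) a i) t ≤
      4 * ∑ a, ∑ i, hs 1 (D k (N a i) t) + 50 * W := by
    intro k
    have r2 := Reg.HM hv (Reg.DF hb k)
    have h1 := QQ1_le (v := DF k v) (Reg.DF hv k) hb (N := fun a i => D k (N a i) + HM v (DF k b) a i)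
      (fun a i => ((hN a i).D k).add (r2 a i)) t (hW2 k)
    have h2 := sum_hs_add_le 1 (fun a i => (hN a i).D k) r2 t
    have h3 := sum_nn_D 0 (HM v (DF k b)) t
    have h4 : ∀ l, ∑ a, ∑ i, nn (D l (HM v (DF k b) a i) t) ≤ 4 * W := by
      intro l
      have e : ∀ a i, D l (HM v (DF k b) a i) = HM (DF l v) (DF k b) a i + HM v (DF l (DF k b)) a i := fun a i =>
        HM_leib hv (Reg.DF hb k) l a i
      simp only [e]
      have := sum_hs_add_le 0 (Reg.HM (Reg.DF hv l) (Reg.DF hb k)) (Reg.HM hv (Reg.DF (Reg.DF hb k) l)) t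
      have a1 := hW2 l k
      have a2 := hW3 l k
      simp only [hs_zero_eq] at *
      have e2 : ∀ a i, nn (HM v (fun c => D l (DF k b c)) a i t) = nn (HM v (DF l (DF k b)) a i t) := fun _ _ => rfl
      have e3 : ∀ a i, nn (HM (fun c => D l (v c)) (DF k b) a i t) = nn (HM (DF l v) (DF k b) a i t) := fun _ _ => rfl
      change _ ≤ 2 * ∑ a, ∑ i, nn (HM (DF l v) (DF k b) a i t) + 2 * ∑ a, ∑ i, nn (HM v (DF l (DF k b)) a i t) at this
      linarith
    have h5 := h4 0
    have h6 := h4 1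
    have h7 := hW1 k
    have h8 := sum_nn_nonneg2 (HM v (DF k b)) t
    simp only [hs_zero_eq, zero_add] at *
    change _ ≤ _ + 2 * ∑ a, ∑ i, hs 1 (HM v (DF k b) a i t) at h2
    linarith
  rw [QQ_succ_le, sum_nn_D 1]
  have k0 := key 0
  have k1 := key 1
  have n0 := sum_nn_nonneg2 N t
  linarith

theorem nn_mul_bd {f g : E2 → ℝ} (hf : Sch f) (hg : Sch g) {a0 a1 c0 c1 : ℝ} (h1 : nn f ≤ a0) (h2 : nn (pd 0 f) ≤ a1)
    (h3 : nn g ≤ c0) (h4 : nn (pd 1 g) ≤ c1) : nn (f * g) ≤ 4 * (√a0 * √a1 * (√c0 * √c1)) := by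
  have h := nn_mul_le hf hg
  have m : √(nn f) * √(nn (pd 0 f)) * (√(nn g) * √(nn (pd 1 g))) ≤ √a0 * √a1 * (√c0 * √c1) :=
    mul_le_mul (mul_le_mul (Real.sqrt_le_sqrt h1) (Real.sqrt_le_sqrt h2) (Real.sqrt_nonneg _) (Real.sqrt_nonneg _))
      (mul_le_mul (Real.sqrt_le_sqrt h3) (Real.sqrt_le_sqrt h4) (Real.sqrt_nonneg _) (Real.sqrt_nonneg _)) (by positivity) (by positivity)
  linarith

end
end

end Part10

section Part11
open MeasureTheory Set Filter Topology
open scoped ENNReal ContDiff SchwartzMap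

noncomputable section

/-! ### the system and the equations derived from it -/

def adv (f g : Fin 3 → TF) (a : Fin 3) (t : ℝ) : E2 → ℝ := f 0 t * pd 0 (g a t) + f 1 t * pd 1 (g a t)
def CE (b : Fin 3 → TF) : Fin 3 → TF := ![D 1 (Ef2 b b), -D 0 (Ef2 b b), D 0 (Ef1 b b) - D 1 (Ef0 b b)]
def GP (π : TF) : Fin 3 → TF := ![D 0 π, D 1 π, 0]
def NB (u b : Fin 3 → TF) (a : Fin 3) (i : Fin 2) : TF := b i.castSucc * u a - u i.castSucc * b a
def zz (u b : Fin 3 → TF) : Fin 3 → TF := ![b 0 + J0 u, b 1 + J1 u, b 2 + J2 u]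

structure Sol (T : ℝ) (u b : Fin 3 → TF) (π : TF) : Prop where
  ru : ∀ a, Reg T (u a)
  rb : ∀ a, Reg T (b a)
  rp : Reg T π
  du : ∀ t, pd 1 (u 1 t) = -pd 0 (u 0 t)
  db : ∀ t, pd 1 (b 1 t) = -pd 0 (b 0 t)
  eu : ∀ t ∈ Ioo 0 T, ∀ a, dt (u a) t = lap (u a t) - adv u u a t + adv b b a t - GP π a t
  eb : ∀ t ∈ Ioo 0 T, ∀ a, dt (b a) t = lap (b a t) - adv u b a t + adv b u a t - CE b a t

section
variable {U0 U1 U2 B0 B1 B2 P : E2 → ℝ}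

theorem id_b {A C : E2 → ℝ} (hU0 : Sch U0) (hU1 : Sch U1) (hA : Sch A) (hB0 : Sch B0) (hB1 : Sch B1) (hC : Sch C)
    (dU : pd 1 U1 = -pd 0 U0) (dB : pd 1 B1 = -pd 0 B0) :
    pd 0 (B0 * A - U0 * C) + pd 1 (B1 * A - U1 * C) = B0 * pd 0 A + B1 * pd 1 A - (U0 * pd 0 C + U1 * pd 1 C) := by
  simp only [pd_add, pd_sub, pd_mul, pd_neg, Sch.add, Sch.sub, Sch.mul, Sch.neg, Sch.pd, *]
  ring

theorem id_z0 (hU0 : Sch U0) (hU1 : Sch U1) (hU2 : Sch U2) (hB0 : Sch B0) (hB1 : Sch B1) (hB2 : Sch B2)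
    (dU : pd 1 U1 = -pd 0 U0) (dB : pd 1 B1 = -pd 0 B0) :
    lap B0 - (U0 * pd 0 B0 + U1 * pd 1 B0) + (B0 * pd 0 U0 + B1 * pd 1 U0) - pd 1 (pd 1 B2 * B1 - -pd 0 B2 * B0) +
      pd 1 (lap U2 - (U0 * pd 0 U2 + U1 * pd 1 U2) + (B0 * pd 0 B2 + B1 * pd 1 B2) - 0)
    = lap (B0 + pd 1 U2) + pd 1 ((B1 + -pd 0 U2) * U0 - U1 * (B0 + pd 1 U2)) := by
  have e1 := pd_comm hU2 1 0
  have e2 := pd_comm hB2 1 0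
  simp (config := { maxDischargeDepth := 12 }) only [sub_zero, pd_add, pd_sub, pd_mul, pd_neg, Sch.add, Sch.sub, Sch.mul, Sch.neg, Sch.pd, Sch.lap, lap_add, pd_lap, *]
  ring

theorem id_z1 (hU0 : Sch U0) (hU1 : Sch U1) (hU2 : Sch U2) (hB0 : Sch B0) (hB1 : Sch B1) (hB2 : Sch B2)
    (dU : pd 1 U1 = -pd 0 U0) (dB : pd 1 B1 = -pd 0 B0) :
    lap B1 - (U0 * pd 0 B1 + U1 * pd 1 B1) + (B0 * pd 0 U1 + B1 * pd 1 U1) - -pd 0 (pd 1 B2 * B1 - -pd 0 B2 * B0) +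
      -pd 0 (lap U2 - (U0 * pd 0 U2 + U1 * pd 1 U2) + (B0 * pd 0 B2 + B1 * pd 1 B2) - 0)
    = lap (B1 + -pd 0 U2) + pd 0 ((B0 + pd 1 U2) * U1 - U0 * (B1 + -pd 0 U2)) := by
  have e1 := pd_comm hU2 1 0
  have e2 := pd_comm hB2 1 0
  have e3 : lap (-pd 0 U2) = -lap (pd 0 U2) := by simp only [lap_eq, pd_neg]; ring
  simp (config := { maxDischargeDepth := 12 }) only [sub_zero, pd_add, pd_sub, pd_mul, pd_neg, Sch.add, Sch.sub, Sch.mul, Sch.neg, Sch.pd, Sch.lap, lap_add, pd_lap, *]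
  ring

theorem id_z2 (hU0 : Sch U0) (hU1 : Sch U1) (hU2 : Sch U2) (hB0 : Sch B0) (hB1 : Sch B1) (hB2 : Sch B2) (hP : Sch P)
    (dU : pd 1 U1 = -pd 0 U0) (dB : pd 1 B1 = -pd 0 B0) :
    lap B2 - (U0 * pd 0 B2 + U1 * pd 1 B2) + (B0 * pd 0 U2 + B1 * pd 1 U2) -
        (pd 0 ((pd 0 B1 - pd 1 B0) * B0 - pd 1 B2 * B2) - pd 1 (-pd 0 B2 * B2 - (pd 0 B1 - pd 1 B0) * B1)) +
      (pd 0 (lap U1 - (U0 * pd 0 U1 + U1 * pd 1 U1) + (B0 * pd 0 B1 + B1 * pd 1 B1) - pd 1 P) -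
       pd 1 (lap U0 - (U0 * pd 0 U0 + U1 * pd 1 U0) + (B0 * pd 0 B0 + B1 * pd 1 B0) - pd 0 P))
    = lap (B2 + (pd 0 U1 - pd 1 U0)) + (pd 0 ((B0 + pd 1 U2) * U2 - U0 * (B2 + (pd 0 U1 - pd 1 U0))) +
        pd 1 ((B1 + -pd 0 U2) * U2 - U1 * (B2 + (pd 0 U1 - pd 1 U0)))) := by
  have e1 := pd_comm hU2 1 0
  have e2 := pd_comm hB2 1 0
  have e3 := pd_comm hP 1 0
  have e4 := pd_comm hU0 1 0
  have e5 := pd_comm hB0 1 0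
  have e6 := pd_comm hU1 1 0
  have e7 := pd_comm hB1 1 0
  rw [dU, pd_neg] at e6
  rw [dB, pd_neg] at e7
  simp (config := { maxDischargeDepth := 12 }) only [sub_zero, pd_add, pd_sub, pd_mul, pd_neg, Sch.add, Sch.sub, Sch.mul, Sch.neg, Sch.pd, Sch.lap, lap_add, lap_sub, pd_lap, *]
  ring

/-- the energy cancellation -/
theorem id_energy (hU0 : Sch U0) (hU1 : Sch U1) (hU2 : Sch U2) (hB0 : Sch B0) (hB1 : Sch B1) (hB2 : Sch B2) (hP : Sch P)
    (dU : pd 1 U1 = -pd 0 U0) (dB : pd 1 B1 = -pd 0 B0) {E0 E1 E2' : E2 → ℝ}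
    (sE0 : Sch E0) (sE1 : Sch E1) (sE2 : Sch E2')
    (hE0 : E0 = -pd 0 B2 * B2 - (pd 0 B1 - pd 1 B0) * B1) (hE1 : E1 = (pd 0 B1 - pd 1 B0) * B0 - pd 1 B2 * B2)
    (hE2 : E2' = pd 1 B2 * B1 - -pd 0 B2 * B0) :
    ∫ x, (U0 * (-(U0 * pd 0 U0 + U1 * pd 1 U0) + (B0 * pd 0 B0 + B1 * pd 1 B0) - pd 0 P) +
      U1 * (-(U0 * pd 0 U1 + U1 * pd 1 U1) + (B0 * pd 0 B1 + B1 * pd 1 B1) - pd 1 P) +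
      U2 * (-(U0 * pd 0 U2 + U1 * pd 1 U2) + (B0 * pd 0 B2 + B1 * pd 1 B2) - 0) +
      (B0 * (-(U0 * pd 0 B0 + U1 * pd 1 B0) + (B0 * pd 0 U0 + B1 * pd 1 U0) - pd 1 E2') +
      B1 * (-(U0 * pd 0 B1 + U1 * pd 1 B1) + (B0 * pd 0 U1 + B1 * pd 1 U1) - -pd 0 E2') +
      B2 * (-(U0 * pd 0 B2 + U1 * pd 1 B2) + (B0 * pd 0 U2 + B1 * pd 1 U2) - (pd 0 E1 - pd 1 E0)))) x = 0 := by
  set S := U0 * U0 + U1 * U1 + U2 * U2 + (B0 * B0 + B1 * B1 + B2 * B2) with hS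
  set R := U0 * B0 + U1 * B1 + U2 * B2 with hR
  have sS : Sch S := ((hU0.mul hU0).add (hU1.mul hU1)).add (hU2.mul hU2) |>.add (((hB0.mul hB0).add (hB1.mul hB1)).add (hB2.mul hB2))
  have sR : Sch R := ((hU0.mul hB0).add (hU1.mul hB1)).add (hU2.mul hB2)
  set F0 := (-1/2 : ℝ) • (U0 * S) + (B0 * R - U0 * P - (E1 * B2 - E2' * B1)) with hF0
  set F1 := (-1/2 : ℝ) • (U1 * S) + (B1 * R - U1 * P - (E2' * B0 - E0 * B2)) with hF1
  have s0 : Sch F0 := ((hU0.mul sS).smul _).add (((hB0.mul sR).sub (hU0.mul hP)).sub ((sE1.mul hB2).sub (sE2.mul hB1)))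
  have s1 : Sch F1 := ((hU1.mul sS).smul _).add (((hB1.mul sR).sub (hU1.mul hP)).sub ((sE2.mul hB0).sub (sE0.mul hB2)))
  have e : ∀ x, (U0 * (-(U0 * pd 0 U0 + U1 * pd 1 U0) + (B0 * pd 0 B0 + B1 * pd 1 B0) - pd 0 P) +
      U1 * (-(U0 * pd 0 U1 + U1 * pd 1 U1) + (B0 * pd 0 B1 + B1 * pd 1 B1) - pd 1 P) +
      U2 * (-(U0 * pd 0 U2 + U1 * pd 1 U2) + (B0 * pd 0 B2 + B1 * pd 1 B2) - 0) +
      (B0 * (-(U0 * pd 0 B0 + U1 * pd 1 B0) + (B0 * pd 0 U0 + B1 * pd 1 U0) - pd 1 E2') +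
      B1 * (-(U0 * pd 0 B1 + U1 * pd 1 B1) + (B0 * pd 0 U1 + B1 * pd 1 U1) - -pd 0 E2') +
      B2 * (-(U0 * pd 0 B2 + U1 * pd 1 B2) + (B0 * pd 0 U2 + B1 * pd 1 U2) - (pd 0 E1 - pd 1 E0)))) x = pd 0 F0 x + pd 1 F1 x := by
    intro x
    have q0 : ∀ k, pd k S = pd k U0 * U0 + U0 * pd k U0 + (pd k U1 * U1 + U1 * pd k U1) + (pd k U2 * U2 + U2 * pd k U2) +
        (pd k B0 * B0 + B0 * pd k B0 + (pd k B1 * B1 + B1 * pd k B1) + (pd k B2 * B2 + B2 * pd k B2)) := by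
      intro k
      simp (config := { maxDischargeDepth := 12 }) only [hS, pd_add, pd_mul, Sch.add, Sch.mul, hU0, hU1, hU2, hB0, hB1, hB2]
    have q1 : ∀ k, pd k R = pd k U0 * B0 + U0 * pd k B0 + (pd k U1 * B1 + U1 * pd k B1) + (pd k U2 * B2 + U2 * pd k B2) := by
      intro k
      simp (config := { maxDischargeDepth := 12 }) only [hR, pd_add, pd_mul, Sch.add, Sch.mul, hU0, hU1, hU2, hB0, hB1, hB2]
    have q2 : pd 0 F0 = (-1/2 : ℝ) • (pd 0 U0 * S + U0 * pd 0 S) + (pd 0 B0 * R + B0 * pd 0 R - (pd 0 U0 * P + U0 * pd 0 P) -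
        ((pd 0 E1 * B2 + E1 * pd 0 B2) - (pd 0 E2' * B1 + E2' * pd 0 B1))) := by
      rw [hF0, pd_add ((hU0.mul sS).smul _) (((hB0.mul sR).sub (hU0.mul hP)).sub ((sE1.mul hB2).sub (sE2.mul hB1))),
        pd_smul _ (hU0.mul sS), pd_sub ((hB0.mul sR).sub (hU0.mul hP)) ((sE1.mul hB2).sub (sE2.mul hB1)),
        pd_sub (hB0.mul sR) (hU0.mul hP), pd_sub (sE1.mul hB2) (sE2.mul hB1), pd_mul hU0 sS, pd_mul hB0 sR, pd_mul hU0 hP,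
        pd_mul sE1 hB2, pd_mul sE2 hB1]
    have q3 : pd 1 F1 = (-1/2 : ℝ) • (pd 1 U1 * S + U1 * pd 1 S) + (pd 1 B1 * R + B1 * pd 1 R - (pd 1 U1 * P + U1 * pd 1 P) -
        ((pd 1 E2' * B0 + E2' * pd 1 B0) - (pd 1 E0 * B2 + E0 * pd 1 B2))) := by
      rw [hF1, pd_add ((hU1.mul sS).smul _) (((hB1.mul sR).sub (hU1.mul hP)).sub ((sE2.mul hB0).sub (sE0.mul hB2))),
        pd_smul _ (hU1.mul sS), pd_sub ((hB1.mul sR).sub (hU1.mul hP)) ((sE2.mul hB0).sub (sE0.mul hB2)),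
        pd_sub (hB1.mul sR) (hU1.mul hP), pd_sub (sE2.mul hB0) (sE0.mul hB2), pd_mul hU1 sS, pd_mul hB1 sR, pd_mul hU1 hP,
        pd_mul sE2 hB0, pd_mul sE0 hB2]
    rw [q2, q3, q0, q1, q0, q1, dU, dB]
    have w0 := congrFun hE0 x
    have w1 := congrFun hE1 x
    have w2 := congrFun hE2 x
    simp only [hS, hR, Pi.add_apply, Pi.sub_apply, Pi.mul_apply, Pi.neg_apply, Pi.smul_apply, smul_eq_mul, Pi.zero_apply] at *
    rw [w0, w1, w2]
    ring
  rw [integral_congr_ae (ae_of_all _ e), integral_add (s0.pd 0).integrable (s1.pd 1).integrable, integral_pd s0, integral_pd s1, add_zero]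

end

section
variable {T : ℝ} {u b : Fin 3 → TF} {π : TF}

theorem Reg.zz (hu : ∀ a, Reg T (u a)) (hb : ∀ a, Reg T (b a)) (a : Fin 3) : Reg T (zz u b a) := by
  fin_cases a
  · exact (hb 0).add (Reg.J0 hu)
  · exact (hb 1).add (Reg.J1 hu)
  · exact (hb 2).add (Reg.J2 hu)

theorem Reg.NB (hu : ∀ a, Reg T (u a)) (hb : ∀ a, Reg T (b a)) (a : Fin 3) (i : Fin 2) : Reg T (NB u b a i) :=
  ((hb _).mul (hu a)).sub ((hu _).mul (hb a))

theorem Reg.CE (hb : ∀ a, Reg T (b a)) (a : Fin 3) : Reg T (CE b a) := by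
  fin_cases a
  · exact (Reg.Ef2 hb hb).D 1
  · exact ((Reg.Ef2 hb hb).D 0).neg
  · exact ((Reg.Ef1 hb hb).D 0).sub ((Reg.Ef0 hb hb).D 1)

theorem Reg.GP (hp : Reg T π) (a : Fin 3) : Reg T (GP π a) := by
  fin_cases a
  · exact hp.D 0
  · exact hp.D 1
  · exact Reg.zero

theorem Sol.beq (h : Sol T u b π) : ∀ t ∈ Ioo 0 T, ∀ x a,
    dt (b a) t x = lap (b a t) x + ∑ i, pd i (NB u b a i t + HM b b a i t) x := by
  intro t ht x a
  have s := fun a => (h.ru a).sch t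
  have s' := fun a => (h.rb a).sch t
  have sN := fun i => (Reg.NB h.ru h.rb a i).sch t
  have sH := fun i => (Reg.HM h.rb h.rb a i).sch t
  rw [h.eb t ht a, Fin.sum_univ_two, pd_add (sN 0) (sH 0), pd_add (sN 1) (sH 1)]
  have e1 : pd 0 (NB u b a 0 t) + pd 1 (NB u b a 1 t) = adv b u a t - adv u b a t :=
    id_b (s 0) (s 1) (s a) (s' 0) (s' 1) (s' a) (h.du t) (h.db t)
  have e1 := congrFun e1 x
  have e2 : pd 0 (HM b b a 0 t) + pd 1 (HM b b a 1 t) = -CE b a t := by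
    fin_cases a
    · change pd 0 0 + pd 1 (-Ef2 b b t) = -pd 1 (Ef2 b b t)
      rw [pd_zero, zero_add, pd_neg]
    · change pd 0 (Ef2 b b t) + pd 1 0 = - -pd 0 (Ef2 b b t)
      rw [pd_zero, add_zero, neg_neg]
    · change pd 0 (-Ef1 b b t) + pd 1 (Ef0 b b t) = -(pd 0 (Ef1 b b t) - pd 1 (Ef0 b b t))
      rw [pd_neg]; ring
  have e2 := congrFun e2 x
  simp only [Pi.add_apply, Pi.sub_apply, Pi.neg_apply] at *
  linarith

theorem Sol.zeq (h : Sol T u b π) : ∀ t ∈ Ioo 0 T, ∀ x a,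
    dt (zz u b a) t x = lap (zz u b a t) x + ∑ i, pd i (NB u (zz u b) a i t) x := by
  intro t ht x a
  have s := fun a => (h.ru a).sch t
  have s' := fun a => (h.rb a).sch t
  have z0 : ∀ f : E2 → ℝ, f - f = 0 := fun f => sub_self f
  rw [Fin.sum_univ_two]
  fin_cases a
  · change dt (b 0 + D 1 (u 2)) t x = lap (b 0 t + pd 1 (u 2 t)) x + (pd 0 ((b 0 t + pd 1 (u 2 t)) * u 0 t - u 0 t * (b 0 t + pd 1 (u 2 t))) x +
      pd 1 ((b 1 t + -pd 0 (u 2 t)) * u 0 t - u 1 t * (b 0 t + pd 1 (u 2 t))) x)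
    rw [mul_comm _ (u 0 t), z0, pd_zero, dt_add (h.rb 0) ((h.ru 2).D 1) ht, dt_D (h.ru 2) ht, h.eu t ht, h.eb t ht]
    have := congrFun (id_z0 (s 0) (s 1) (s 2) (s' 0) (s' 1) (s' 2) (h.du t) (h.db t)) x
    rw [Pi.zero_apply, zero_add]
    exact this
  · change dt (b 1 + -D 0 (u 2)) t x = lap (b 1 t + -pd 0 (u 2 t)) x + (pd 0 ((b 0 t + pd 1 (u 2 t)) * u 1 t - u 0 t * (b 1 t + -pd 0 (u 2 t))) x +
      pd 1 ((b 1 t + -pd 0 (u 2 t)) * u 1 t - u 1 t * (b 1 t + -pd 0 (u 2 t))) x)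
    rw [mul_comm (b 1 t + -pd 0 (u 2 t)) (u 1 t), z0, pd_zero, dt_add (h.rb 1) ((h.ru 2).D 0).neg ht, dt_neg ((h.ru 2).D 0) ht, dt_D (h.ru 2) ht, h.eu t ht, h.eb t ht]
    have := congrFun (id_z1 (s 0) (s 1) (s 2) (s' 0) (s' 1) (s' 2) (h.du t) (h.db t)) x
    rw [Pi.zero_apply, add_zero]
    exact this
  · change dt (b 2 + (D 0 (u 1) - D 1 (u 0))) t x = lap (b 2 t + (pd 0 (u 1 t) - pd 1 (u 0 t))) x + _
    rw [dt_add (h.rb 2) (((h.ru 1).D 0).sub ((h.ru 0).D 1)) ht, dt_sub ((h.ru 1).D 0) ((h.ru 0).D 1) ht, dt_D (h.ru 1) ht, dt_D (h.ru 0) ht,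
      h.eu t ht, h.eu t ht, h.eb t ht]
    exact congrFun (id_z2 (s 0) (s 1) (s 2) (s' 0) (s' 1) (s' 2) (h.rp.sch t) (h.du t) (h.db t)) x

end
end

end Part11

section Part12
open MeasureTheory Set Filter Topology
open scoped ENNReal ContDiff SchwartzMap

noncomputable section

/-! ### closure properties of the classes `TB`, `TI`, `LB` -/

structure Cls (T : ℝ) (P : (ℝ → ℝ) → Prop) : Prop where
  mono : ∀ {f g : ℝ → ℝ}, P g → (∀ t ∈ Ioo 0 T, f t ≤ g t) → P f
  add : ∀ {f g : ℝ → ℝ}, P f → P g → P (fun t => f t + g t)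
  cmul : ∀ {c : ℝ} {f : ℝ → ℝ}, 0 ≤ c → P f → P (fun t => c * f t)

theorem clsB (T : ℝ) : Cls T (TB T) := ⟨TB.mono, TB.add, TB.const_mul⟩
theorem clsI (T : ℝ) : Cls T (TI T) := ⟨TI.mono, TI.add, TI.const_mul⟩
theorem clsL (T : ℝ) : Cls T (LB T) := ⟨LB.mono, LB.add, LB.const_mul⟩

def HP (P : (ℝ → ℝ) → Prop) (k : ℕ) (f : TF) : Prop := P (fun t => hs k (f t))

section
variable {T : ℝ} {P : (ℝ → ℝ) → Prop} {f g : TF} {k k' : ℕ}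

theorem HP.le (c : Cls T P) (h : HP P k f) (hk : k' ≤ k) : HP P k' f := c.mono h fun t _ => hs_mono hk _
theorem HP.D (c : Cls T P) (h : HP P (k + 1) f) (i : Fin 2) : HP P k (D i f) := c.mono h fun t _ => hs_pd_le k _ i
theorem HP.neg (c : Cls T P) (h : HP P k f) : HP P k (-f) := c.mono h fun t _ => (hs_neg k (f t)).le
theorem HP.add (c : Cls T P) (rf : Reg T f) (rg : Reg T g) (h : HP P k f) (h' : HP P k g) : HP P k (f + g) :=
  c.mono (c.add (c.cmul zero_le_two h) (c.cmul zero_le_two h')) fun t _ => hs_add_le k (rf.sch t) (rg.sch t)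
theorem HP.sub (c : Cls T P) (rf : Reg T f) (rg : Reg T g) (h : HP P k f) (h' : HP P k g) : HP P k (f - g) :=
  c.mono (c.add (c.cmul zero_le_two h) (c.cmul zero_le_two h')) fun t _ => hs_sub_le k (rf.sch t) (rg.sch t)
theorem HP.succ (c : Cls T P) (h : HP P 0 f) (h0 : HP P k (_root_.D 0 f)) (h1 : HP P k (_root_.D 1 f)) : HP P (k + 1) f :=
  c.mono (c.add h (c.add h0 h1)) fun t _ => (hs_succ k (f t)).le

theorem HP.mulL (hk : 2 ≤ k) (rf : Reg T f) (rg : Reg T g) (h : HP (LB T) k f) (h' : HP (LB T) k g) : HP (LB T) k (f * g) := by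
  obtain ⟨C, hC, hp⟩ := Prsss hk
  exact LB.mono (LB.const_mul hC (LB.mul h h' fun t => hs_nonneg _ _)) fun t _ => hp _ _ (rf.sch t) (rg.sch t)

theorem HP.mulI {i j : ℕ} (hp : Pr k i j) (rf : Reg T f) (rg : Reg T g) (h : HP (TB T) i f) (h' : HP (TI T) j g) :
    HP (TI T) k (f * g) := by
  obtain ⟨C, hC, hp⟩ := hp
  exact TI.mono (TI.const_mul hC (TB.mulTI h (fun t _ => hs_nonneg _ _) h')) fun t _ => hp _ _ (rf.sch t) (rg.sch t)

theorem HP.B_I (h : HP (TB T) k f) : HP (TI T) k f := TB.toTI h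

theorem HP.of_sum {ι : Type} [Fintype ι] {v : ι → TF} (c : Cls T P) (h : P (fun t => ∑ a, hs k (v a t))) (a : ι) : HP P k (v a) :=
  c.mono h fun t _ => Finset.single_le_sum (f := fun a => hs k (v a t)) (fun a _ => hs_nonneg k _) (Finset.mem_univ a)

theorem HP.of_sum2 {ι : Type} [Fintype ι] {v : ι → TF} (c : Cls T P) (h0 : P (fun t => ∑ a, hs k (v a t)))
    (h : P (fun t => ∑ a, ∑ i, hs k (pd i (v a t)))) (a : ι) : HP P (k + 1) (v a) := by
  refine c.mono (c.add (HP.of_sum c h0 a) h) fun t _ => ?_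
  have := Finset.single_le_sum (f := fun a => ∑ i, hs k (pd i (v a t))) (fun a _ => Finset.sum_nonneg fun i _ => hs_nonneg k _) (Finset.mem_univ a)
  rw [Fin.sum_univ_two] at this
  have h2 := nn_le_hs k (v a t)
  rw [hs_succ]; linarith
end

section
variable {T : ℝ} {u b : Fin 3 → TF} {π : TF}

theorem Reg.adv {f g : Fin 3 → TF} (hf : ∀ a, Reg T (f a)) (hg : ∀ a, Reg T (g a)) (a : Fin 3) : Reg T (adv f g a) :=
  ((hf 0).mul ((hg a).D 0)).add ((hf 1).mul ((hg a).D 1))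

theorem LB_adv {f g : Fin 3 → TF} (hf : ∀ a, Reg T (f a)) (hg : ∀ a, Reg T (g a))
    (lf : ∀ a, HP (LB T) 3 (f a)) (lg : ∀ a, HP (LB T) 3 (g a)) (a : Fin 3) : HP (LB T) 2 (adv f g a) :=
  HP.add (clsL T) ((hf 0).mul ((hg a).D 0)) ((hf 1).mul ((hg a).D 1))
    (HP.mulL le_rfl (hf 0) ((hg a).D 0) ((lf 0).le (clsL T) (by norm_num)) ((lg a).D (clsL T) 0))
    (HP.mulL le_rfl (hf 1) ((hg a).D 1) ((lf 1).le (clsL T) (by norm_num)) ((lg a).D (clsL T) 1))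

def KU (u b : Fin 3 → TF) (a : Fin 3) : TF := -adv u u a + adv b b a

theorem Reg.KU (hu : ∀ a, Reg T (u a)) (hb : ∀ a, Reg T (b a)) (a : Fin 3) : Reg T (KU u b a) :=
  (Reg.adv hu hu a).neg.add (Reg.adv hb hb a)

theorem Sol.pressure (h : Sol T u b π) {t : ℝ} (ht : t ∈ Ioo 0 T) :
    nn (pd 0 (π t)) + nn (pd 1 (π t)) ≤ nn (KU u b 0 t) + nn (KU u b 1 t) := by
  have sp := h.rp.sch t
  have sK := fun a => (Reg.KU h.ru h.rb a).sch t
  have su := fun a => (h.ru a).sch t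
  set Y0 := KU u b 0 t - pd 0 (π t) with hY0
  set Y1 := KU u b 1 t - pd 1 (π t) with hY1
  have sY0 : Sch Y0 := (sK 0).sub (sp.pd 0)
  have sY1 : Sch Y1 := (sK 1).sub (sp.pd 1)
  have e0 : dt (u 0) t = lap (u 0 t) + Y0 := by
    rw [h.eu t ht 0, hY0]; change _ - _ + _ - pd 0 (π t) = _ + ((-adv u u 0 t + adv b b 0 t) - _); ring
  have e1 : dt (u 1) t = lap (u 1 t) + Y1 := by
    rw [h.eu t ht 1, hY1]; change _ - _ + _ - pd 1 (π t) = _ + ((-adv u u 1 t + adv b b 1 t) - _); ring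
  have hD : D 1 (u 1) = - D 0 (u 0) := funext h.du
  have dY : ∀ x, pd 0 Y0 x + pd 1 Y1 x = 0 := by
    intro x
    have a0 := dt_D (h.ru 0) ht x 0
    have a1 := dt_D (h.ru 1) ht x 1
    rw [hD, dt_neg ((h.ru 0).D 0) ht, a0, e0, e1, pd_add (su 0).lap sY0, pd_add (su 1).lap sY1, pd_lap (su 0), pd_lap (su 1), h.du t] at a1
    have q : lap (-pd 0 (u 0 t)) = -lap (pd 0 (u 0 t)) := by simp only [lap_eq, pd_neg]; ring
    rw [q] at a1
    simp only [Pi.add_apply, Pi.neg_apply] at a1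
    linarith
  have key : (∫ x, Y0 x * pd 0 (π t) x) + ∫ x, Y1 x * pd 1 (π t) x = 0 := by
    rw [ibp sY0 sp, ibp sY1 sp, ← neg_add, ← integral_add ((sY0.pd 0).integrable_mul sp) ((sY1.pd 1).integrable_mul sp), neg_eq_zero]
    rw [← integral_zero E2 ℝ]
    refine integral_congr_ae (ae_of_all _ fun x => ?_)
    dsimp only
    rw [← add_mul, dY, zero_mul]
  have f0 : nn (pd 0 (π t)) + 2 * ∫ x, Y0 x * pd 0 (π t) x ≤ nn (KU u b 0 t) := by
    unfold nn
    rw [← integral_const_mul, ← integral_add (sp.pd 0).integrable_sq ((sY0.integrable_mul (sp.pd 0)).const_mul 2)]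
    refine integral_mono (((sp.pd 0).integrable_sq).add ((sY0.integrable_mul (sp.pd 0)).const_mul 2)) (sK 0).integrable_sq fun x => ?_
    simp only [hY0, Pi.sub_apply]
    nlinarith [sq_nonneg (KU u b 0 t x - pd 0 (π t) x)]
  have f1 : nn (pd 1 (π t)) + 2 * ∫ x, Y1 x * pd 1 (π t) x ≤ nn (KU u b 1 t) := by
    unfold nn
    rw [← integral_const_mul, ← integral_add (sp.pd 1).integrable_sq ((sY1.integrable_mul (sp.pd 1)).const_mul 2)]
    refine integral_mono (((sp.pd 1).integrable_sq).add ((sY1.integrable_mul (sp.pd 1)).const_mul 2)) (sK 1).integrable_sq fun x => ?_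
    simp only [hY1, Pi.sub_apply]
    nlinarith [sq_nonneg (KU u b 1 t x - pd 1 (π t) x)]
  linarith

theorem LB_KU (hu : ∀ a, Reg T (u a)) (hb : ∀ a, Reg T (b a))
    (lu : ∀ a, HP (LB T) 3 (u a)) (lb : ∀ a, HP (LB T) 3 (b a)) (a : Fin 3) : HP (LB T) 2 (KU u b a) :=
  HP.add (clsL T) (Reg.adv hu hu a).neg (Reg.adv hb hb a) ((LB_adv hu hu lu lu a).neg (clsL T)) (LB_adv hb hb lb lb a)

theorem LB_GP (h : Sol T u b π) (lu : ∀ a, HP (LB T) 3 (u a)) (lb : ∀ a, HP (LB T) 3 (b a)) (a : Fin 3) :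
    HP (LB T) 0 (GP π a) := by
  have l := fun a => (LB_KU h.ru h.rb lu lb a).le (clsL T) (Nat.zero_le 2)
  have q := (clsL T).add (l 0) (l 1)
  fin_cases a
  · refine q.mono fun t ht => ?_
    have := h.pressure ht
    have := nn_nonneg (pd 1 (π t))
    change nn (pd 0 (π t)) ≤ nn _ + nn _
    linarith
  · refine q.mono fun t ht => ?_
    have := h.pressure ht
    have := nn_nonneg (pd 0 (π t))
    change nn (pd 1 (π t)) ≤ nn _ + nn _
    linarith
  · refine LB.zero.mono fun t ht => ?_
    exact (hs_zero_fun 0).le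

theorem LB_J (hb : ∀ a, Reg T (b a)) (lb : ∀ a, HP (LB T) 3 (b a)) :
    HP (LB T) 2 (J0 b) ∧ HP (LB T) 2 (J1 b) ∧ HP (LB T) 2 (J2 b) :=
  ⟨(lb 2).D (clsL T) 1, ((lb 2).D (clsL T) 0).neg (clsL T),
    HP.sub (clsL T) ((hb 1).D 0) ((hb 0).D 1) ((lb 1).D (clsL T) 0) ((lb 0).D (clsL T) 1)⟩

theorem LB_CE (hb : ∀ a, Reg T (b a)) (lb : ∀ a, HP (LB T) 3 (b a)) (a : Fin 3) : HP (LB T) 0 (CE b a) := by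
  obtain ⟨j0, j1, j2⟩ := LB_J hb lb
  have c := clsL T
  have l2 := fun a => (lb a).le c (show 2 ≤ 3 by norm_num)
  have m : ∀ {f : TF} (a : Fin 3), Reg T f → HP (LB T) 2 f → HP (LB T) 2 (f * b a) := fun a rf h => HP.mulL le_rfl rf (hb a) h (l2 a)
  have r0 := Reg.J0 hb
  have r1 := Reg.J1 hb
  have r2 := Reg.J2 hb
  have E0 : HP (LB T) 2 (Ef0 b b) := HP.sub c (r1.mul (hb 2)) (r2.mul (hb 1)) (m 2 r1 j1) (m 1 r2 j2)
  have E1 : HP (LB T) 2 (Ef1 b b) := HP.sub c (r2.mul (hb 0)) (r0.mul (hb 2)) (m 0 r2 j2) (m 2 r0 j0)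
  have E2 : HP (LB T) 2 (Ef2 b b) := HP.sub c (r0.mul (hb 1)) (r1.mul (hb 0)) (m 1 r0 j0) (m 0 r1 j1)
  have e0 := Reg.Ef0 hb hb
  have e1 := Reg.Ef1 hb hb
  refine HP.le c (k := 1) ?_ (by norm_num)
  fin_cases a
  · exact E2.D c 1
  · exact (E2.D c 0).neg c
  · exact HP.sub c (e1.D 0) (e0.D 1) (E1.D c 0) (E0.D c 1)

theorem LB.exists_sum {ι : Type} [Fintype ι] {f : ι → TF} (h : ∀ a, HP (LB T) 0 (f a)) : LB T (fun t => ∑ a, nn (f a t)) :=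
  LB.sum fun a _ => h a

/-- the basic energy estimate -/
theorem Sol.L0 (hT : 0 < T) (h : Sol T u b π) (lu : ∀ a, HP (LB T) 3 (u a)) (lb : ∀ a, HP (LB T) 3 (b a)) :
    (∀ a, HP (TB T) 0 (u a) ∧ HP (TI T) 1 (u a)) ∧ (∀ a, HP (TB T) 0 (b a) ∧ HP (TI T) 1 (b a)) := by
  have c := clsL T
  let v : Fin 3 ⊕ Fin 3 → TF := Sum.elim u b
  let H : Fin 3 ⊕ Fin 3 → TF := Sum.elim (fun a => KU u b a - GP π a) (fun a => -adv u b a + adv b u a - CE b a)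
  have rv : ∀ a, Reg T (v a) := by rintro (a | a); exacts [h.ru a, h.rb a]
  have rH : ∀ a, Reg T (H a) := by
    rintro (a | a)
    exacts [(Reg.KU h.ru h.rb a).sub (Reg.GP h.rp a), ((Reg.adv h.ru h.rb a).neg.add (Reg.adv h.rb h.ru a)).sub (Reg.CE h.rb a)]
  have lv : ∀ a, HP (LB T) 0 (v a) := by
    rintro (a | a); exacts [(lu a).le c (by norm_num), (lb a).le c (by norm_num)]
  have lH : ∀ a, HP (LB T) 0 (H a) := by
    rintro (a | a)
    · exact HP.sub c (Reg.KU h.ru h.rb a) (Reg.GP h.rp a) ((LB_KU h.ru h.rb lu lb a).le c (by norm_num)) (LB_GP h lu lb a)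
    · exact HP.sub c ((Reg.adv h.ru h.rb a).neg.add (Reg.adv h.rb h.ru a)) (Reg.CE h.rb a)
        ((HP.add c (Reg.adv h.ru h.rb a).neg (Reg.adv h.rb h.ru a) ((LB_adv h.ru h.rb lu lb a).neg c) (LB_adv h.rb h.ru lb lu a)).le c (by norm_num))
        (LB_CE h.rb lb a)
  have heq : ∀ t ∈ Ioo 0 T, ∀ x a, dt (v a) t x = lap (v a t) x + ∑ i, pd i ((0 : TF) t + (0 : TF) t) x + H a t x := by
    intro t ht x a
    have z : ∀ i : Fin 2, pd i ((0 : TF) t + (0 : TF) t) x = 0 := by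
      intro i
      have : ((0 : TF) t + (0 : TF) t) = 0 := by funext y; simp
      rw [this, pd_zero]; rfl
    simp only [z, Finset.sum_const_zero, add_zero]
    rcases a with a | a
    · change dt (u a) t x = lap (u a t) x + ((-adv u u a t x + adv b b a t x) - GP π a t x)
      rw [h.eu t ht a]
      simp only [Pi.add_apply, Pi.sub_apply]; ring
    · change dt (b a) t x = lap (b a t) x + ((-adv u b a t x + adv b u a t x) - CE b a t x)
      rw [h.eb t ht a]
      simp only [Pi.add_apply, Pi.sub_apply]; ring
  have hH0 : ∀ t, ∑ a, ∫ x, v a t x * H a t x = 0 := by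
    intro t
    have s := fun a => (h.ru a).sch t
    have s' := fun a => (h.rb a).sch t
    rw [← integral_finsetSum _ (fun a _ => ((rv a).sch t).integrable_mul ((rH a).sch t))]
    rw [← id_energy (s 0) (s 1) (s 2) (s' 0) (s' 1) (s' 2) (h.rp.sch t) (h.du t) (h.db t)
      ((Reg.Ef0 h.rb h.rb).sch t) ((Reg.Ef1 h.rb h.rb).sch t) ((Reg.Ef2 h.rb h.rb).sch t) rfl rfl rfl]
    refine integral_congr_ae (ae_of_all _ fun x => ?_)
    dsimp only
    rw [Fintype.sum_sum_type, Fin.sum_univ_three, Fin.sum_univ_three]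
    rfl
  have hE : ∀ t0 t1, 0 < t0 → t0 < t1 → t1 < T → IntegrableOn (fun t => ∑ a, ∑ i, nn (pd i (v a t))) (Ioo t0 t1) ∧
      ∑ a, nn (v a t1) + ∫ t in Ioo t0 t1, ∑ a, ∑ i, nn (pd i (v a t)) ≤ ∑ a, nn (v a t0) + ∫ t in Ioo t0 t1, (0 : ℝ) := by
    intro t0 t1 h0 h01 h1
    obtain ⟨B, hB, hb⟩ := (LB.exists_sum lv).add (LB.exists_sum lH) t0 t1 h0 h01 h1
    have p1 : ∀ t, 0 ≤ ∑ a, nn (v a t) := fun t => Finset.sum_nonneg fun a _ => nn_nonneg _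
    have p2 : ∀ t, 0 ≤ ∑ a, nn (H a t) := fun t => Finset.sum_nonneg fun a _ => nn_nonneg _
    have z : ∀ t : ℝ, nn ((0 : TF) t) = 0 := fun t => nn_zero
    have := energy (T := T) (v := v) (N := fun _ _ => 0) (M := fun _ _ => 0) (H := H) rv (fun _ _ => Reg.zero) (fun _ _ => Reg.zero) rH heq
      (fun t _ x => by simp) h0 h01 h1 (K := 0) (B := B) le_rfl (fun t _ x => by simp)
      (fun t ht => by have := hb t ht; have := p2 t; linarith) (fun t ht => by have := hb t ht; have := p1 t; linarith)
      (fun t _ => hH0 t) (by simp [nn_zero])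
    simpa [nn_zero] using this
  have := closing (T := T) (X := fun t => ∑ a, nn (v a t)) (Y := fun t => ∑ a, ∑ i, nn (pd i (v a t))) (Q := fun _ => 0)
    (fun t => Finset.sum_nonneg fun a _ => nn_nonneg _)
    (fun t => Finset.sum_nonneg fun a _ => Finset.sum_nonneg fun i _ => nn_nonneg _) (fun _ => le_rfl)
    (LB.exists_sum lv) hE
    (Good.of_TI (TB.toTI ⟨T / 2, ⟨by linarith, by linarith⟩, 0, le_rfl, fun t _ => le_rfl⟩)
      (fun t _ => Finset.sum_nonneg fun a _ => nn_nonneg _)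
      (fun t _ => Finset.sum_nonneg fun a _ => Finset.sum_nonneg fun i _ => nn_nonneg _) (fun _ _ => le_rfl))
  have q0 : ∀ a, HP (TB T) 0 (v a) := fun a => HP.of_sum (clsB T) this.1 a
  have q1 : ∀ a, HP (TI T) 1 (v a) := fun a => HP.of_sum2 (clsI T) (this.1.toTI) this.2 a
  exact ⟨fun a => ⟨q0 (.inl a), q1 (.inl a)⟩, fun a => ⟨q0 (.inr a), q1 (.inr a)⟩⟩

end
end

end Part12

section Part13
open MeasureTheory Set Filter Topology
open scoped ENNReal ContDiff SchwartzMap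

noncomputable section

/-! ### the `Good` class -/
section
variable {T : ℝ} {X Y A : ℝ → ℝ} {f g : TF} {s k i j : ℕ}

theorem clsG (hY : ∀ t ∈ Ioo 0 T, 0 ≤ Y t) : Cls T (Good T X Y) := ⟨Good.mono, Good.add, fun hc h => Good.const_mul hc hY h⟩

theorem good_wb (hA : TI T (fun t => A t ^ 2)) (hY : ∀ t ∈ Ioo 0 T, 0 ≤ Y t) (rf : Reg T f) (rg : Reg T g)
    (hw : ∀ t ∈ Ioo 0 T, wb s (A t) (f t)) (hg : ∀ t ∈ Ioo 0 T, hs s (g t) ≤ X t) : HP (Good T X Y) s (f * g) := by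
  obtain ⟨C, hC, h⟩ := wb_mul s
  refine Good.mono (Good.of_mul (hA.const_mul hC) hY fun t _ => by positivity) fun t ht => ?_
  refine (h _ _ _ (rf.sch t) (rg.sch t) (hw t ht)).trans ?_
  rw [mul_assoc]
  have := hg t ht
  gcongr

theorem good_pr (hp : Pr k i j) (hY : ∀ t ∈ Ioo 0 T, 0 ≤ Y t) (rf : Reg T f) (rg : Reg T g)
    (hf : HP (TI T) i f) (hg : ∀ t ∈ Ioo 0 T, hs j (g t) ≤ X t) : HP (Good T X Y) k (f * g) := by
  obtain ⟨C, hC, h⟩ := hp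
  refine Good.mono (Good.of_mul (TI.const_mul hC hf) hY fun t _ => mul_nonneg hC (hs_nonneg _ _)) fun t ht => ?_
  refine (h _ _ (rf.sch t) (rg.sch t)).trans ?_
  rw [mul_assoc]
  have := hg t ht
  have := hs_nonneg i (f t)
  gcongr

theorem good_TI (hX : ∀ t ∈ Ioo 0 T, 0 ≤ X t) (hY : ∀ t ∈ Ioo 0 T, 0 ≤ Y t) (h : HP (TI T) k f) : HP (Good T X Y) k f :=
  Good.of_TI h hX hY fun t _ => hs_nonneg _ _

end

/-! ### div-curl -/

theorem dc0 {f g : E2 → ℝ} (hf : Sch f) (hg : Sch g) (h : pd 1 g = -pd 0 f) :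
    nn (pd 0 f) + nn (pd 1 f) + (nn (pd 0 g) + nn (pd 1 g)) = nn (pd 0 g - pd 1 f) := by
  have e1 : ∫ x, pd 0 g x * pd 1 f x = - nn (pd 0 f) := by
    rw [ibp (hg.pd 0) hf 1, pd_comm hg 1 0, h, pd_neg]
    simp only [Pi.neg_apply, neg_mul, integral_neg, neg_neg]
    have := ibp (hf.pd 0) hf 0
    have e : nn (pd 0 f) = ∫ x, pd 0 f x * pd 0 f x := by unfold nn; simp only [sq]
    rw [e, this, neg_neg]
  have e2 : nn (pd 0 g - pd 1 f) = nn (pd 0 g) + nn (pd 1 f) - 2 * ∫ x, pd 0 g x * pd 1 f x := by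
    unfold nn
    have hi : Integrable (fun x => pd 0 g x ^ 2 + pd 1 f x ^ 2) := (hg.pd 0).integrable_sq.add (hf.pd 1).integrable_sq
    rw [← integral_const_mul, ← integral_add (hg.pd 0).integrable_sq (hf.pd 1).integrable_sq,
      ← integral_sub hi (((hg.pd 0).integrable_mul (hf.pd 1)).const_mul 2)]
    refine integral_congr_ae (ae_of_all _ fun x => ?_)
    simp only [Pi.sub_apply]; ring
  rw [e2, e1, h, nn_neg]; ring

theorem dc (s : ℕ) : ∀ {f g : E2 → ℝ}, Sch f → Sch g → pd 1 g = -pd 0 f →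
    hs s (pd 0 f) + hs s (pd 1 f) + (hs s (pd 0 g) + hs s (pd 1 g)) = hs s (pd 0 g - pd 1 f) := by
  induction s with
  | zero => intro f g hf hg h; exact dc0 hf hg h
  | succ s ih =>
    intro f g hf hg h
    have a := dc0 hf hg h
    have b := fun k => ih (hf.pd k) (hg.pd k) (by rw [pd_comm hg 1 k, h, pd_neg, pd_comm hf k 0])
    have b0 := b 0
    have b1 := b 1
    simp only [hs_succ, pd_sub (hg.pd 0) (hf.pd 1)]
    rw [pd_comm hf 1 0] at b0 ⊢
    rw [pd_comm hg 1 0] at b0 ⊢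
    rw [pd_comm hf 0 1] at b1
    rw [pd_comm hg 0 1] at b1
    rw [pd_comm hf 1 0] at b1
    rw [pd_comm hg 1 0] at b1
    linarith

section
variable {T : ℝ} {u b : Fin 3 → TF} {π : TF} {P : (ℝ → ℝ) → Prop} {k : ℕ}

theorem zz0 : zz u b 0 = b 0 + D 1 (u 2) := rfl
theorem zz1 : zz u b 1 = b 1 + -D 0 (u 2) := rfl
theorem zz2 : zz u b 2 = b 2 + (D 0 (u 1) - D 1 (u 0)) := rfl

theorem u2_of (c : Cls T P) (h : Sol T u b π) (z0 : HP P k (zz u b 0)) (z1 : HP P k (zz u b 1)) (b0 : HP P k (b 0))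
    (b1 : HP P k (b 1)) (h0 : HP P 0 (u 2)) : HP P (k + 1) (u 2) := by
  have rz := Reg.zz h.ru h.rb
  have e1 : D 1 (u 2) = zz u b 0 - b 0 := by rw [zz0]; ring
  have e0 : D 0 (u 2) = b 1 - zz u b 1 := by rw [zz1]; ring
  refine h0.succ c ?_ ?_
  · rw [e0]; exact HP.sub c (h.rb 1) (rz 1) b1 z1
  · rw [e1]; exact HP.sub c (rz 0) (h.rb 0) z0 b0

theorem uh_of (c : Cls T P) (h : Sol T u b π) (z2 : HP P k (zz u b 2)) (b2 : HP P k (b 2)) (h0 : HP P 0 (u 0)) (h1 : HP P 0 (u 1)) :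
    HP P (k + 1) (u 0) ∧ HP P (k + 1) (u 1) := by
  have rz := Reg.zz h.ru h.rb
  have e : D 0 (u 1) - D 1 (u 0) = zz u b 2 - b 2 := by rw [zz2]; ring
  have hw : HP P k (D 0 (u 1) - D 1 (u 0)) := by rw [e]; exact HP.sub c (rz 2) (h.rb 2) z2 b2
  have q := fun t => dc k ((h.ru 0).sch t) ((h.ru 1).sch t) (h.du t)
  have n := fun t i a => hs_nonneg k (pd i (u a t))
  constructor
  · refine h0.succ c (c.mono hw fun t ht => ?_) (c.mono hw fun t ht => ?_)
    · refine le_of_le_of_eq ?_ (q t)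
      have := n t 0 0; have := n t 1 0; have := n t 0 1; have := n t 1 1
      change hs k (pd 0 (u 0 t)) ≤ _; linarith
    · refine le_of_le_of_eq ?_ (q t)
      have := n t 0 0; have := n t 1 0; have := n t 0 1; have := n t 1 1
      change hs k (pd 1 (u 0 t)) ≤ _; linarith
  · refine h1.succ c (c.mono hw fun t ht => ?_) (c.mono hw fun t ht => ?_)
    · refine le_of_le_of_eq ?_ (q t)
      have := n t 0 0; have := n t 1 0; have := n t 0 1; have := n t 1 1
      change hs k (pd 0 (u 1 t)) ≤ _; linarith
    · refine le_of_le_of_eq ?_ (q t)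
      have := n t 0 0; have := n t 1 0; have := n t 0 1; have := n t 1 1
      change hs k (pd 1 (u 1 t)) ≤ _; linarith

theorem LB_zz (h : Sol T u b π) (lu : ∀ a, HP (LB T) (k + 1) (u a)) (lb : ∀ a, HP (LB T) (k + 1) (b a)) (a : Fin 3) :
    HP (LB T) k (zz u b a) := by
  have c := clsL T
  have l := fun a => (lb a).le c (Nat.le_succ k)
  fin_cases a
  · exact HP.add c (h.rb 0) (Reg.J0 h.ru) (l 0) ((lu 2).D c 1)
  · exact HP.add c (h.rb 1) (Reg.J1 h.ru) (l 1) (((lu 2).D c 0).neg c)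
  · exact HP.add c (h.rb 2) (Reg.J2 h.ru) (l 2) (HP.sub c ((h.ru 1).D 0) ((h.ru 0).D 1) ((lu 1).D c 0) ((lu 0).D c 1))

theorem LB_NB {v : Fin 3 → TF} (hk : 2 ≤ k) (hu : ∀ a, Reg T (u a)) (hv : ∀ a, Reg T (v a)) (lu : ∀ a, HP (LB T) k (u a))
    (lv : ∀ a, HP (LB T) k (v a)) (a : Fin 3) (i : Fin 2) : HP (LB T) k (NB u v a i) :=
  HP.sub (clsL T) ((hv _).mul (hu a)) ((hu _).mul (hv a)) (HP.mulL hk (hv _) (hu a) (lv _) (lu a)) (HP.mulL hk (hu _) (hv a) (lu _) (lv a))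

theorem LB_QQ (h : Sol T u b π) (lu : ∀ a, HP (LB T) (max 3 k) (u a)) (lb : ∀ a, HP (LB T) (max 3 k) (b a)) :
    LB T (QQ HM b k b (NB u b)) := by
  have c := clsL T
  obtain ⟨C, hC, hq⟩ := hQ_bound h.rb k
  have l := LB_NB (k := max 3 k) (le_trans (by norm_num) (le_max_left 3 k)) h.ru h.rb lu lb
  have l1 : LB T (fun t => ∑ a, ∑ i, hs k (NB u b a i t)) := LB.sum fun a _ => LB.sum fun i _ => (l a i).le c (le_max_right _ _)
  have l2 : LB T (fun t => ∑ a, hs (max 3 k) (b a t)) := LB.sum fun a _ => lb a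
  have l3 : LB T (fun t => ∑ a, hs k (b a t)) := LB.sum fun a _ => (lb a).le c (le_max_right _ _)
  exact LB.mono (LB.const_mul hC (l1.add (l3.mul l2 fun t => Finset.sum_nonneg fun a _ => hs_nonneg _ _)))
    fun t _ => hq _ _ h.rb (Reg.NB h.ru h.rb) t

end
end

end Part13

section Part14
open MeasureTheory Set Filter Topology
open scoped ENNReal ContDiff SchwartzMap

noncomputable section

/-! ### the chain of estimates -/

structure Ctx (T : ℝ) (u b : Fin 3 → TF) (π : TF) (m : ℕ) (A : ℝ → ℝ) : Prop where
  hT : 0 < T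
  sol : Sol T u b π
  hm : 3 ≤ m
  lu : ∀ a, HP (LB T) m (u a)
  lb : ∀ a, HP (LB T) m (b a)
  hA : TI T (fun t => A t ^ 2)
  wA : ∀ t ∈ Ioo 0 T, ∀ k : Fin 2, wb 3 (A t) (u k.castSucc t)

section
variable {T : ℝ} {ι : Type} [Fintype ι] {u b : Fin 3 → TF} {π : TF} {m : ℕ} {A : ℝ → ℝ}

theorem sumX (s : ℕ) (v : ι → TF) (t : ℝ) : 0 ≤ ∑ a, hs s (v a t) := Finset.sum_nonneg fun a _ => hs_nonneg _ _
theorem sumY (s : ℕ) (v : ι → TF) (t : ℝ) : 0 ≤ ∑ a, ∑ i, hs s (pd i (v a t)) :=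
  Finset.sum_nonneg fun a _ => Finset.sum_nonneg fun i _ => hs_nonneg _ _
theorem leX (s : ℕ) (v : ι → TF) (t : ℝ) (a : ι) : hs s (v a t) ≤ ∑ a, hs s (v a t) :=
  single_le (f := fun a => hs s (v a t)) (fun a => hs_nonneg _ _) a

theorem goodsum (hT : 0 < T) {s : ℕ} {v : ι → TF} {N : ι → Fin 2 → TF}
    (h : ∀ a i, HP (Good T (fun t => ∑ a, hs s (v a t)) (fun t => ∑ a, ∑ i, hs s (pd i (v a t)))) s (N a i)) :
    Good T (fun t => ∑ a, hs s (v a t)) (fun t => ∑ a, ∑ i, hs s (pd i (v a t))) (fun t => ∑ a, ∑ i, hs s (N a i t)) :=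
  Good.sum hT (fun t _ => sumX s v t) (fun t _ => sumY s v t) fun a _ =>
    Good.sum hT (fun t _ => sumX s v t) (fun t _ => sumY s v t) fun i _ => h a i

/-- linear case, componentwise formulation -/
theorem lin_close (hT : 0 < T) {v : ι → TF} {N : ι → Fin 2 → TF} (s : ℕ) (hv : ∀ a, Reg T (v a)) (hN : ∀ a i, Reg T (N a i))
    (heq : ∀ t ∈ Ioo 0 T, ∀ x a, dt (v a) t x = lap (v a t) x + ∑ i, pd i (N a i t) x)
    (hvB : ∀ a, HP (LB T) s (v a)) (hNB : ∀ a i, HP (LB T) s (N a i))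
    (h : ∀ a i, HP (Good T (fun t => ∑ a, hs s (v a t)) (fun t => ∑ a, ∑ i, hs s (pd i (v a t)))) s (N a i)) (a : ι) :
    HP (TB T) s (v a) ∧ HP (TI T) (s + 1) (v a) := by
  have := linear_close s hv hN heq hvB hNB (goodsum hT h)
  exact ⟨HP.of_sum (clsB T) this.1 a, HP.of_sum2 (clsI T) this.1.toTI this.2 a⟩

theorem b_close (c : Ctx T u b π m A) (s : ℕ) (hs' : max 3 s ≤ m)
    (hG : Good T (fun t => ∑ a, hs s (b a t)) (fun t => ∑ a, ∑ i, hs s (pd i (b a t))) (QQ HM b s b (NB u b))) (a : Fin 3) :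
    HP (TB T) s (b a) ∧ HP (TI T) (s + 1) (b a) := by
  have cl := clsL T
  have lb := fun a => (c.lb a).le cl hs'
  have hb : ∀ c', LB T (fun t => hs 2 (b c' t)) := fun c' => (c.lb c').le cl ((by norm_num : 2 ≤ 3).trans c.hm)
  have := adm_close (adm_HM c.sol.rb hb) s c.sol.rb (Reg.NB c.sol.ru c.sol.rb) c.sol.beq
    (fun a => (c.lb a).le cl ((le_max_right _ _).trans hs')) (LB_QQ c.sol (fun a => (c.lu a).le cl hs') lb) hG
  exact ⟨HP.of_sum (clsB T) this.1 a, HP.of_sum2 (clsI T) this.1.toTI this.2 a⟩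

theorem Ctx.w2 (c : Ctx T u b π m A) (k : Fin 2) : ∀ t ∈ Ioo 0 T, wb 2 (A t) (u k.castSucc t) := fun t ht => (c.wA t ht k).pred
theorem Ctx.w1 (c : Ctx T u b π m A) (k : Fin 2) : ∀ t ∈ Ioo 0 T, wb 1 (A t) (u k.castSucc t) := fun t ht => (c.wA t ht k).pred.pred
theorem Ctx.w21 (c : Ctx T u b π m A) (i j k : Fin 2) : ∀ t ∈ Ioo 0 T, wb 1 (A t) (D i (D j (u k.castSucc)) t) :=
  fun t ht => ((c.wA t ht k).2 j).2 i

theorem Ctx.z2 (c : Ctx T u b π m A) (a : Fin 3) : HP (LB T) 2 (zz u b a) :=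
  LB_zz c.sol (fun a => (c.lu a).le (clsL T) c.hm) (fun a => (c.lb a).le (clsL T) c.hm) a
theorem Ctx.u2 (c : Ctx T u b π m A) (a : Fin 3) : HP (LB T) 2 (u a) := (c.lu a).le (clsL T) ((by norm_num : 2 ≤ 3).trans c.hm)
theorem Ctx.b2 (c : Ctx T u b π m A) (a : Fin 3) : HP (LB T) 2 (b a) := (c.lb a).le (clsL T) ((by norm_num : 2 ≤ 3).trans c.hm)
theorem Ctx.rz (c : Ctx T u b π m A) (a : Fin 3) : Reg T (zz u b a) := Reg.zz c.sol.ru c.sol.rb a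

theorem Ctx.L0 (c : Ctx T u b π m A) :
    (∀ a, HP (TB T) 0 (u a) ∧ HP (TI T) 1 (u a)) ∧ (∀ a, HP (TB T) 0 (b a) ∧ HP (TI T) 1 (b a)) :=
  c.sol.L0 c.hT (fun a => (c.lu a).le (clsL T) c.hm) (fun a => (c.lb a).le (clsL T) c.hm)

theorem Ctx.Zh (c : Ctx T u b π m A) (a : Fin 2) : HP (TB T) 2 (zz u b a.castSucc) ∧ HP (TI T) 3 (zz u b a.castSucc) := by
  refine lin_close c.hT (v := fun a : Fin 2 => zz u b a.castSucc) (N := fun a i => NB u (zz u b) a.castSucc i) 2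
    (fun a => c.rz _) (fun a i => Reg.NB c.sol.ru c.rz _ i) (fun t ht x a => c.sol.zeq t ht x _) (fun a => c.z2 _)
    (fun a i => LB_NB le_rfl c.sol.ru c.rz c.u2 c.z2 _ i) (fun a i => ?_) a
  have hY := fun t (_ : t ∈ Ioo 0 T) => sumY 2 (fun a : Fin 2 => zz u b a.castSucc) t
  have ru := c.sol.ru
  refine HP.sub (clsG hY) ((c.rz _).mul (ru _)) ((ru _).mul (c.rz _)) ?_ ?_
  · rw [mul_comm]
    exact good_wb c.hA hY (ru _) (c.rz _) (c.w2 a) fun t _ => leX 2 (fun a : Fin 2 => zz u b a.castSucc) t i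
  · exact good_wb c.hA hY (ru _) (c.rz _) (c.w2 i) fun t _ => leX 2 (fun a : Fin 2 => zz u b a.castSucc) t a

theorem Ctx.U2 (c : Ctx T u b π m A) : HP (TB T) 1 (u 2) ∧ HP (TI T) 2 (u 2) := by
  have z0 := c.Zh 0
  have z1 := c.Zh 1
  exact ⟨u2_of (clsB T) c.sol (z0.1.le (clsB T) (by norm_num)) (z1.1.le (clsB T) (by norm_num)) (c.L0.2 0).1 (c.L0.2 1).1 (c.L0.1 2).1,
    u2_of (clsI T) c.sol (z0.2.le (clsI T) (by norm_num)) (z1.2.le (clsI T) (by norm_num)) (c.L0.2 0).2 (c.L0.2 1).2 (c.L0.1 2).1.B_I⟩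

theorem Ctx.Z3 (c : Ctx T u b π m A) : HP (TB T) 2 (zz u b 2) ∧ HP (TI T) 3 (zz u b 2) := by
  refine lin_close c.hT (v := fun _ : Unit => zz u b 2) (N := fun _ i => NB u (zz u b) 2 i) 2
    (fun a => c.rz _) (fun a i => Reg.NB c.sol.ru c.rz _ i) (fun t ht x a => c.sol.zeq t ht x _) (fun a => c.z2 _)
    (fun a i => LB_NB le_rfl c.sol.ru c.rz c.u2 c.z2 _ i) (fun a i => ?_) ()
  have hX := fun t (_ : t ∈ Ioo 0 T) => sumX 2 (fun _ : Unit => zz u b 2) t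
  have hY := fun t (_ : t ∈ Ioo 0 T) => sumY 2 (fun _ : Unit => zz u b 2) t
  have ru := c.sol.ru
  refine HP.sub (clsG hY) ((c.rz _).mul (ru _)) ((ru _).mul (c.rz _)) ?_ ?_
  · exact good_TI hX hY (HP.mulI Pr222 (c.rz _) (ru 2) (c.Zh i).1 c.U2.2)
  · exact good_wb c.hA hY (ru _) (c.rz _) (c.w2 i) fun t _ => leX 2 (fun _ : Unit => zz u b 2) t ()

theorem Ctx.Db2 (c : Ctx T u b π m A) (k : Fin 2) : D k (b 2) = D k (zz u b 2) - (D k (D 0 (u 1)) - D k (D 1 (u 0))) := by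
  have ru := c.sol.ru
  rw [zz2, D_add (c.sol.rb 2) (((ru 1).D 0).sub ((ru 0).D 1)), D_sub ((ru 1).D 0) ((ru 0).D 1)]
  ring

theorem wb.weak {s : ℕ} (h1 : s ≤ 1) {A : ℝ} {f : E2 → ℝ} (h : wb 1 A f) : wb s A f := by
  interval_cases s
  · exact h.pred
  · exact h

/-- products with `D k (b 2)` -/
theorem Ctx.good_Db2 (c : Ctx T u b π m A) {X Y : ℝ → ℝ} (hY : ∀ t ∈ Ioo 0 T, 0 ≤ Y t) {s : ℕ} (h1 : s ≤ 1) (hp : Pr s 2 s)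
    {g : TF} (rg : Reg T g) (hg : ∀ t ∈ Ioo 0 T, hs s (g t) ≤ X t) (k : Fin 2) : HP (Good T X Y) s (D k (b 2) * g) := by
  have ru := c.sol.ru
  have r1 := ((ru 1).D 0).D k
  have r0 := ((ru 0).D 1).D k
  rw [c.Db2 k, sub_mul, sub_mul]
  refine HP.sub (clsG hY) (((c.rz 2).D k).mul rg) ((r1.mul rg).sub (r0.mul rg)) ?_ (HP.sub (clsG hY) (r1.mul rg) (r0.mul rg) ?_ ?_)
  · exact good_pr hp hY ((c.rz 2).D k) rg (c.Z3.2.D (clsI T) k) hg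
  · exact good_wb c.hA hY r1 rg (fun t ht => (c.w21 k 0 1 t ht).weak h1) hg
  · exact good_wb c.hA hY r0 rg (fun t ht => (c.w21 k 1 0 t ht).weak h1) hg

theorem Ctx.LB_HM (c : Ctx T u b π m A) (a : Fin 3) (i : Fin 2) : HP (LB T) 2 (HM b b a i) := by
  have l := clsL T
  have rb := c.sol.rb
  obtain ⟨j0, j1, j2⟩ := LB_J rb (fun a => (c.lb a).le l c.hm)
  have mm : ∀ {f : TF} (a : Fin 3), Reg T f → HP (LB T) 2 f → HP (LB T) 2 (f * b a) := fun a rf h => HP.mulL le_rfl rf (rb a) h (c.b2 a)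
  have r0 := Reg.J0 rb
  have r1 := Reg.J1 rb
  have r2 := Reg.J2 rb
  refine HM_cases (P := fun f => HP (LB T) 2 f) ?_ (fun f h => h.neg l) ?_ ?_ ?_ a i
  · exact LB.zero.mono fun t _ => (hs_zero_fun 2).le
  · exact HP.sub l (r1.mul (rb 2)) (r2.mul (rb 1)) (mm 2 r1 j1) (mm 1 r2 j2)
  · exact HP.sub l (r2.mul (rb 0)) (r0.mul (rb 2)) (mm 0 r2 j2) (mm 2 r0 j0)
  · exact HP.sub l (r0.mul (rb 1)) (r1.mul (rb 0)) (mm 1 r0 j0) (mm 0 r1 j1)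

theorem Ctx.BH1 (c : Ctx T u b π m A) (a : Fin 2) : HP (TB T) 1 (b a.castSucc) ∧ HP (TI T) 2 (b a.castSucc) := by
  have ru := c.sol.ru
  have rb := c.sol.rb
  have rN := Reg.NB ru rb
  have rH := Reg.HM rb rb
  refine lin_close c.hT (v := fun a : Fin 2 => b a.castSucc) (N := fun a i => NB u b a.castSucc i + HM b b a.castSucc i) 1
    (fun a => rb _) (fun a i => (rN _ i).add (rH _ i)) (fun t ht x a => c.sol.beq t ht x _) (fun a => (c.b2 _).le (clsL T) (by norm_num))
    (fun a i => (HP.add (clsL T) (rN _ i) (rH _ i) (LB_NB le_rfl ru rb c.u2 c.b2 _ i) (c.LB_HM _ i)).le (clsL T) (by norm_num)) (fun a i => ?_) a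
  have hX := fun t (_ : t ∈ Ioo 0 T) => sumX 1 (fun a : Fin 2 => b a.castSucc) t
  have hY := fun t (_ : t ∈ Ioo 0 T) => sumY 1 (fun a : Fin 2 => b a.castSucc) t
  have cG := clsG (X := fun t => ∑ a : Fin 2, hs 1 (b a.castSucc t)) hY
  have hl := fun (a : Fin 2) t (_ : t ∈ Ioo 0 T) => leX 1 (fun a : Fin 2 => b a.castSucc) t a
  refine HP.add cG (rN _ i) (rH _ i) (HP.sub cG ((rb _).mul (ru _)) ((ru _).mul (rb _)) ?_ ?_) ?_
  · rw [mul_comm]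
    exact good_wb c.hA hY (ru _) (rb _) (c.w1 a) (hl i)
  · exact good_wb c.hA hY (ru _) (rb _) (c.w1 i) (hl a)
  · have g1 := c.good_Db2 hY le_rfl Pr121 (rb 1) (hl 1) 1
    have g0 := c.good_Db2 hY le_rfl Pr121 (rb 0) (hl 0) 0
    have e2 : HP (Good T (fun t => ∑ a : Fin 2, hs 1 (b a.castSucc t)) (fun t => ∑ a : Fin 2, ∑ i, hs 1 (pd i (b a.castSucc t)))) 1 (Ef2 b b) := by
      have : Ef2 b b = D 1 (b 2) * b 1 + D 0 (b 2) * b 0 := by unfold Ef2 J0 J1; ring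
      rw [this]
      exact HP.add cG (((rb 2).D 1).mul (rb 1)) (((rb 2).D 0).mul (rb 0)) g1 g0
    have z : HP (Good T (fun t => ∑ a : Fin 2, hs 1 (b a.castSucc t)) (fun t => ∑ a : Fin 2, ∑ i, hs 1 (pd i (b a.castSucc t)))) 1 (0 : TF) :=
      cG.mono e2 fun t _ => (hs_zero_fun 1).le.trans (hs_nonneg _ _)
    fin_cases a <;> fin_cases i
    · exact z
    · exact e2.neg cG
    · exact e2
    · exact z

end
end

end Part14

section Part15
open MeasureTheory Set Filter Topology
open scoped ENNReal ContDiff SchwartzMap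

noncomputable section

section
variable {T : ℝ} {u b : Fin 3 → TF} {π : TF} {m : ℕ} {A : ℝ → ℝ}

theorem Ctx.BH1' (c : Ctx T u b π m A) (a : Fin 3) (ha : a ≠ 2) : HP (TB T) 1 (b a) ∧ HP (TI T) 2 (b a) := by
  fin_cases a
  · exact c.BH1 0
  · exact c.BH1 1
  · exact absurd rfl ha

theorem four_sqrt {p q r s : ℝ} (hp : 0 ≤ p) (hq : 0 ≤ q) (hr : 0 ≤ r) (hs : 0 ≤ s) :
    4 * (√p * √q * (√r * √s)) ≤ 2 * (p * q) + 2 * (r * s) := by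
  have a := Real.mul_self_sqrt hp
  have b := Real.mul_self_sqrt hq
  have c := Real.mul_self_sqrt hr
  have d := Real.mul_self_sqrt hs
  have e1 : p * q = (√p * √q) ^ 2 := by rw [mul_pow, Real.sq_sqrt hp, Real.sq_sqrt hq]
  have e2 : r * s = (√r * √s) ^ 2 := by rw [mul_pow, Real.sq_sqrt hr, Real.sq_sqrt hs]
  rw [e1, e2]
  nlinarith [sq_nonneg (√p * √q - √r * √s)]

theorem Ctx.good_NB (c : Ctx T u b π m A) {X Y : ℝ → ℝ} (hY : ∀ t ∈ Ioo 0 T, 0 ≤ Y t) {s : ℕ} (h1 : s ≤ 2)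
    (hl : ∀ a, ∀ t ∈ Ioo 0 T, hs s (b a t) ≤ X t) (h2 : ∀ i : Fin 2, HP (Good T X Y) s (b i.castSucc * u 2)) (a : Fin 3) (i : Fin 2) :
    HP (Good T X Y) s (NB u b a i) := by
  have ru := c.sol.ru
  have rb := c.sol.rb
  have w : ∀ k : Fin 2, ∀ t ∈ Ioo 0 T, wb s (A t) (u k.castSucc t) := by
    intro k t ht
    have := c.w2 k t ht
    interval_cases s
    · exact this.pred.pred
    · exact this.pred
    · exact this
  refine HP.sub (clsG hY) ((rb _).mul (ru _)) ((ru _).mul (rb _)) ?_ (good_wb c.hA hY (ru _) (rb _) (w i) (hl a))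
  fin_cases a
  · rw [mul_comm]; exact good_wb c.hA hY (ru _) (rb _) (w 0) (hl _)
  · rw [mul_comm]; exact good_wb c.hA hY (ru _) (rb _) (w 1) (hl _)
  · exact h2 i

theorem Ctx.B1 (c : Ctx T u b π m A) (a : Fin 3) : HP (TB T) 1 (b a) ∧ HP (TI T) 2 (b a) := by
  have ru := c.sol.ru
  have rb := c.sol.rb
  have rN := Reg.NB ru rb
  have hX := fun t (_ : t ∈ Ioo 0 T) => sumX 1 b t
  have hY := fun t (_ : t ∈ Ioo 0 T) => sumY 1 b t
  have hl := fun (a : Fin 3) t (_ : t ∈ Ioo 0 T) => leX 1 b t a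
  refine b_close c 1 (by simpa using c.hm) ?_ a
  have gN := goodsum c.hT (s := 1) (v := b) (c.good_NB hY (by norm_num) hl fun i => good_TI hX hY (by
    rw [mul_comm]; exact HP.mulI Pr112 (ru 2) (rb _) c.U2.1 (c.BH1 i).2))
  let F : Fin 2 → Fin 2 → Fin 3 → Fin 3 → ℝ → ℝ := fun k i a d t => if d = 2 → a = 2 then nn (D i (b a) t * D k (b d) t) else 0
  have gF : ∀ k i a d, Good T (fun t => ∑ a, hs 1 (b a t)) (fun t => ∑ a, ∑ i, hs 1 (pd i (b a t))) (F k i a d) := by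
    intro k i a d
    by_cases h : d = 2 → a = 2
    · simp only [F, if_pos h]
      by_cases ha : a = 2
      · subst ha
        exact c.good_Db2 (s := 0) hY (by norm_num) Pr020 ((rb d).D k) (fun t ht => (hs_pd_le 0 _ k).trans (hl d t ht)) i
      · have hd : d ≠ 2 := fun e => ha (h e)
        have q := fun (a : Fin 3) ha => TB.mulTI (c.BH1' a ha).1 (fun t _ => hs_nonneg _ _) (c.BH1' a ha).2
        refine Good.of_TI (((q a ha).const_mul zero_le_two).add ((q d hd).const_mul zero_le_two) |>.mono fun t _ => ?_) hX hY fun t _ => nn_nonneg _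
        refine (nn_mul_bd (((rb a).D i).sch t) (((rb d).D k).sch t) (hs_pd_le 0 (b a t) i)
          ((hs_pd_le 0 _ 0).trans (hs_pd_le 1 (b a t) i)) (hs_pd_le 0 (b d t) k)
          ((hs_pd_le 0 _ 1).trans (hs_pd_le 1 (b d t) k))).trans ?_
        exact four_sqrt (hs_nonneg _ _) (hs_nonneg _ _) (hs_nonneg _ _) (hs_nonneg _ _)
    · simp only [F, if_neg h]
      exact Good.of_TI (TB.toTI ⟨T / 2, ⟨by linarith [c.hT], by linarith [c.hT]⟩, 0, le_rfl, fun t _ => le_rfl⟩) hX hY (fun _ _ => le_rfl)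
  have F0 : ∀ k i a d t, 0 ≤ F k i a d t := by
    intro k i a d t
    simp only [F]; split_ifs
    · exact nn_nonneg _
    · exact le_rfl
  have gW : Good T (fun t => ∑ a, hs 1 (b a t)) (fun t => ∑ a, ∑ i, hs 1 (pd i (b a t))) (fun t => ∑ k, ∑ i, ∑ a, ∑ d, F k i a d t) :=
    Good.sum c.hT hX hY fun k _ => Good.sum c.hT hX hY fun i _ => Good.sum c.hT hX hY fun a _ => Good.sum c.hT hX hY fun d _ => gF k i a d
  have cG := clsG (X := fun t => ∑ a, hs 1 (b a t)) hY
  refine cG.mono (cG.add (cG.cmul zero_le_two gN) (cG.cmul (c := 160) (by norm_num) gW)) fun t _ => ?_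
  have := QQ1_le rb rb rN t (W := 40 * ∑ k, ∑ i, ∑ a, ∑ d, F k i a d t) (fun k => ?_)
  · linarith
  · refine HM_gen 0 rb (Reg.DF rb k) t fun i a d h => ?_
    have e : F k i a d t = nn (D i (b a) t * D k (b d) t) := if_pos h
    refine e.ge.trans ?_
    refine (single_le (f := fun d => F k i a d t) (fun d => F0 _ _ _ _ _) d).trans ?_
    refine (single_le (f := fun a => ∑ d, F k i a d t) (fun a => Finset.sum_nonneg fun d _ => F0 _ _ _ _ _) a).trans ?_
    refine (single_le (f := fun i => ∑ a, ∑ d, F k i a d t) (fun i => Finset.sum_nonneg fun a _ => Finset.sum_nonneg fun d _ => F0 _ _ _ _ _) i).trans ?_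
    exact (single_le (f := fun k => ∑ i, ∑ a, ∑ d, F k i a d t) (fun k => Finset.sum_nonneg fun i _ => Finset.sum_nonneg fun a _ => Finset.sum_nonneg fun d _ => F0 _ _ _ _ _) k)

theorem sqrt4 {p q r ε : ℝ} (hp : 0 ≤ p) (hq : 0 ≤ q) (hr : 0 ≤ r) (hε : 0 < ε) :
    4 * (√p * √q * (√q * √r)) ≤ ε * r + 4 / ε * (p * q) * q := by
  have e : √p * √q * (√q * √r) = q * (√p * √r) := by
    have := Real.mul_self_sqrt hq
    calc √p * √q * (√q * √r) = (√q * √q) * (√p * √r) := by ring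
      _ = _ := by rw [this]
  rw [e]
  have hP := Real.sq_sqrt hp
  have hR := Real.sq_sqrt hr
  have : ε * r + 4 / ε * (p * q) * q - 4 * (q * (√p * √r)) = (ε * √r - 2 * q * √p) ^ 2 / ε := by
    rw [show ε * r + 4 / ε * (p * q) * q = ε * √r ^ 2 + 4 / ε * (√p ^ 2 * q) * q by rw [hP, hR]]
    field_simp
    ring
  have h2 : 0 ≤ (ε * √r - 2 * q * √p) ^ 2 / ε := by positivity
  linarith

theorem Ctx.B2 (c : Ctx T u b π m A) (a : Fin 3) : HP (TB T) 2 (b a) ∧ HP (TI T) 3 (b a) := by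
  have ru := c.sol.ru
  have rb := c.sol.rb
  have rN := Reg.NB ru rb
  have hX := fun t (_ : t ∈ Ioo 0 T) => sumX 2 b t
  have hY := fun t (_ : t ∈ Ioo 0 T) => sumY 2 b t
  have hl := fun (a : Fin 3) t (_ : t ∈ Ioo 0 T) => leX 2 b t a
  refine b_close c 2 (by simpa using c.hm) ?_ a
  have gN := goodsum c.hT (s := 2) (v := b) (c.good_NB hY le_rfl hl fun i => by
    rw [mul_comm]; exact good_pr Pr222 hY (ru 2) (rb _) c.U2.2 (hl _))
  have t1 : TB T (fun t => ∑ a, hs 1 (b a t)) := TB.sum c.hT fun a _ => (c.B1 a).1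
  have t2 : TI T (fun t => ∑ a, hs 2 (b a t)) := TI.sum c.hT fun a _ => (c.B1 a).2
  let W : ℝ → ℝ := fun t => 4 * (√(∑ a, hs 1 (b a t)) * √(∑ a, hs 2 (b a t)) * (√(∑ a, hs 2 (b a t)) * √(∑ a, hs 3 (b a t))))
  have x3 : ∀ t, ∑ a, hs 3 (b a t) ≤ ∑ a, hs 2 (b a t) + ∑ a, ∑ i, hs 2 (pd i (b a t)) := by
    intro t
    rw [← Finset.sum_add_distrib]
    refine Finset.sum_le_sum fun a _ => ?_
    rw [hs_succ, Fin.sum_univ_two]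
    have := nn_le_hs 2 (b a t)
    linarith
  have gW : Good T (fun t => ∑ a, hs 2 (b a t)) (fun t => ∑ a, ∑ i, hs 2 (pd i (b a t))) W := by
    intro ε hε
    have tc : TI T (fun _ => ε) := TB.toTI ⟨T / 2, ⟨by linarith [c.hT], by linarith [c.hT]⟩, ε, hε.le, fun t _ => le_rfl⟩
    refine ⟨_, tc.add ((TB.mulTI t1 (fun t _ => sumX 1 b t) t2).const_mul (c := 4 / ε) (by positivity)), fun t ht => ?_⟩
    have q := sqrt4 (sumX 1 b t) (sumX 2 b t) (sumX 3 b t) hε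
    have q2 := mul_le_mul_of_nonneg_left (x3 t) hε.le
    have q3 : 0 ≤ 4 / ε * ((∑ a, hs 1 (b a t)) * ∑ a, hs 2 (b a t)) :=
      mul_nonneg (by positivity) (mul_nonneg (sumX 1 b t) (sumX 2 b t))
    change 4 * _ ≤ _
    refine q.trans ?_
    nlinarith
  have cG := clsG (X := fun t => ∑ a, hs 2 (b a t)) hY
  refine cG.mono (cG.add (cG.cmul (c := 4) (by norm_num) gN) (cG.cmul (c := 4000) (by norm_num) gW)) fun t _ => ?_
  have m12 : ∑ a, hs 1 (b a t) ≤ ∑ a, hs 2 (b a t) := Finset.sum_le_sum fun a _ => hs_mono (by norm_num) _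
  have m23 : ∑ a, hs 2 (b a t) ≤ ∑ a, hs 3 (b a t) := Finset.sum_le_sum fun a _ => hs_mono (by norm_num) _
  have l1 := fun a => leX 1 b t a
  have l2 := fun a => leX 2 b t a
  have l3 := fun a => leX 3 b t a
  have d1 : ∀ a i, nn (D i (b a) t) ≤ ∑ a, hs 1 (b a t) := fun a i => (hs_pd_le 0 (b a t) i).trans (l1 a)
  have d2 : ∀ a i k, nn (D k (D i (b a)) t) ≤ ∑ a, hs 2 (b a t) := fun a i k =>
    ((hs_pd_le 0 (D i (b a) t) k).trans (hs_pd_le 1 (b a t) i)).trans (l2 a)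
  have d3 : ∀ a i k l, nn (D l (D k (D i (b a))) t) ≤ ∑ a, hs 3 (b a t) := fun a i k l =>
    ((hs_pd_le 0 (D k (D i (b a)) t) l).trans ((hs_pd_le 1 (D i (b a) t) k).trans (hs_pd_le 2 (b a t) i))).trans (l3 a)
  have := QQ2_le rb rb rN t (W := 40 * W t) (fun k => ?_) (fun k l => ?_) (fun k l => ?_)
  · linarith
  · refine HM_gen 0 rb (Reg.DF rb k) t fun i a d _ => ?_
    exact nn_mul_bd (((rb a).D i).sch t) (((rb d).D k).sch t) (d1 a i) (d2 a i 0) ((d1 d k).trans m12) ((d2 d k 1).trans m23)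
  · refine HM_gen 0 (Reg.DF rb k) (Reg.DF rb l) t fun i a d _ => ?_
    refine (nn_mul_bd ((((rb a).D k).D i).sch t) (((rb d).D l).sch t) (d2 a k i) (d3 a k i 0) (d1 d l) (d2 d l 1)).trans (le_of_eq ?_)
    simp only [W]; ring
  · refine HM_gen 0 rb (Reg.DF (Reg.DF rb l) k) t fun i a d _ => ?_
    exact nn_mul_bd (((rb a).D i).sch t) ((((rb d).D l).D k).sch t) (d1 a i) (d2 a i 0) (d2 d l k) (d3 d l k 1)

/-- the induction statement -/
structure SS (T : ℝ) (u b : Fin 3 → TF) (s : ℕ) : Prop where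
  bB : ∀ a, HP (TB T) s (b a)
  bI : ∀ a, HP (TI T) (s + 1) (b a)
  zB : ∀ a, HP (TB T) s (zz u b a)
  zI : ∀ a, HP (TI T) (s + 1) (zz u b a)

theorem Ctx.S2 (c : Ctx T u b π m A) : SS T u b 2 := by
  refine ⟨fun a => (c.B2 a).1, fun a => (c.B2 a).2, fun a => ?_, fun a => ?_⟩
  · fin_cases a
    exacts [(c.Zh 0).1, (c.Zh 1).1, c.Z3.1]
  · fin_cases a
    exacts [(c.Zh 0).2, (c.Zh 1).2, c.Z3.2]

theorem SS.uu {s : ℕ} (h : SS T u b s) (c : Ctx T u b π m A) (a : Fin 3) : HP (TB T) (s + 1) (u a) ∧ HP (TI T) (s + 2) (u a) := by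
  have l := fun a => (c.L0.1 a).1
  have h1 := uh_of (clsB T) c.sol (h.zB 2) (h.bB 2) (l 0) (l 1)
  have h2 := uh_of (clsI T) c.sol (h.zI 2) (h.bI 2) (l 0).B_I (l 1).B_I
  fin_cases a
  · exact ⟨h1.1, h2.1⟩
  · exact ⟨h1.2, h2.2⟩
  · exact ⟨u2_of (clsB T) c.sol (h.zB 0) (h.zB 1) (h.bB 0) (h.bB 1) (l 2), u2_of (clsI T) c.sol (h.zI 0) (h.zI 1) (h.bI 0) (h.bI 1) (l 2).B_I⟩

theorem SS.good_NB {s : ℕ} (h : SS T u b s) (c : Ctx T u b π m A) (h2 : 2 ≤ s) {X Y : ℝ → ℝ} (hY : ∀ t ∈ Ioo 0 T, 0 ≤ Y t)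
    {v : Fin 3 → TF} (rv : ∀ a, Reg T (v a)) (hl : ∀ a, ∀ t ∈ Ioo 0 T, hs (s + 1) (v a t) ≤ X t) (a : Fin 3) (i : Fin 2) :
    HP (Good T X Y) (s + 1) (NB u v a i) := by
  have ru := c.sol.ru
  have hp : Pr (s + 1) (s + 1) (s + 1) := Prsss (by omega)
  have hu := fun a => ((h.uu c a).2).le (clsI T) (Nat.le_succ (s + 1))
  refine HP.sub (clsG hY) ((rv _).mul (ru _)) ((ru _).mul (rv _)) ?_ (good_pr hp hY (ru _) (rv _) (hu _) (hl a))
  rw [mul_comm]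
  exact good_pr hp hY (ru _) (rv _) (hu _) (hl _)

theorem SS.bstep {s : ℕ} (h : SS T u b s) (c : Ctx T u b π m A) (h2 : 2 ≤ s) (hm : s + 1 ≤ m) (a : Fin 3) :
    HP (TB T) (s + 1) (b a) ∧ HP (TI T) (s + 1 + 1) (b a) := by
  have rb := c.sol.rb
  have hY := fun t (_ : t ∈ Ioo 0 T) => sumY (s + 1) b t
  have hl := fun (a : Fin 3) t (_ : t ∈ Ioo 0 T) => leX (s + 1) b t a
  have e3 : max 3 (s + 1) = s + 1 := by omega
  refine b_close c (s + 1) (by omega) ?_ a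
  obtain ⟨C, hC, hq⟩ := hQ_bound rb (s + 1)
  rw [e3] at hq
  have gN := goodsum c.hT (s := s + 1) (v := b) (h.good_NB c h2 hY rb hl)
  have t2 : TI T (fun t => ∑ a, hs (s + 1) (b a t)) := TI.sum c.hT fun a _ => h.bI a
  have cG := clsG (X := fun t => ∑ a, hs (s + 1) (b a t)) hY
  exact cG.mono (cG.cmul hC (cG.add gN (Good.of_mul t2 hY fun t _ => sumX (s + 1) b t))) fun t _ => hq _ _ rb (Reg.NB c.sol.ru rb) t

theorem SS.zstep {s : ℕ} (h : SS T u b s) (c : Ctx T u b π m A) (h2 : 2 ≤ s) (hm : s + 2 ≤ m) (a : Fin 3) :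
    HP (TB T) (s + 1) (zz u b a) ∧ HP (TI T) (s + 1 + 1) (zz u b a) := by
  have ru := c.sol.ru
  have hY := fun t (_ : t ∈ Ioo 0 T) => sumY (s + 1) (zz u b) t
  have hl := fun (a : Fin 3) t (_ : t ∈ Ioo 0 T) => leX (s + 1) (zz u b) t a
  have lz : ∀ a, HP (LB T) (s + 1) (zz u b a) := LB_zz c.sol (fun a => (c.lu a).le (clsL T) hm) (fun a => (c.lb a).le (clsL T) hm)
  exact lin_close c.hT (v := zz u b) (N := NB u (zz u b)) (s + 1) c.rz (Reg.NB ru c.rz) (fun t ht x a => c.sol.zeq t ht x a) lz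
    (LB_NB (by omega) ru c.rz (fun a => (c.lu a).le (clsL T) (by omega)) lz) (h.good_NB c h2 hY c.rz hl) a

theorem Ctx.Sall (c : Ctx T u b π m A) {s : ℕ} (h2 : 2 ≤ s) : s + 1 ≤ m → SS T u b s := by
  induction h2 with
  | refl => intro _; exact c.S2
  | step h2 ih =>
    intro hm
    have h := ih (by omega)
    exact ⟨fun a => (h.bstep c h2 (by omega) a).1, fun a => (h.bstep c h2 (by omega) a).2,
      fun a => (h.zstep c h2 hm a).1, fun a => (h.zstep c h2 hm a).2⟩

theorem Ctx.final (c : Ctx T u b π m A) : (∀ a, HP (TB T) m (u a)) ∧ (∀ a, HP (TB T) m (b a)) := by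
  obtain ⟨s, rfl⟩ : ∃ s, m = s + 1 := ⟨m - 1, by have := c.hm; omega⟩
  have h2 : 2 ≤ s := by have := c.hm; omega
  have h := c.Sall h2 le_rfl
  exact ⟨fun a => (h.uu c a).1, fun a => (h.bstep c h2 le_rfl a).1⟩

end
end

end Part15

section Part16
open MeasureTheory Set Filter Topology
open scoped ENNReal ContDiff SchwartzMap

noncomputable section

/-! ### comparison of Sobolev norms -/

/-- squared `L²` norm of the `k`-th derivative -/
def dn {F : Type*} [NormedAddCommGroup F] [NormedSpace ℝ F] (k : ℕ) (f : E2 → F) : ℝ :=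
  ∫ x, ‖iteratedFDeriv ℝ k f x‖ ^ 2

section
variable {F : Type*} [NormedAddCommGroup F] [NormedSpace ℝ F]

theorem dn_nonneg (k : ℕ) (f : E2 → F) : 0 ≤ dn k f := integral_nonneg fun _ => sq_nonneg _

theorem dn_int {f : E2 → F} (h : IsSchwartz f) (k : ℕ) :
    Integrable (fun x => ‖iteratedFDeriv ℝ k f x‖ ^ 2) := by
  let g : 𝓢(E2, F) := ⟨f, h.1, h.2⟩
  have h1 : Integrable (fun x => ‖x‖ ^ 0 * ‖iteratedFDeriv ℝ k (g : E2 → F) x‖) :=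
    g.integrable_pow_mul_iteratedFDeriv volume 0 k
  obtain ⟨C, hC⟩ := h.2 0 k
  have hc : Continuous (fun x => ‖iteratedFDeriv ℝ k f x‖ ^ 2) :=
    ((h.1.continuous_iteratedFDeriv (by exact_mod_cast le_top)).norm).pow 2
  refine (h1.const_mul C).mono' hc.aestronglyMeasurable (Eventually.of_forall fun x => ?_)
  have e : iteratedFDeriv ℝ k (g : E2 → F) x = iteratedFDeriv ℝ k f x := rfl
  have := hC x
  simp only [pow_zero, one_mul] at this ⊢
  rw [e, Real.norm_of_nonneg (sq_nonneg _), sq]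
  exact mul_le_mul_of_nonneg_right this (norm_nonneg _)

theorem dn_mono {G : Type*} [NormedAddCommGroup G] [NormedSpace ℝ G] {f : E2 → F} {g : E2 → G} {k l : ℕ}
    (hf : IsSchwartz f) (hg : IsSchwartz g)
    (h : ∀ x, ‖iteratedFDeriv ℝ k f x‖ ≤ ‖iteratedFDeriv ℝ l g x‖) : dn k f ≤ dn l g :=
  integral_mono (dn_int hf k) (dn_int hg l) fun x => by
    have := h x
    show ‖iteratedFDeriv ℝ k f x‖ ^ 2 ≤ ‖iteratedFDeriv ℝ l g x‖ ^ 2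
    gcongr

end

theorem iter_pd_le {f : E2 → ℝ} (hf : Sch f) (k : ℕ) (i : Fin 2) (x : E2) :
    ‖iteratedFDeriv ℝ k (pd i f) x‖ ≤ ‖iteratedFDeriv ℝ (k + 1) f x‖ := by
  rw [← norm_iteratedFDeriv_fderiv]
  have e : pd i f = (ContinuousLinearMap.apply ℝ ℝ (Pi.single i 1 : E2)) ∘ fderiv ℝ f := rfl
  have hd : ContDiff ℝ ∞ (fderiv ℝ f) := hf.contDiff.fderiv_right (by simp)
  rw [e]
  refine (ContinuousLinearMap.norm_iteratedFDeriv_comp_left _ (hd.contDiffAt (x := x)) (by exact_mod_cast le_top)).trans ?_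
  have : ‖ContinuousLinearMap.apply ℝ ℝ (Pi.single i 1 : E2)‖ ≤ 1 := by
    refine ContinuousLinearMap.opNorm_le_bound _ zero_le_one fun L => ?_
    have := L.le_opNorm (Pi.single i 1 : E2)
    rw [Pi.norm_single] at this
    simpa using this
  exact mul_le_of_le_one_left (norm_nonneg _) this

theorem iter_succ_le {f : E2 → ℝ} (hf : Sch f) (k : ℕ) (x : E2) :
    ‖iteratedFDeriv ℝ (k + 1) f x‖ ≤ ‖iteratedFDeriv ℝ k (pd 0 f) x‖ + ‖iteratedFDeriv ℝ k (pd 1 f) x‖ := by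
  rw [← norm_iteratedFDeriv_fderiv]
  have hd : ContDiff ℝ ∞ (fderiv ℝ f) := hf.contDiff.fderiv_right (by simp)
  have e : ∀ i (v : Fin k → E2), iteratedFDeriv ℝ k (pd i f) x v = iteratedFDeriv ℝ k (fderiv ℝ f) x v (Pi.single i 1) := by
    intro i v
    have := (ContinuousLinearMap.apply ℝ ℝ (Pi.single i 1 : E2)).iteratedFDeriv_comp_left (hd.contDiffAt (x := x)) (i := k) (by exact_mod_cast le_top)
    have e' : pd i f = (ContinuousLinearMap.apply ℝ ℝ (Pi.single i 1 : E2)) ∘ fderiv ℝ f := rfl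
    rw [e', this]
    rfl
  refine ContinuousMultilinearMap.opNorm_le_bound (by positivity) fun v => ?_
  have hp : 0 ≤ ∏ i, ‖v i‖ := Finset.prod_nonneg fun _ _ => norm_nonneg _
  refine ContinuousLinearMap.opNorm_le_bound _ (by positivity) fun w => ?_
  have hw : w = w 0 • (Pi.single 0 1 : E2) + w 1 • (Pi.single 1 1 : E2) := by
    ext j; fin_cases j <;> simp
  set L := iteratedFDeriv ℝ k (fderiv ℝ f) x v with hL
  have h0 := (iteratedFDeriv ℝ k (pd 0 f) x).le_opNorm v
  have h1 := (iteratedFDeriv ℝ k (pd 1 f) x).le_opNorm v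
  rw [e] at h0 h1
  have w0 := norm_le_pi_norm w 0
  have w1 := norm_le_pi_norm w 1
  calc ‖L w‖ = ‖w 0 * L (Pi.single 0 1) + w 1 * L (Pi.single 1 1)‖ := by
        conv_lhs => rw [hw]
        simp only [map_add, map_smul, smul_eq_mul]
    _ ≤ ‖w 0‖ * ‖L (Pi.single 0 1)‖ + ‖w 1‖ * ‖L (Pi.single 1 1)‖ := by
        rw [← norm_mul, ← norm_mul]; exact norm_add_le _ _
    _ ≤ ‖w‖ * (‖iteratedFDeriv ℝ k (pd 0 f) x‖ * ∏ i, ‖v i‖) + ‖w‖ * (‖iteratedFDeriv ℝ k (pd 1 f) x‖ * ∏ i, ‖v i‖) := by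
        gcongr
    _ = _ := by ring

theorem dn_zero (f : E2 → ℝ) : dn 0 f = nn f := by
  simp only [dn, nn, norm_iteratedFDeriv_zero, Real.norm_eq_abs, sq_abs]

theorem dn_pd {f : E2 → ℝ} (hf : Sch f) (k : ℕ) (i : Fin 2) : dn k (pd i f) ≤ dn (k + 1) f :=
  dn_mono (hf.pd i) hf (iter_pd_le hf k i)

theorem dn_succ {f : E2 → ℝ} (hf : Sch f) (k : ℕ) : dn (k + 1) f ≤ 2 * (dn k (pd 0 f) + dn k (pd 1 f)) := by
  have i0 := dn_int (hf.pd 0) k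
  have i1 := dn_int (hf.pd 1) k
  have : dn (k + 1) f ≤ ∫ x, 2 * (‖iteratedFDeriv ℝ k (pd 0 f) x‖ ^ 2 + ‖iteratedFDeriv ℝ k (pd 1 f) x‖ ^ 2) := by
    refine integral_mono (dn_int hf (k + 1)) ((i0.add i1).const_mul 2) fun x => ?_
    have h := iter_succ_le hf k x
    have h0 := norm_nonneg (iteratedFDeriv ℝ (k + 1) f x)
    show ‖iteratedFDeriv ℝ (k + 1) f x‖ ^ 2 ≤ _
    nlinarith [sq_nonneg (‖iteratedFDeriv ℝ k (pd 0 f) x‖ - ‖iteratedFDeriv ℝ k (pd 1 f) x‖)]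
  rw [integral_const_mul, integral_add i0 i1] at this
  exact this

theorem dn_le_hs (k : ℕ) : ∀ {f : E2 → ℝ}, Sch f → dn k f ≤ 2 ^ k * hs k f := by
  induction k with
  | zero => intro f hf; simp [dn_zero, hs_zero_eq]
  | succ k ih =>
    intro f hf
    have h := dn_succ hf k
    have h0 := ih (hf.pd 0)
    have h1 := ih (hf.pd 1)
    rw [hs_succ, pow_succ]
    have := mul_nonneg (pow_nonneg (zero_le_two (α := ℝ)) k) (nn_nonneg f)
    nlinarith

theorem hs_le_dn (m : ℕ) : ∀ {f : E2 → ℝ}, Sch f → hs m f ≤ 3 ^ m * ∑ k ∈ Finset.range (m + 1), dn k f := by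
  induction m with
  | zero => intro f hf; simp [dn_zero, hs_zero_eq]
  | succ m ih =>
    intro f hf
    have hs' : ∀ i, ∑ k ∈ Finset.range (m + 1), dn k (pd i f) ≤ ∑ k ∈ Finset.range (m + 1), dn (k + 1) f := fun i =>
      Finset.sum_le_sum fun k _ => dn_pd hf k i
    have h0 := ih (hf.pd 0)
    have h1 := ih (hf.pd 1)
    rw [hs_succ, Finset.sum_range_succ', dn_zero, pow_succ]
    have p1 : (1 : ℝ) ≤ 3 ^ m := one_le_pow₀ (by norm_num)
    have g0 := mul_le_mul_of_nonneg_left (hs' 0) (zero_le_one.trans p1)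
    have g1 := mul_le_mul_of_nonneg_left (hs' 1) (zero_le_one.trans p1)
    have n0 := nn_nonneg f
    have s0 : 0 ≤ ∑ k ∈ Finset.range (m + 1), dn (k + 1) f := Finset.sum_nonneg fun _ _ => dn_nonneg _ _
    have n1 := mul_le_mul_of_nonneg_right p1 n0
    have s1 := mul_nonneg (zero_le_one.trans p1) s0
    nlinarith

section
variable {f : E2 → Fin 3 → ℝ}

theorem iter_comp (hf : ContDiff ℝ ∞ f) (k : ℕ) (a : Fin 3) (x : E2) (v : Fin k → E2) :
    iteratedFDeriv ℝ k (fun y => f y a) x v = iteratedFDeriv ℝ k f x v a := by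
  have := (ContinuousLinearMap.proj (R := ℝ) (φ := fun _ : Fin 3 => ℝ) a).iteratedFDeriv_comp_left (hf.contDiffAt (x := x)) (i := k) (by exact_mod_cast le_top)
  have e' : (fun y => f y a) = (ContinuousLinearMap.proj (R := ℝ) (φ := fun _ : Fin 3 => ℝ) a) ∘ f := rfl
  rw [e', this]
  rfl

theorem iter_comp_le (hf : ContDiff ℝ ∞ f) (k : ℕ) (a : Fin 3) (x : E2) :
    ‖iteratedFDeriv ℝ k (fun y => f y a) x‖ ≤ ‖iteratedFDeriv ℝ k f x‖ := by
  refine ContinuousMultilinearMap.opNorm_le_bound (norm_nonneg _) fun v => ?_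
  rw [iter_comp hf]
  exact (norm_le_pi_norm _ a).trans ((iteratedFDeriv ℝ k f x).le_opNorm v)

theorem iter_le_comp (hf : ContDiff ℝ ∞ f) (k : ℕ) (x : E2) :
    ‖iteratedFDeriv ℝ k f x‖ ≤ ∑ a, ‖iteratedFDeriv ℝ k (fun y => f y a) x‖ := by
  have h0 : 0 ≤ ∑ a, ‖iteratedFDeriv ℝ k (fun y => f y a) x‖ := Finset.sum_nonneg fun _ _ => norm_nonneg _
  refine ContinuousMultilinearMap.opNorm_le_bound h0 fun v => ?_
  have hp : 0 ≤ ∏ i, ‖v i‖ := Finset.prod_nonneg fun _ _ => norm_nonneg _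
  refine (pi_norm_le_iff_of_nonneg (mul_nonneg h0 hp)).2 fun a => ?_
  rw [← iter_comp hf]
  refine ((iteratedFDeriv ℝ k (fun y => f y a) x).le_opNorm v).trans (mul_le_mul_of_nonneg_right ?_ hp)
  exact Finset.single_le_sum (f := fun a => ‖iteratedFDeriv ℝ k (fun y => f y a) x‖) (fun _ _ => norm_nonneg _) (Finset.mem_univ a)

theorem sch_comp (hf : IsSchwartz f) (a : Fin 3) : Sch (fun y => f y a) := by
  refine ⟨contDiff_pi.1 hf.1 a, fun k n => ?_⟩
  obtain ⟨C, hC⟩ := hf.2 k n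
  exact ⟨C, fun x => (mul_le_mul_of_nonneg_left (iter_comp_le hf.1 n a x) (by positivity)).trans (hC x)⟩

theorem dn_comp (hf : IsSchwartz f) (k : ℕ) (a : Fin 3) : dn k (fun y => f y a) ≤ dn k f :=
  dn_mono (sch_comp hf a) hf (iter_comp_le hf.1 k a)

theorem dn_vec (hf : IsSchwartz f) (k : ℕ) : dn k f ≤ 3 * ∑ a, dn k (fun y => f y a) := by
  have ii := fun a => dn_int (sch_comp hf a) k
  have : dn k f ≤ ∫ x, 3 * ∑ a, ‖iteratedFDeriv ℝ k (fun y => f y a) x‖ ^ 2 := by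
    refine integral_mono (dn_int hf k) ((integrable_finset_sum _ fun a _ => ii a).const_mul 3) fun x => ?_
    have h := iter_le_comp hf.1 k x
    have h2 := sq_sum_le_card_mul_sum_sq (s := Finset.univ) (f := fun a => ‖iteratedFDeriv ℝ k (fun y => f y a) x‖)
    simp only [Finset.card_univ, Fintype.card_fin] at h2
    have : ‖iteratedFDeriv ℝ k f x‖ ^ 2 ≤ (∑ a, ‖iteratedFDeriv ℝ k (fun y => f y a) x‖) ^ 2 := by gcongr
    exact this.trans (by exact_mod_cast h2)
  rw [integral_const_mul, integral_finset_sum _ fun a _ => ii a] at this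
  exact this

theorem hSob_sq (m : ℕ) (f : E2 → Fin 3 → ℝ) : hSobNorm m f ^ 2 = ∑ k ∈ Finset.range (m + 1), dn k f := by
  rw [hSobNorm, Real.sq_sqrt]
  · rfl
  · exact Finset.sum_nonneg fun k _ => dn_nonneg k f

theorem hs_le_hSob (m : ℕ) (hf : IsSchwartz f) (a : Fin 3) : hs m (fun y => f y a) ≤ 3 ^ m * hSobNorm m f ^ 2 := by
  rw [hSob_sq]
  refine (hs_le_dn m (sch_comp hf a)).trans (mul_le_mul_of_nonneg_left ?_ (by positivity))
  exact Finset.sum_le_sum fun k _ => dn_comp hf k a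

theorem hSob_le_hs (m : ℕ) (hf : IsSchwartz f) :
    hSobNorm m f ^ 2 ≤ ((m : ℝ) + 1) * (3 * 2 ^ m) * ∑ a, hs m (fun y => f y a) := by
  rw [hSob_sq]
  have : ∀ k ∈ Finset.range (m + 1), dn k f ≤ (3 * 2 ^ m) * ∑ a, hs m (fun y => f y a) := by
    intro k hk
    have hk' : k ≤ m := by have := Finset.mem_range.1 hk; omega
    refine (dn_vec hf k).trans ?_
    rw [mul_assoc]
    refine mul_le_mul_of_nonneg_left ?_ (by norm_num)
    rw [Finset.mul_sum]
    refine Finset.sum_le_sum fun a _ => (dn_le_hs k (sch_comp hf a)).trans ?_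
    exact mul_le_mul (pow_le_pow_right₀ (by norm_num) hk') (hs_mono hk' _) (hs_nonneg _ _) (by positivity)
  refine (Finset.sum_le_sum this).trans (le_of_eq ?_)
  simp
  ring

end

end

end Part16

section Part17
open MeasureTheory Set Filter Topology
open scoped ENNReal ContDiff SchwartzMap

noncomputable section

open Classical in
/-- restriction to `(0,T)` -/
def cut (T : ℝ) (g : TF) : TF := fun t => if t ∈ Ioo 0 T then g t else 0

theorem cut_of {T t : ℝ} (g : TF) (ht : t ∈ Ioo 0 T) : cut T g t = g t := if_pos ht
theorem cut_not {T t : ℝ} (g : TF) (ht : t ∉ Ioo 0 T) : cut T g t = 0 := if_neg ht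

theorem Reg.cut {T : ℝ} {g : TF} (h : ∀ t ∈ Ioo 0 T, Sch (g t))
    (hs : ContDiffOn ℝ ∞ (fun p : ℝ × E2 => g p.1 p.2) (Ico 0 T ×ˢ univ)) : Reg T (cut T g) := by
  refine ⟨fun t => ?_, ?_⟩
  · by_cases ht : t ∈ Ioo 0 T
    · rw [cut_of g ht]; exact h t ht
    · rw [cut_not g ht]; exact Sch.zero
  · refine (hs.mono (prod_mono Ioo_subset_Ico_self le_rfl)).congr fun p hp => ?_
    show _root_.cut T g p.1 p.2 = _
    rw [cut_of g hp.1]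

theorem dt_cut {T t : ℝ} (g : TF) (ht : t ∈ Ioo 0 T) (x : E2) : dt (cut T g) t x = deriv (fun s => g s x) t := by
  refine Filter.EventuallyEq.deriv_eq ?_
  filter_upwards [isOpen_Ioo.mem_nhds ht] with s hs
  rw [cut_of g hs]

/-- components of the cut solution -/
def cc (T : ℝ) (f : ℝ → E2 → Fin 3 → ℝ) (a : Fin 3) : TF := cut T (fun t y => f t y a)

theorem cc_of {T t : ℝ} (f : ℝ → E2 → Fin 3 → ℝ) (a : Fin 3) (ht : t ∈ Ioo 0 T) : cc T f a t = fun y => f t y a :=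
  cut_of _ ht
theorem cc_not {T t : ℝ} (f : ℝ → E2 → Fin 3 → ℝ) (a : Fin 3) (ht : t ∉ Ioo 0 T) : cc T f a t = 0 :=
  cut_not _ ht

theorem div_cc {T : ℝ} {f : ℝ → E2 → Fin 3 → ℝ}
    (h : ∀ t ∈ Ico 0 T, ∀ x, pd 0 (fun y => f t y 0) x + pd 1 (fun y => f t y 1) x = 0) (t : ℝ) :
    pd 1 (cc T f 1 t) = -pd 0 (cc T f 0 t) := by
  by_cases ht : t ∈ Ioo 0 T
  · rw [cc_of f 1 ht, cc_of f 0 ht]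
    ext x
    have := h t ⟨ht.1.le, ht.2⟩ x
    simp only [Pi.neg_apply]
    linarith
  · rw [cc_not f 1 ht, cc_not f 0 ht, pd_zero, pd_zero, neg_zero]

theorem adv_cc {T t : ℝ} (f g : ℝ → E2 → Fin 3 → ℝ) (a : Fin 3) (ht : t ∈ Ioo 0 T) (x : E2) :
    adv (cc T f) (cc T g) a t x = advect (f t) (g t) x a := by
  simp only [adv, cc_of _ _ ht, advect, Pi.add_apply, Pi.mul_apply]

theorem CE_cc {T t : ℝ} (b : ℝ → E2 → Fin 3 → ℝ) (a : Fin 3) (ht : t ∈ Ioo 0 T) (x : E2) :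
    CE (cc T b) a t x = curl (fun y => crossProduct (curl (b t) y) (b t y)) x a := by
  have j0 : J0 (cc T b) t = fun y => curl (b t) y 0 := by
    ext y; simp [J0, D, cc_of _ _ ht, curl]
  have j1 : J1 (cc T b) t = fun y => curl (b t) y 1 := by
    ext y; simp [J1, D, cc_of _ _ ht, curl]
  have j2 : J2 (cc T b) t = fun y => curl (b t) y 2 := by
    ext y; simp [J2, D, cc_of _ _ ht, curl]
  have e0 : Ef0 (cc T b) (cc T b) t = fun y => crossProduct (curl (b t) y) (b t y) 0 := by
    ext y; simp [Ef0, j1, j2, cc_of _ _ ht, cross_apply]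
  have e1 : Ef1 (cc T b) (cc T b) t = fun y => crossProduct (curl (b t) y) (b t y) 1 := by
    ext y; simp [Ef1, j0, j2, cc_of _ _ ht, cross_apply]
  have e2 : Ef2 (cc T b) (cc T b) t = fun y => crossProduct (curl (b t) y) (b t y) 2 := by
    ext y; simp [Ef2, j0, j1, cc_of _ _ ht, cross_apply]
  unfold CE
  conv_rhs => unfold curl
  fin_cases a
  · show pd 1 (Ef2 (cc T b) (cc T b) t) x = _
    rw [e2]; rfl
  · show -pd 0 (Ef2 (cc T b) (cc T b) t) x = _
    rw [e2]; rfl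
  · show pd 0 (Ef1 (cc T b) (cc T b) t) x - pd 1 (Ef0 (cc T b) (cc T b) t) x = _
    rw [e1, e0]; rfl

theorem GP_cc {T t : ℝ} (π : TF) (a : Fin 3) (ht : t ∈ Ioo 0 T) (x : E2) :
    GP (cut T π) a t x = ![pd 0 (π t) x, pd 1 (π t) x, 0] a := by
  fin_cases a
  · show pd 0 (cut T π t) x = _
    rw [cut_of π ht]; rfl
  · show pd 1 (cut T π t) x = _
    rw [cut_of π ht]; rfl
  · rfl

theorem Sol.of {T : ℝ} {u b : ℝ → E2 → Fin 3 → ℝ} {π : TF} (h : IsHallMHDSolution 1 1 1 (Ico 0 T) u b π) :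
    Sol T (cc T u) (cc T b) (cut T π) where
  ru a := Reg.cut (fun t ht => sch_comp (h.schwartz_u t ⟨ht.1.le, ht.2⟩) a) (contDiffOn_pi.1 h.smooth_u a)
  rb a := Reg.cut (fun t ht => sch_comp (h.schwartz_b t ⟨ht.1.le, ht.2⟩) a) (contDiffOn_pi.1 h.smooth_b a)
  rp := Reg.cut (fun t ht => h.schwartz_pi t ⟨ht.1.le, ht.2⟩) h.smooth_pi
  du := div_cc h.div_u
  db := div_cc h.div_b
  eu t ht a := by
    ext x
    have := h.momentum t ⟨ht.1.le, ht.2⟩ x a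
    have e : dt (cc T u a) t x = _ := dt_cut (fun t y => u t y a) ht x
    simp only [Pi.add_apply, Pi.sub_apply]
    rw [e, adv_cc u u a ht, adv_cc b b a ht, GP_cc π a ht, cc_of u a ht]
    linarith
  eb t ht a := by
    ext x
    have := h.induction t ⟨ht.1.le, ht.2⟩ x a
    have e : dt (cc T b a) t x = _ := dt_cut (fun t y => b t y a) ht x
    simp only [Pi.add_apply, Pi.sub_apply]
    rw [e, adv_cc u b a ht, adv_cc b u a ht, CE_cc b a ht, cc_of b a ht]
    linarith

theorem LB_cc {T : ℝ} {m : ℕ} {f g : ℝ → E2 → Fin 3 → ℝ} (hf : ∀ t ∈ Ico 0 T, IsSchwartz (f t))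
    (h : ∀ T' ∈ Ico (0 : ℝ) T, ∃ C : ℝ, ∀ t ∈ Icc (0 : ℝ) T', hSobNorm m (f t) + hSobNorm m (g t) ≤ C) (a : Fin 3) :
    HP (LB T) m (cc T f a) := by
  intro t0 t1 h0 h1 h2
  obtain ⟨C, hC⟩ := h t1 ⟨by linarith, h2⟩
  refine ⟨3 ^ m * C ^ 2, by positivity, fun t ht => ?_⟩
  have ht' : t ∈ Ioo 0 T := ⟨by linarith [ht.1], by linarith [ht.2]⟩
  show hs m (cc T f a t) ≤ _
  rw [cc_of f a ht']
  refine (hs_le_hSob m (hf t ⟨ht'.1.le, ht'.2⟩) a).trans ?_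
  have n1 : 0 ≤ hSobNorm m (f t) := Real.sqrt_nonneg _
  have n2 : 0 ≤ hSobNorm m (g t) := Real.sqrt_nonneg _
  have : hSobNorm m (f t) ≤ C := by linarith [hC t ⟨ht'.1.le, ht.2⟩]
  gcongr

theorem lpn_eq {p : ℝ≥0∞} (hp : 2 < p) (hp' : p ≠ ⊤) {F : E2 → ℝ} (hF : Sch F) :
    eLpNorm F p volume = ENNReal.ofReal (lpn p.toReal F) := by
  have h0 : p ≠ 0 := (lt_trans (by norm_num) hp).ne'
  rw [(hF.memLp p).eLpNorm_eq_integral_rpow_norm h0 hp']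
  simp [lpn, one_div]

theorem TI_lpn {T : ℝ} (hT : 0 < T) {f : TF} (hf : Reg T f) {p : ℝ≥0∞} (hp : 2 < p) (hp' : p ≠ ⊤) {r : ℝ} (hr : 2 ≤ r)
    (h : ∫⁻ t in Ioo 0 T, (eLpNorm (f t) p volume) ^ r < ⊤) :
    TI T (fun t => lpn p.toReal (f t) ^ 2) := by
  have h0 : p ≠ 0 := (lt_trans (by norm_num) hp).ne'
  let F : ℝ × E2 → ℝ := indicator (Ioo 0 T ×ˢ univ) (fun p => f p.1 p.2)
  have hF : Measurable F := aesm_integral.measurable_of_continuousOn_compl_singleton_aux hf.contOn (isOpen_slab T)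
  have hFt : ∀ t ∈ Ioo 0 T, (fun x => F (t, x)) = f t := fun t ht => by
    ext x; simp only [F]; rw [indicator_of_mem (slab_mem ht x)]
  have hm : Measurable (fun t => (eLpNorm (fun x => F (t, x)) p volume) ^ r) := by
    have : (fun t => (eLpNorm (fun x => F (t, x)) p volume) ^ r) =
        fun t => ((∫⁻ x, ‖F (t, x)‖ₑ ^ p.toReal) ^ (1 / p.toReal)) ^ r := by
      ext t; rw [eLpNorm_eq_lintegral_rpow_enorm_toReal h0 hp']
    rw [this]
    have : Measurable (fun t => ∫⁻ x, ‖F (t, x)‖ₑ ^ p.toReal) := (hF.enorm.pow_const _).lintegral_prod_right'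
    exact (this.pow_const _).pow_const _
  have hi : ∫⁻ t in Ioo 0 T, (eLpNorm (fun x => F (t, x)) p volume) ^ r ≠ ⊤ := by
    rw [setLIntegral_congr_fun (g := fun t => (eLpNorm (f t) p volume) ^ r) measurableSet_Ioo]
    · exact h.ne
    · intro t ht; simp only [hFt t ht]
  have hI := integrable_toReal_of_lintegral_ne_top hm.aemeasurable hi
  have hT2 : T / 2 ∈ Ioo 0 T := ⟨by linarith, by linarith⟩
  have hsub : Ioo (T / 2) T ⊆ Ioo 0 T := Ioo_subset_Ioo_left hT2.1.le
  refine ⟨T / 2, hT2, fun t => 1 + ((eLpNorm (fun x => F (t, x)) p volume) ^ r).toReal, ?_, fun t ht => ⟨by positivity, ?_⟩⟩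
  · exact (integrableOn_const (by simp)).add (IntegrableOn.mono_set hI hsub)
  · have hl := lpn_nonneg p.toReal (f t)
    show lpn p.toReal (f t) ^ 2 ≤ 1 + (eLpNorm (fun x => F (t, x)) p volume ^ r).toReal
    rw [hFt t (hsub ht), lpn_eq hp hp' (hf.sch t), ENNReal.ofReal_rpow_of_nonneg hl (by linarith), ENNReal.toReal_ofReal (by positivity)]
    set y := lpn p.toReal (f t)
    rcases le_total y 1 with h1 | h1
    · have : 0 ≤ y ^ r := by positivity
      nlinarith
    · have : y ^ (2 : ℝ) ≤ y ^ r := Real.rpow_le_rpow_of_exponent_le h1 hr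
      rw [Real.rpow_two] at this
      linarith

theorem final_aux {m : ℕ} (hm : 2 < m) {T : ℝ} (hT : 0 < T)
    {u b : ℝ → E2 → Fin 3 → ℝ} {π : TF}
    (hsol : IsHallMHDSolution 1 1 1 (Ico 0 T) u b π)
    (hloc : ∀ T' ∈ Ico (0 : ℝ) T, ∃ C : ℝ, ∀ t ∈ Icc (0 : ℝ) T', hSobNorm m (u t) + hSobNorm m (b t) ≤ C)
    (hcrit : ∀ k : Fin 2, ∃ (p : ℝ≥0∞) (r : ℝ), 2 < p ∧ p ≠ ⊤ ∧ 2 ≤ r ∧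
      2 / p + 2 / ENNReal.ofReal r ≤ 1 ∧
      ∫⁻ t in Ico (0 : ℝ) T,
        (eLpNorm (fun x => lap (lap (fun y => u t y k.castSucc)) x) p volume) ^ r < ⊤) :
    ∃ A, Ctx T (cc T u) (cc T b) (cut T π) m A := by
  have S := Sol.of hsol
  have lu : ∀ a, HP (LB T) m (cc T u a) := LB_cc hsol.schwartz_u hloc
  have lb : ∀ a, HP (LB T) m (cc T b a) := LB_cc hsol.schwartz_b (g := u) (fun T' hT' => by
    obtain ⟨C, hC⟩ := hloc T' hT'
    exact ⟨C, fun t ht => by linarith [hC t ht]⟩)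
  have L0 := (S.L0 hT (fun a => (lu a).le (clsL T) hm) (fun a => (lb a).le (clsL T) hm)).1
  have key : ∀ k : Fin 2, ∃ A : ℝ → ℝ, (∀ t, 0 ≤ A t) ∧ TI T (fun t => A t ^ 2) ∧
      ∀ t ∈ Ioo 0 T, wb 3 (A t) (cc T u k.castSucc t) := by
    intro k
    obtain ⟨p, r, hp, hp', hr, -, hi⟩ := hcrit k
    have hpr : 2 < p.toReal := by
      have := (ENNReal.toReal_lt_toReal (by norm_num) hp').2 hp
      simpa using this
    obtain ⟨C, hC, hw⟩ := sup_bilap hpr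
    have R := S.ru k.castSucc
    let f : TF := fun t => lap (lap (cc T u k.castSucc t))
    have rlap : ∀ {g : TF}, Reg T g → Reg T (fun t => lap (g t)) := fun hg => ((hg.D 0).D 0).add ((hg.D 1).D 1)
    have hf : Reg T f := rlap (rlap R)
    have hfi : ∫⁻ t in Ioo 0 T, (eLpNorm (f t) p volume) ^ r < ⊤ := by
      refine lt_of_le_of_lt ?_ hi
      refine le_trans (le_of_eq ?_) (lintegral_mono_set Ioo_subset_Ico_self)
      refine setLIntegral_congr_fun measurableSet_Ioo fun t ht => ?_
      simp only [f, cc_of u _ ht]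
    have h1 := TI_lpn hT hf hp hp' hr hfi
    have h2 : TI T (fun t => nn (cc T u k.castSucc t)) := TB.toTI (L0 k.castSucc).1
    refine ⟨fun t => C * (√(nn (cc T u k.castSucc t)) + lpn p.toReal (f t)), fun t => ?_, ?_, fun t ht => hw _ (R.sch t)⟩
    · exact mul_nonneg hC (add_nonneg (Real.sqrt_nonneg _) (lpn_nonneg _ _))
    · refine TI.mono (TI.const_mul (c := 2 * C ^ 2) (by positivity) (h2.add h1)) fun t _ => ?_
      have e := Real.sq_sqrt (nn_nonneg (cc T u k.castSucc t))
      show (C * (√(nn (cc T u k.castSucc t)) + lpn p.toReal (f t))) ^ 2 ≤ 2 * C ^ 2 * (nn (cc T u k.castSucc t) + lpn p.toReal (f t) ^ 2)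
      rw [mul_pow, mul_comm 2 (C ^ 2), mul_assoc]
      refine mul_le_mul_of_nonneg_left ?_ (sq_nonneg C)
      nlinarith [sq_nonneg (√(nn (cc T u k.castSucc t)) - lpn p.toReal (f t))]
  choose A hA0 hA hw using key
  refine ⟨fun t => A 0 t + A 1 t, hT, S, hm, lu, lb, ?_, fun t ht k => ?_⟩
  · refine TI.mono (TI.const_mul (c := 2) (by norm_num) ((hA 0).add (hA 1))) fun t _ => ?_
    show (A 0 t + A 1 t) ^ 2 ≤ 2 * (A 0 t ^ 2 + A 1 t ^ 2)
    nlinarith [sq_nonneg (A 0 t - A 1 t)]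
  · refine wb.mono_A ?_ (hw k t ht)
    have h0 := hA0 0 t
    have h1 := hA0 1 t
    fin_cases k
    · show A 0 t ≤ A 0 t + A 1 t
      linarith
    · show A 1 t ≤ A 0 t + A 1 t
      linarith

theorem TB_hSob {T : ℝ} {m : ℕ} {f : ℝ → E2 → Fin 3 → ℝ} (hT : 0 < T) (hf : ∀ t ∈ Ico 0 T, IsSchwartz (f t))
    (h : ∀ a, HP (TB T) m (cc T f a)) : TB T (fun t => hSobNorm m (f t)) := by
  have h1 : TB T (fun t => ∑ a, hs m (cc T f a t)) := TB.sum hT fun a _ => h a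
  have h2 := TB.const_mul (c := ((m : ℝ) + 1) * (3 * 2 ^ m)) (by positivity) h1
  obtain ⟨τ, hτ, B, hB, hb⟩ := h2
  refine ⟨τ, hτ, B + 1, by positivity, fun t ht => ?_⟩
  have ht' : t ∈ Ioo 0 T := ⟨hτ.1.trans ht.1, ht.2⟩
  have := hb t ht
  simp only [cc_of f _ ht'] at this
  have h3 := (hSob_le_hs m (hf t ⟨ht'.1.le, ht'.2⟩)).trans this
  show hSobNorm m (f t) ≤ B + 1
  nlinarith [sq_nonneg (hSobNorm m (f t) - 1)]

end

end Part17

/-- Theorem 2.3, part (2), `Lᵖ` case: regularity criterion for the 2½-dimensional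
Hall-MHD system (with `ν = η = ε = 1`) in terms of the first two components of velocity:
if for both `k ∈ {1,2}` one has `∫₀ᵀ ‖Δ(Δu_k)‖_{L^{p_k}}^{r_k} dt < ∞` with
`2/p_k + 2/r_k ≤ 1`, `p_k ∈ (2,∞)`, then the `Hᵐ` norms of `(u, b)` remain bounded up to
time `T`. -/
theorem regularity_criterion_bilap_u1_u2 (m : ℕ) (hm : 2 < m) (T : ℝ) (hT : 0 < T)
    (u b : ℝ → (Fin 2 → ℝ) → (Fin 3 → ℝ)) (π : ℝ → (Fin 2 → ℝ) → ℝ)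
    (hsol : IsHallMHDSolution 1 1 1 (Set.Ico 0 T) u b π)
    (hloc : ∀ T' ∈ Set.Ico (0 : ℝ) T, ∃ C : ℝ, ∀ t ∈ Set.Icc (0 : ℝ) T',
      hSobNorm m (u t) + hSobNorm m (b t) ≤ C)
    (hcrit : ∀ k : Fin 2, ∃ (p : ℝ≥0∞) (r : ℝ), 2 < p ∧ p ≠ ⊤ ∧ 2 ≤ r ∧
      2 / p + 2 / ENNReal.ofReal r ≤ 1 ∧
      ∫⁻ t in Set.Ico (0 : ℝ) T,
        (eLpNorm (fun x => lap (lap (fun y => u t y k.castSucc)) x) p volume) ^ r < ⊤) :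
    ∃ C : ℝ, ∀ t ∈ Set.Ico (0 : ℝ) T,
      hSobNorm m (u t) + hSobNorm m (b t) ≤ C := by
  obtain ⟨A, c⟩ := final_aux hm hT hsol hloc hcrit
  obtain ⟨h1, h2⟩ := c.final
  obtain ⟨τ, hτ, B, hB, hb⟩ := (TB_hSob hT hsol.schwartz_u h1).add (TB_hSob hT hsol.schwartz_b h2)
  obtain ⟨C, hC⟩ := hloc τ ⟨hτ.1.le, hτ.2⟩
  refine ⟨max B C, fun t ht => ?_⟩
  rcases le_or_gt t τ with h | h
  · exact (hC t ⟨ht.1, h⟩).trans (le_max_right _ _)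
  · exact (hb t ⟨h, ht.2⟩).trans (le_max_left _ _)
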